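/- arXiv:1410.2626 — 3 statements merged into one kernel-verified Lean document; each statement's English description precedes it below -/
import Mathlib

section
/- Let m ≥ 1 and let R be a finite subset of the free group F_m such that the quotient group F_m/⟨⟨R⟩⟩ is abelian (equivalently, F_m/⟨⟨R⟩⟩ is a finitely generated abelian group presented by R). Then R is stable in permutations. -/
open Filter Topology

/-- The normalized Hamming distance between two permutations of `Fin n`
(interpreted as `0` when `n = 0`). -/
noncomputable def dH {n : ℕ} (p q : Equiv.Perm (Fin n)) : ℝ :=
  ((Finset.univ.filter fun i => p i ≠ q i).card : ℝ) / n

/-- Evaluation of a word `ξ` of the free group on `m` generators at a tuple of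
elements of a group `H`: the image of `ξ` under the unique homomorphism sending
the `i`-th generator to `p i`. -/
def evalWord {m : ℕ} {H : Type*} [Group H] (ξ : FreeGroup (Fin m)) (p : Fin m → H) : H :=
  FreeGroup.lift p ξ

/-- A finite set of words `R ⊆ F_m` is stable in permutations. -/
def IsStable {m : ℕ} (R : Finset (FreeGroup (Fin m))) : Prop :=
  ∀ ε : ℝ, 0 < ε → ∃ δ : ℝ, 0 < δ ∧
    ∀ (n : ℕ) (p : Fin m → Equiv.Perm (Fin n)),
      (∀ ξ ∈ R, dH (evalWord ξ p) 1 < δ) →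
      ∃ q : Fin m → Equiv.Perm (Fin n),
        (∀ ξ ∈ R, evalWord ξ q = 1) ∧ ∀ i, dH (p i) (q i) < ε

open Finset

theorem compact_subgroups {G : Type} [Group G] (N : Subgroup G) (B : Subgroup G → Finset G) :
    ∃ (𝒦 : Finset (Subgroup G)) (W : Finset G),
      ∀ S : Subgroup G, (∀ w ∈ W, w ∈ N → w ∈ S) →
        ∃ K ∈ 𝒦, N ≤ K ∧ ∀ b ∈ B K, (b ∈ S ↔ b ∈ K) := by
  classical
  by_contra hcon
  push Not at hcon
  have hcon' : ∀ i : Finset (Subgroup G) × Finset G, ∃ S : Subgroup G,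
      (∀ w ∈ i.2, w ∈ N → w ∈ S) ∧ ∀ K ∈ i.1, N ≤ K → ¬ ∀ b ∈ B K, (b ∈ S ↔ b ∈ K) := by
    intro i
    obtain ⟨S, h1, h2⟩ := hcon i.1 i.2
    refine ⟨S, h1, fun K hK hN hall => ?_⟩
    obtain ⟨b, hb, h3⟩ := h2 K hK hN
    have := hall b hb
    tauto
  choose S hS1 hS2 using hcon'
  let U : Ultrafilter (Finset (Subgroup G) × Finset G) := Ultrafilter.of Filter.atTop
  have hU : (U : Filter (Finset (Subgroup G) × Finset G)) ≤ Filter.atTop := Ultrafilter.of_le _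
  let K : Subgroup G :=
    { carrier := {g | ∀ᶠ i in (U : Filter _), g ∈ S i}
      one_mem' := Filter.Eventually.of_forall fun i => (S i).one_mem
      mul_mem' := by
        intro a b ha hb
        filter_upwards [ha, hb] with i h1 h2 using (S i).mul_mem h1 h2
      inv_mem' := by
        intro a ha
        filter_upwards [ha] with i h1 using (S i).inv_mem h1 }
  have hKmem : ∀ g, g ∈ K ↔ ∀ᶠ i in (U : Filter _), g ∈ S i := fun g => Iff.rfl
  have hNK : N ≤ K := by
    intro g hg
    rw [hKmem]
    refine hU ((Filter.eventually_ge_atTop (∅, {g})).mono ?_)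
    intro i hi
    exact hS1 i g (hi.2 (by simp)) hg
  have h1 : ∀ᶠ i in (U : Filter (Finset (Subgroup G) × Finset G)), K ∈ i.1 := by
    refine hU ((Filter.eventually_ge_atTop ({K}, ∅)).mono ?_)
    intro i hi
    exact hi.1 (by simp)
  have h2 : ∀ᶠ i in (U : Filter _), ∀ b ∈ B K, (b ∈ S i ↔ b ∈ K) := by
    rw [Filter.eventually_all_finset]
    intro b hb
    by_cases hbK : b ∈ K
    · filter_upwards [(hKmem b).1 hbK] with i hi
      tauto
    · have := hbK
      rw [hKmem, ← Ultrafilter.eventually_not] at this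
      filter_upwards [this] with i hi
      tauto
  obtain ⟨i, h3, h4⟩ := (h1.and h2).exists
  exact hS2 i K h3 hNK h4

/-- Existence of Folner tiles with uniformly bounded doubling. -/
def HasTiles (Q : Type) [Group Q] : Prop :=
  ∃ C : ℕ, 1 ≤ C ∧ ∀ (S : Finset Q) (η : ℝ), 0 < η →
    ∃ (I : Type) (_ : Fintype I) (_ : Nonempty I) (α : Q →* Equiv.Perm I) (σ : I → Q),
      Function.Injective σ ∧
      (∀ s ∈ S, ({i | σ (α s i) ≠ s * σ i}.ncard : ℝ) ≤ η * Fintype.card I) ∧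
      (Set.range fun ij : I × I => (σ ij.1)⁻¹ * σ ij.2).ncard ≤ C * Fintype.card I

theorem HasTiles.of_finite (Q : Type) [Group Q] [Finite Q] : HasTiles Q := by
  classical
  have := Fintype.ofFinite Q
  refine ⟨1, le_rfl, fun S η hη => ⟨Q, inferInstance, ⟨1⟩, MulAction.toPermHom Q Q, id,
    Function.injective_id, ?_, ?_⟩⟩
  · intro s _
    simp
    positivity
  · rw [one_mul, ← Nat.card_eq_fintype_card]
    exact Set.ncard_le_card _

theorem HasTiles.of_equiv {Q Q' : Type} [Group Q] [Group Q'] (e : Q ≃* Q') (h : HasTiles Q) :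
    HasTiles Q' := by
  classical
  obtain ⟨C, hC, h⟩ := h
  refine ⟨C, hC, fun S η hη => ?_⟩
  obtain ⟨I, i1, i2, α, σ, h1, h2, h3⟩ := h (S.image e.symm) η hη
  refine ⟨I, i1, i2, α.comp e.symm.toMonoidHom, e ∘ σ, e.injective.comp h1, ?_, ?_⟩
  · intro s hs
    convert h2 (e.symm s) (Finset.mem_image_of_mem _ hs) using 5 with i
    simp [← e.symm.injective.eq_iff]
  · refine le_trans (le_of_eq ?_) h3
    rw [← Set.ncard_image_of_injective _ e.injective, ← Set.range_comp]
    congr 2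
    ext ij
    simp

theorem HasTiles.prod {Q Q' : Type} [Group Q] [Group Q'] (h : HasTiles Q) (h' : HasTiles Q') :
    HasTiles (Q × Q') := by
  classical
  obtain ⟨C, hC, h⟩ := h
  obtain ⟨C', hC', h'⟩ := h'
  refine ⟨C * C', Nat.mul_pos hC hC', fun S η hη => ?_⟩
  obtain ⟨I, i1, i2, α, σ, h1, h2, h3⟩ := h (S.image Prod.fst) (η / 2) (by positivity)
  obtain ⟨I', i1', i2', α', σ', h1', h2', h3'⟩ := h' (S.image Prod.snd) (η / 2) (by positivity)
  refine ⟨I × I', inferInstance, inferInstance,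
    { toFun := fun s => Equiv.prodCongr (α s.1) (α' s.2)
      map_one' := by ext <;> simp
      map_mul' := by intro a b; ext <;> simp }, Prod.map σ σ', h1.prodMap h1', ?_, ?_⟩
  · intro s hs
    have e1 := h2 s.1 (Finset.mem_image_of_mem _ hs)
    have e2 := h2' s.2 (Finset.mem_image_of_mem _ hs)
    have hsub : {i : I × I' | Prod.map σ σ' ((Equiv.prodCongr (α s.1) (α' s.2)) i) ≠
        s * Prod.map σ σ' i} ⊆ ({i | σ (α s.1 i) ≠ s.1 * σ i} ×ˢ Set.univ) ∪
          (Set.univ ×ˢ {i | σ' (α' s.2 i) ≠ s.2 * σ' i}) := by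
      rintro ⟨i, j⟩ hij
      simp [Prod.ext_iff] at hij ⊢
      tauto
    have e3 := (Set.ncard_le_ncard hsub (Set.toFinite _)).trans (Set.ncard_union_le _ _)
    rw [Set.ncard_prod, Set.ncard_prod, Set.ncard_univ, Set.ncard_univ,
      Nat.card_eq_fintype_card, Nat.card_eq_fintype_card] at e3
    have e4 : (({i : I × I' | Prod.map σ σ' ((Equiv.prodCongr (α s.1) (α' s.2)) i) ≠
        s * Prod.map σ σ' i}).ncard : ℝ) ≤ _ := Nat.cast_le.2 e3
    refine e4.trans ?_
    push_cast [Fintype.card_prod]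
    have p1 : (0:ℝ) ≤ Fintype.card I := by positivity
    have p2 : (0:ℝ) ≤ Fintype.card I' := by positivity
    nlinarith [mul_le_mul_of_nonneg_right e1 p2, mul_le_mul_of_nonneg_left e2 p1]
  · have hsub : (Set.range fun ij : (I × I') × (I × I') =>
        (Prod.map σ σ' ij.1)⁻¹ * Prod.map σ σ' ij.2) ⊆
        (Set.range fun ij : I × I => (σ ij.1)⁻¹ * σ ij.2) ×ˢ
        (Set.range fun ij : I' × I' => (σ' ij.1)⁻¹ * σ' ij.2) := by
      rintro _ ⟨⟨⟨a, b⟩, ⟨c, d⟩⟩, rfl⟩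
      exact ⟨⟨(a, c), rfl⟩, ⟨(b, d), rfl⟩⟩
    refine (Set.ncard_le_ncard hsub (Set.toFinite _)).trans ?_
    rw [Set.ncard_prod, Fintype.card_prod]
    calc _ ≤ _ := Nat.mul_le_mul h3 h3'
      _ = _ := by ring

theorem HasTiles.int : HasTiles (Multiplicative ℤ) := by
  classical
  refine ⟨3, by norm_num, fun S η hη => ?_⟩
  obtain ⟨M, hM⟩ : ∃ M : ℕ, ∀ s ∈ S, (s.toAdd).natAbs ≤ M :=
    ⟨S.sup fun s => s.toAdd.natAbs, fun s hs => Finset.le_sup (f := fun s => s.toAdd.natAbs) hs⟩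
  obtain ⟨l, hl⟩ := exists_nat_gt ((M : ℝ) / η)
  have hl0 : 0 < l := by
    have : (0:ℝ) ≤ (M : ℝ) / η := by positivity
    exact_mod_cast this.trans_lt hl
  have : NeZero l := ⟨hl0.ne'⟩
  have hMl : (M : ℝ) ≤ η * l := by
    rw [div_lt_iff₀ hη] at hl
    linarith
  refine ⟨ZMod l, inferInstance, inferInstance,
    { toFun := fun s => Equiv.addLeft ((s.toAdd : ℤ) : ZMod l)
      map_one' := by ext; simp
      map_mul' := by intro a b; ext; simp },
    fun i => Multiplicative.ofAdd (i.val : ℤ), ?_, ?_, ?_⟩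
  · intro i j hij
    have : (i.val : ℤ) = j.val := Multiplicative.ofAdd.injective hij
    exact ZMod.val_injective l (by exact_mod_cast this)
  · intro s hs
    rw [ZMod.card]
    refine le_trans ?_ hMl
    have hs' := hM s hs
    set t : ℤ := s.toAdd with ht
    refine le_trans ?_ (Nat.cast_le.2 hs')
    rw [Nat.cast_le]
    have hinj : Function.Injective fun i : ZMod l => (i.val : ℤ) := by
      intro i j hij
      exact ZMod.val_injective l (Int.ofNat_injective hij)
    rw [← Set.ncard_image_of_injective _ hinj]
    have key : ∀ i : ZMod l, 0 ≤ t + i.val → t + i.val < l →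
        (((t : ZMod l) + i).val : ℤ) = t + i.val := by
      intro i h1 h2
      have h3 : ((t : ZMod l) + i) = ((t + (i.val : ℤ) : ℤ) : ZMod l) := by simp
      rw [h3, ZMod.val_intCast, Int.emod_eq_of_lt h1 h2]
    have hsub : ((fun i : ZMod l => (i.val : ℤ)) '' {i : ZMod l |
        Multiplicative.ofAdd ((((t : ZMod l) + i).val : ℤ)) ≠
          s * Multiplicative.ofAdd (i.val : ℤ)}) ⊆
        ((if 0 ≤ t then Finset.Ico (l - t) l else Finset.Ico 0 (-t) : Finset ℤ) : Set ℤ) := by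
      rintro _ ⟨i, hi, rfl⟩
      have hi' : ¬ (0 ≤ t + i.val ∧ t + i.val < l) := by
        rintro ⟨h1, h2⟩
        apply hi
        rw [key i h1 h2]
        rfl
      have h3 := ZMod.val_lt i
      split_ifs with h <;>
        simp only [Finset.coe_Ico, Set.mem_Ico] <;> omega
    refine (Set.ncard_le_ncard hsub (Finset.finite_toSet _)).trans ?_
    rw [Set.ncard_coe_finset]
    split_ifs with h <;> simp only [Int.card_Ico] <;> omega
  · rw [ZMod.card]
    have hsub : (Set.range fun ij : ZMod l × ZMod l =>
        (Multiplicative.ofAdd (ij.1.val : ℤ))⁻¹ * Multiplicative.ofAdd (ij.2.val : ℤ)) ⊆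
        Multiplicative.ofAdd '' ((Finset.Icc (-l : ℤ) l : Finset ℤ) : Set ℤ) := by
      rintro _ ⟨⟨i, j⟩, rfl⟩
      refine ⟨-(i.val : ℤ) + j.val, ?_, rfl⟩
      have h3 := ZMod.val_lt i
      have h4 := ZMod.val_lt j
      simp only [Finset.coe_Icc, Set.mem_Icc]
      omega
    refine (Set.ncard_le_ncard hsub ((Finset.finite_toSet _).image _)).trans ?_
    refine (Set.ncard_image_le (Finset.finite_toSet _)).trans ?_
    rw [Set.ncard_coe_finset]
    simp
    omega

theorem HasTiles.pi (j : Type) [Finite j] : HasTiles (j → Multiplicative ℤ) := by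
  induction j using Finite.induction_empty_option with
  | of_equiv e h => exact h.of_equiv (MulEquiv.arrowCongr e (MulEquiv.refl _))
  | h_empty => exact HasTiles.of_finite _
  | h_option h =>
    refine (HasTiles.int.prod h).of_equiv
      { toFun := fun x i => Option.elim i x.1 x.2
        invFun := fun f => (f none, fun i => f (some i))
        left_inv := fun x => rfl
        right_inv := fun f => by ext i; cases i <;> rfl
        map_mul' := fun x y => by ext i; cases i <;> rfl }

theorem HasTiles.of_comm (Q : Type) [CommGroup Q] [Group.FG Q] : HasTiles Q := by
  obtain ⟨ι, j, _, _, p, hp, e, ⟨f⟩⟩ := CommGroup.equiv_free_prod_prod_multiplicative_zmod Q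
  have : ∀ i, NeZero (p i ^ e i) := fun i => ⟨(pow_pos (hp i).pos _).ne'⟩
  exact ((HasTiles.pi j).prod (HasTiles.of_finite _)).of_equiv f.symm

/-- `D` carries an action of `G`, trivial on `N`, close to `ρ` on `S`. -/
def GoodSet {G X : Type} [Group G] (ρ : G →* Equiv.Perm X) (N : Subgroup G)
    (S : Finset G) (θ : ℝ) (D : Set X) : Prop :=
  ∃ φ : G →* Equiv.Perm X, (∀ g ∈ N, φ g = 1) ∧ (∀ g, ∀ x, x ∉ D → φ g x = x) ∧
    ∀ s ∈ S, ({d | d ∈ D ∧ φ s d ≠ ρ s d}.ncard : ℝ) ≤ θ * D.ncard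

theorem GoodSet.empty {G X : Type} [Group G] (ρ : G →* Equiv.Perm X) (N : Subgroup G)
    (S : Finset G) (θ : ℝ) : GoodSet ρ N S θ ∅ :=
  ⟨1, by simp, by simp, by simp⟩

theorem GoodSet.mono {G X : Type} [Group G] {ρ : G →* Equiv.Perm X} {N : Subgroup G}
    {S S' : Finset G} {θ θ' : ℝ} {D : Set X} (h : GoodSet ρ N S θ D) (hS : S' ⊆ S)
    (hθ : θ ≤ θ') : GoodSet ρ N S' θ' D := by
  obtain ⟨φ, h1, h2, h3⟩ := h
  exact ⟨φ, h1, h2, fun s hs => (h3 s (hS hs)).trans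
    (mul_le_mul_of_nonneg_right hθ (Nat.cast_nonneg _))⟩

theorem GoodSet.union {G X : Type} [Group G] [Finite X] {ρ : G →* Equiv.Perm X} {N : Subgroup G}
    {S : Finset G} {θ : ℝ} {D D' : Set X} (h : GoodSet ρ N S θ D) (h' : GoodSet ρ N S θ D')
    (hd : Disjoint D D') : GoodSet ρ N S θ (D ∪ D') := by
  obtain ⟨φ, h1, h2, h3⟩ := h
  obtain ⟨φ', h1', h2', h3'⟩ := h'
  have hcomm : ∀ a b, Commute (φ a) (φ' b) := by
    intro a b
    apply Equiv.Perm.Disjoint.commute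
    intro x
    by_cases hx : x ∈ D
    · exact Or.inr (h2' b x (Set.disjoint_left.1 hd hx))
    · exact Or.inl (h2 a x hx)
  have hinv : ∀ g x, x ∈ D' → φ' g x ∈ D' := by
    intro g x hx
    by_contra hcon
    have e := h2' g⁻¹ _ hcon
    rw [← Equiv.Perm.mul_apply, ← map_mul, inv_mul_cancel, map_one, Equiv.Perm.one_apply] at e
    exact hcon (e ▸ hx)
  refine ⟨{ toFun := fun g => φ g * φ' g, map_one' := by simp, map_mul' := ?_ }, ?_, ?_, ?_⟩
  · intro a b
    rw [map_mul, map_mul, mul_assoc, mul_assoc, ← mul_assoc (φ b), (hcomm b a).eq, mul_assoc]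
  · intro g hg
    simp [h1 g hg, h1' g hg]
  · intro g x hx
    simp only [Set.mem_union, not_or] at hx
    simp [h2' g x hx.2, h2 g x hx.1]
  · intro s hs
    have hsub : {d | d ∈ D ∪ D' ∧ (φ s * φ' s) d ≠ ρ s d} ⊆
        {d | d ∈ D ∧ φ s d ≠ ρ s d} ∪ {d | d ∈ D' ∧ φ' s d ≠ ρ s d} := by
      rintro d ⟨hd1 | hd1, hne⟩
      · left
        refine ⟨hd1, ?_⟩
        rwa [Equiv.Perm.mul_apply, h2' s d (Set.disjoint_left.1 hd hd1)] at hne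
      · right
        refine ⟨hd1, ?_⟩
        rwa [Equiv.Perm.mul_apply,
          h2 s _ (Set.disjoint_right.1 hd (hinv s d hd1))] at hne
    have e1 := (Set.ncard_le_ncard hsub (Set.toFinite _)).trans (Set.ncard_union_le _ _)
    have e2 : (({d | d ∈ D ∪ D' ∧ (φ s * φ' s) d ≠ ρ s d}).ncard : ℝ) ≤ _ := Nat.cast_le.2 e1
    refine e2.trans ?_
    rw [Set.ncard_union_eq hd (Set.toFinite _) (Set.toFinite _)]
    push_cast
    linarith [h3 s hs, h3' s hs]

theorem GoodSet.tile {G X : Type} [Group G] [Finite X] {ρ : G →* Equiv.Perm X} {N : Subgroup G}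
    {S : Finset G} {θ : ℝ} {I : Type} [Fintype I] (α : G →* Equiv.Perm I) (σ : I → G)
    (hα : ∀ g ∈ N, α g = 1) (z : X)
    (h1 : Function.Injective fun i => ρ (σ i) z)
    (h2 : ∀ s ∈ S, ({i | ρ (σ (α s i)) z ≠ ρ (s * σ i) z}.ncard : ℝ) ≤ θ * Fintype.card I) :
    GoodSet ρ N S θ (Set.range fun i => ρ (σ i) z) := by
  let ι : I ↪ X := ⟨fun i => ρ (σ i) z, h1⟩
  refine ⟨(Equiv.Perm.viaEmbeddingHom ι).comp α, ?_, ?_, ?_⟩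
  · intro g hg
    simp [hα g hg]
  · intro g x hx
    exact Equiv.Perm.viaEmbedding_apply_of_notMem _ ι x hx
  · intro s hs
    have hc : (Set.range fun i => ρ (σ i) z).ncard = Fintype.card I := by
      rw [← Set.image_univ, Set.ncard_image_of_injective _ h1, Set.ncard_univ,
        Nat.card_eq_fintype_card]
    rw [hc]
    refine le_trans ?_ (h2 s hs)
    rw [Nat.cast_le, ← Set.ncard_image_of_injective _ h1]
    refine Set.ncard_le_ncard ?_ (Set.toFinite _)
    rintro _ ⟨⟨i, rfl⟩, hi⟩
    refine ⟨i, ?_, rfl⟩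
    intro heq
    apply hi
    have e := Equiv.Perm.viaEmbedding_apply (α s) ι i
    change ((α s).viaEmbedding ι) (ι i) = _
    rw [e]
    change ρ (σ (α s i)) z = _
    rw [heq, map_mul]
    rfl

theorem pack_step {G X : Type} [Group G] [Finite X] {ρ : G →* Equiv.Perm X} {N : Subgroup G}
    {S : Finset G} {θ : ℝ} {I : Type} [Fintype I] [Nonempty I]
    (α : G →* Equiv.Perm I) (σ : I → G) (C : ℕ) (hC : 1 ≤ C)
    (hα : ∀ g ∈ N, α g = 1) (Y E D : Set X) (hDY : D ⊆ Y) (hD : GoodSet ρ N S θ D)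
    (h0 : ∀ z ∈ Y, z ∉ E → ∀ i, ρ (σ i) z ∈ Y)
    (h1 : ∀ z ∈ Y, z ∉ E → Function.Injective fun i => ρ (σ i) z)
    (h2 : ∀ z ∈ Y, z ∉ E → ∀ s ∈ S,
      ({i | ρ (σ (α s i)) z ≠ ρ (s * σ i) z}.ncard : ℝ) ≤ θ * Fintype.card I)
    (h3 : ∀ z ∈ Y, z ∉ E →
      (Set.range fun ij : I × I => ρ ((σ ij.1)⁻¹ * σ ij.2) z).ncard ≤ C * Fintype.card I) :
    ∃ D', D' ⊆ Y ∧ GoodSet ρ N S θ D' ∧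
      ((Y \ D').ncard : ℝ) ≤ (1 - 1 / (C : ℝ)) * (Y \ D).ncard + E.ncard +
        {y | y ∉ D ∧ ∃ i, ρ (σ i) y ∈ D}.ncard := by
  classical
  let P : Set (Set X) := {D' | D ⊆ D' ∧ D' ⊆ Y ∧ GoodSet ρ N S θ D' ∧ ∃ Z : Finset X,
    (∀ z ∈ Z, z ∈ Y ∧ z ∉ E ∧ ∀ i, ρ (σ i) z ∈ D') ∧ D'.ncard = D.ncard + Z.card * Fintype.card I ∧
    ∀ x ∈ D', x ∈ D ∨ ∃ z ∈ Z, ∃ i, x = ρ (σ i) z}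
  have hP : P.Nonempty := ⟨D, le_rfl, hDY, hD, ∅, by simp, by simp, fun x hx => Or.inl hx⟩
  obtain ⟨D', ⟨hDD', hD'Y, hG, Z, hZ, hcard, hcov⟩, hmax⟩ :=
    Set.exists_max_image P Set.ncard (Set.toFinite _) hP
  refine ⟨D', hD'Y, hG, ?_⟩
  have hmeet : ∀ y ∈ Y, y ∉ E → ∃ i, ρ (σ i) y ∈ D' := by
    intro y hy hyE
    by_contra hcon
    push Not at hcon
    have hdis : Disjoint D' (Set.range fun i => ρ (σ i) y) := by
      rw [Set.disjoint_right]
      rintro _ ⟨i, rfl⟩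
      exact hcon i
    have hc : (Set.range fun i => ρ (σ i) y).ncard = Fintype.card I := by
      rw [← Set.image_univ, Set.ncard_image_of_injective _ (h1 y hy hyE), Set.ncard_univ,
        Nat.card_eq_fintype_card]
    have hnew := Set.ncard_union_eq hdis (Set.toFinite _) (Set.toFinite _)
    have hpos : 0 < Fintype.card I := Fintype.card_pos
    have hyz : y ∉ Z := fun hyz => hcon (Classical.arbitrary I) ((hZ y hyz).2.2 _)
    have hmem : D' ∪ (Set.range fun i => ρ (σ i) y) ∈ P := by
      refine ⟨hDD'.trans Set.subset_union_left, Set.union_subset hD'Y ?_,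
        hG.union (GoodSet.tile α σ hα y (h1 y hy hyE) (h2 y hy hyE)) hdis, insert y Z, ?_, ?_, ?_⟩
      · rintro _ ⟨i, rfl⟩
        exact h0 y hy hyE i
      · intro z hz
        rcases Finset.mem_insert.1 hz with rfl | hz
        · exact ⟨hy, hyE, fun i => Or.inr ⟨i, rfl⟩⟩
        · exact ⟨(hZ z hz).1, (hZ z hz).2.1, fun i => Or.inl ((hZ z hz).2.2 i)⟩
      · rw [hnew, hcard, hc, Finset.card_insert_of_notMem hyz]
        ring
      · rintro x (hx | ⟨i, rfl⟩)
        · rcases hcov x hx with h | ⟨z, hz, i, rfl⟩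
          · exact Or.inl h
          · exact Or.inr ⟨z, Finset.mem_insert_of_mem hz, i, rfl⟩
        · exact Or.inr ⟨y, Finset.mem_insert_self _ _, i, rfl⟩
    have := hmax _ hmem
    rw [hnew, hc] at this
    omega
  have hsub : Y \ D ⊆ E ∪ ({y | y ∉ D ∧ ∃ i, ρ (σ i) y ∈ D} ∪
      ⋃ z ∈ Z, Set.range fun ij : I × I => ρ ((σ ij.1)⁻¹ * σ ij.2) z) := by
    rintro y ⟨hy, hyD⟩
    by_cases hyE : y ∈ E
    · exact Or.inl hyE
    right
    obtain ⟨i, hi⟩ := hmeet y hy hyE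
    rcases hcov _ hi with h | ⟨z, hz, j, hj⟩
    · exact Or.inl ⟨hyD, i, h⟩
    · right
      simp only [Set.mem_iUnion]
      refine ⟨z, hz, (i, j), ?_⟩
      change ρ ((σ i)⁻¹ * σ j) z = y
      rw [map_mul, Equiv.Perm.mul_apply, ← hj, ← Equiv.Perm.mul_apply, ← map_mul,
        inv_mul_cancel, map_one, Equiv.Perm.one_apply]
  have hb : (⋃ z ∈ Z, Set.range fun ij : I × I => ρ ((σ ij.1)⁻¹ * σ ij.2) z).ncard ≤
      Z.card * (C * Fintype.card I) := by
    refine (Finset.set_ncard_biUnion_le _ _).trans ?_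
    refine (Finset.sum_le_card_nsmul _ _ _ fun z hz => h3 z (hZ z hz).1 (hZ z hz).2.1).trans ?_
    simp
  have e1 : (Y \ D).ncard ≤ E.ncard + ({y | y ∉ D ∧ ∃ i, ρ (σ i) y ∈ D}.ncard +
      Z.card * (C * Fintype.card I)) :=
    (Set.ncard_le_ncard hsub (Set.toFinite _)).trans ((Set.ncard_union_le _ _).trans
      (Nat.add_le_add_left ((Set.ncard_union_le _ _).trans (Nat.add_le_add_left hb _)) _))
  have e2 := Set.ncard_sdiff_add_ncard_of_subset hDY (Set.toFinite _)
  have e3 := Set.ncard_sdiff_add_ncard_of_subset hD'Y (Set.toFinite _)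
  have e4 : (Y \ D').ncard + Z.card * Fintype.card I = (Y \ D).ncard := by omega
  have c1 : ((Y \ D).ncard : ℝ) ≤ E.ncard + ({y | y ∉ D ∧ ∃ i, ρ (σ i) y ∈ D}.ncard +
      Z.card * (C * Fintype.card I)) := by exact_mod_cast e1
  have c4 : ((Y \ D').ncard : ℝ) + Z.card * Fintype.card I = (Y \ D).ncard := by exact_mod_cast e4
  have hC' : (1:ℝ) ≤ C := by exact_mod_cast hC
  have hC0 : (0:ℝ) < C := by linarith
  set u : ℝ := ((Y \ D).ncard : ℝ)
  set a : ℝ := (E.ncard : ℝ)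
  set b : ℝ := ({y | y ∉ D ∧ ∃ i, ρ (σ i) y ∈ D}.ncard : ℝ)
  have ha : 0 ≤ a := Nat.cast_nonneg _
  have hb0 : 0 ≤ b := Nat.cast_nonneg _
  have c5 : u / C ≤ (a + b) + (Z.card : ℝ) * Fintype.card I := by
    rw [div_le_iff₀ hC0]
    nlinarith
  have c6 : (1 - 1 / (C : ℝ)) * u = u - u / C := by ring
  rw [c6]
  linarith

theorem tile_lift {G : Type} [Group G] (K : Subgroup G) [K.Normal] (h : HasTiles (G ⧸ K)) :
    ∃ C : ℕ, 1 ≤ C ∧ ∀ (S : Finset G) (η : ℝ), 0 < η →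
    ∃ (I : Type) (_ : Fintype I) (_ : Nonempty I) (α : G →* Equiv.Perm I) (σ : I → G),
      (∀ g ∈ K, α g = 1) ∧ (∀ i j, (σ i)⁻¹ * σ j ∈ K → i = j) ∧
      (∀ s ∈ S, ({i | (σ (α s i))⁻¹ * (s * σ i) ∉ K}.ncard : ℝ) ≤ η * Fintype.card I) ∧
      (Set.range fun ij : I × I => (((σ ij.1)⁻¹ * σ ij.2 : G) : G ⧸ K)).ncard
        ≤ C * Fintype.card I := by
  classical
  obtain ⟨C, hC, h⟩ := h
  refine ⟨C, hC, fun S η hη => ?_⟩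
  obtain ⟨I, i1, i2, α, σ, h1, h2, h3⟩ := h (S.image (QuotientGroup.mk' K)) η hη
  have hout : ∀ q : G ⧸ K, ((Quotient.out q : G) : G ⧸ K) = q := fun q => Quotient.out_eq' q
  refine ⟨I, i1, i2, α.comp (QuotientGroup.mk' K), fun i => (σ i).out, ?_, ?_, ?_, ?_⟩
  · intro g hg
    have : (QuotientGroup.mk' K) g = 1 := (QuotientGroup.eq_one_iff g).2 hg
    rw [MonoidHom.comp_apply, this, map_one]
  · intro i j hij
    rw [← QuotientGroup.eq, hout, hout] at hij
    exact h1 hij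
  · intro s hs
    convert h2 _ (Finset.mem_image_of_mem _ hs) using 5 with i
    rw [← QuotientGroup.eq, hout, QuotientGroup.mk_mul, hout]
    rfl
  · convert h3 using 4 with ij
    rw [QuotientGroup.mk_mul, QuotientGroup.mk_inv, hout, hout]

theorem GoodSet.boundary {G X : Type} [Group G] [Finite X] {ρ : G →* Equiv.Perm X}
    {N : Subgroup G} {S : Finset G} {θ : ℝ} {D : Set X} (h : GoodSet ρ N S θ D) (s : G)
    (hs : s ∈ S) : ({d | d ∈ D ∧ ρ s d ∉ D}.ncard : ℝ) ≤ θ * D.ncard := by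
  obtain ⟨φ, h1, h2, h3⟩ := h
  have hinv : ∀ g x, x ∈ D → φ g x ∈ D := by
    intro g x hx
    by_contra hcon
    have e := h2 g⁻¹ _ hcon
    rw [← Equiv.Perm.mul_apply, ← map_mul, inv_mul_cancel, map_one, Equiv.Perm.one_apply] at e
    exact hcon (e ▸ hx)
  refine le_trans ?_ (h3 s hs)
  rw [Nat.cast_le]
  refine Set.ncard_le_ncard ?_ (Set.toFinite _)
  rintro d ⟨hd, hd'⟩
  refine ⟨hd, fun heq => hd' ?_⟩
  rw [← heq]
  exact hinv s d hd

theorem ncard_range_le_of_factors {A B B' : Type} [Finite A] [Nonempty B] (f : A → B) (g : A → B')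
    (h : ∀ a b, g a = g b → f a = f b) : (Set.range f).ncard ≤ (Set.range g).ncard := by
  obtain ⟨e, he⟩ := (Function.factorsThrough_iff f).1 (fun a b hab => h a b hab)
  rw [he, Set.range_comp]
  exact Set.ncard_image_le (Set.toFinite _)

theorem local_step {G : Type} [Group G] (K N : Subgroup G) [K.Normal] (hNK : N ≤ K)
    (hT : HasTiles (G ⧸ K)) :
    ∃ C : ℕ, 1 ≤ C ∧ ∀ (t : ℕ) (S : Finset G) (θ : ℝ), 0 < θ → ∃ B U : Finset G,
      ∀ (X : Type) [Finite X] (ρ : G →* Equiv.Perm X) (Y E : Set X),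
        (∀ y ∈ Y, y ∉ E → ∀ u ∈ U, ρ u y ∈ Y) →
        (∀ y ∈ Y, y ∉ E → ∀ b ∈ B, (ρ b y = y ↔ b ∈ K)) →
        ∃ D, D ⊆ Y ∧ GoodSet ρ N S θ D ∧
          ((Y \ D).ncard : ℝ) ≤ ((1 - 1 / (C : ℝ)) ^ t + t * θ) * Y.ncard + t * E.ncard := by
  classical
  obtain ⟨C, hC, hT⟩ := tile_lift K hT
  refine ⟨C, hC, fun t => ?_⟩
  have hC' : (1:ℝ) ≤ C := by exact_mod_cast hC
  have ha0 : 0 ≤ 1 - 1 / (C : ℝ) := by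
    rw [sub_nonneg, div_le_one (by linarith)]
    exact hC'
  have ha1 : 1 - 1 / (C : ℝ) ≤ 1 := by
    have : 0 ≤ 1 / (C : ℝ) := by positivity
    linarith
  induction t with
  | zero =>
    intro S θ hθ
    refine ⟨∅, ∅, fun X _ ρ Y E _ _ => ⟨∅, Set.empty_subset _, GoodSet.empty _ _ _ _, ?_⟩⟩
    simp
  | succ t ih =>
    intro S θ hθ
    obtain ⟨I, i1, i2, α, σ, t1, t2, t3, t4⟩ := hT S θ hθ
    have hI : (1:ℝ) ≤ Fintype.card I := by exact_mod_cast Fintype.card_pos (α := I)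
    have hI0 : (0:ℝ) < Fintype.card I := by linarith
    have hθ' : θ / Fintype.card I ≤ θ := div_le_self hθ.le hI
    obtain ⟨B, U, hBU⟩ := ih (S ∪ univ.image fun i => (σ i)⁻¹) (θ / Fintype.card I)
      (by positivity)
    refine ⟨B ∪ (univ.image fun ij : I × I => (σ ij.1)⁻¹ * σ ij.2) ∪
      ((S ×ˢ univ).image fun si : G × I => (σ (α si.1 si.2))⁻¹ * (si.1 * σ si.2)) ∪
      (univ.image fun ij : (I × I) × (I × I) =>
        ((σ ij.1.1)⁻¹ * σ ij.1.2)⁻¹ * ((σ ij.2.1)⁻¹ * σ ij.2.2)), U ∪ univ.image σ, ?_⟩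
    intro X _ ρ Y E hU hB
    obtain ⟨D, hDY, hD, hu⟩ := hBU X ρ Y E
      (fun y hy hyE u hu => hU y hy hyE u (by simp [hu]))
      (fun y hy hyE b hb => hB y hy hyE b (by simp [hb]))
    have heq : ∀ (a b : G) (y : X), ρ (a⁻¹ * b) y = y ↔ ρ a y = ρ b y := by
      intro a b y
      rw [map_mul, map_inv, Equiv.Perm.mul_apply, Equiv.Perm.inv_eq_iff_eq]
      exact eq_comm
    have hBa : ∀ y ∈ Y, y ∉ E → ∀ i j, ρ (σ i) y = ρ (σ j) y → (σ i)⁻¹ * σ j ∈ K := by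
      intro y hy hyE i j hij
      rw [← hB y hy hyE _ ?_, heq]
      · exact hij
      · simp only [Finset.mem_union]
        exact Or.inl (Or.inl (Or.inr (Finset.mem_image.2 ⟨(i, j), Finset.mem_univ _, rfl⟩)))
    have hBb : ∀ y ∈ Y, y ∉ E → ∀ s ∈ S, ∀ i, (σ (α s i))⁻¹ * (s * σ i) ∈ K →
        ρ (σ (α s i)) y = ρ (s * σ i) y := by
      intro y hy hyE s hs i hij
      rw [← heq, hB y hy hyE _ ?_]
      · exact hij
      · simp only [Finset.mem_union]
        exact Or.inl (Or.inr (Finset.mem_image.2 ⟨(s, i), by simp [hs], rfl⟩))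
    have hBc : ∀ y ∈ Y, y ∉ E → ∀ i j k l, ((σ i)⁻¹ * σ j)⁻¹ * ((σ k)⁻¹ * σ l) ∈ K →
        ρ ((σ i)⁻¹ * σ j) y = ρ ((σ k)⁻¹ * σ l) y := by
      intro y hy hyE i j k l hij
      rw [← heq, hB y hy hyE _ ?_]
      · exact hij
      · simp only [Finset.mem_union]
        exact Or.inr (Finset.mem_image.2 ⟨((i, j), (k, l)), Finset.mem_univ _, rfl⟩)
    obtain ⟨D', hD'Y, hD', hu'⟩ := pack_step (θ := θ) α σ C hC (fun g hg => t1 g (hNK hg)) Y E D hDY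
      (hD.mono Finset.subset_union_left hθ')
      (fun z hz hzE i => hU z hz hzE _ (by simp))
      (fun z hz hzE i j hij => t2 i j (hBa z hz hzE i j hij))
      (fun z hz hzE s hs => by
        refine le_trans ?_ (t3 s hs)
        rw [Nat.cast_le]
        refine Set.ncard_le_ncard ?_ (Set.toFinite _)
        intro i hi hiK
        exact hi (hBb z hz hzE s hs i hiK))
      (fun z hz hzE => by
        refine le_trans ?_ t4
        have : Nonempty X := ⟨z⟩
        apply ncard_range_le_of_factors
        rintro ⟨i, j⟩ ⟨k, l⟩ hab
        exact hBc z hz hzE i j k l (QuotientGroup.eq.1 hab))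
    refine ⟨D', hD'Y, hD', hu'.trans ?_⟩
    have hbd : ({y | y ∉ D ∧ ∃ i, ρ (σ i) y ∈ D}.ncard : ℝ) ≤ θ * Y.ncard := by
      have hsub : {y | y ∉ D ∧ ∃ i, ρ (σ i) y ∈ D} ⊆
          ⋃ i ∈ (univ : Finset I), ρ (σ i)⁻¹ '' {d | d ∈ D ∧ ρ (σ i)⁻¹ d ∉ D} := by
        rintro y ⟨hy, i, hi⟩
        have e : ρ (σ i)⁻¹ (ρ (σ i) y) = y := by
          rw [← Equiv.Perm.mul_apply, ← map_mul, inv_mul_cancel, map_one, Equiv.Perm.one_apply]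
        simp only [Set.mem_iUnion]
        refine ⟨i, Finset.mem_univ _, ρ (σ i) y, ⟨hi, ?_⟩, e⟩
        rwa [e]
      have e1 := (Set.ncard_le_ncard hsub (Set.toFinite _)).trans (Finset.set_ncard_biUnion_le _ _)
      have e2 : ({y | y ∉ D ∧ ∃ i, ρ (σ i) y ∈ D}.ncard : ℝ) ≤
          ∑ i : I, (((ρ (σ i)⁻¹ '' {d | d ∈ D ∧ ρ (σ i)⁻¹ d ∉ D}).ncard : ℕ) : ℝ) := by
        exact_mod_cast e1
      have e3 : ∀ i ∈ (univ : Finset I),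
          (((ρ (σ i)⁻¹ '' {d | d ∈ D ∧ ρ (σ i)⁻¹ d ∉ D}).ncard : ℕ) : ℝ) ≤
            θ / Fintype.card I * D.ncard := by
        intro i _
        refine le_trans (Nat.cast_le.2 (Set.ncard_image_le (Set.toFinite _))) ?_
        exact hD.boundary _ (by simp)
      refine e2.trans ((Finset.sum_le_card_nsmul _ _ _ e3).trans ?_)
      rw [nsmul_eq_mul, Finset.card_univ, ← mul_assoc, mul_div_cancel₀ _ hI0.ne']
      have : (D.ncard : ℝ) ≤ Y.ncard := Nat.cast_le.2 (Set.ncard_le_ncard hDY (Set.toFinite _))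
      exact mul_le_mul_of_nonneg_left this hθ.le
    set a := 1 - 1 / (C : ℝ)
    have hy0 : (0:ℝ) ≤ Y.ncard := Nat.cast_nonneg _
    have he0 : (0:ℝ) ≤ E.ncard := Nat.cast_nonneg _
    have f1 := mul_le_mul_of_nonneg_left hu ha0
    have f2 : a * ((t * (θ / Fintype.card I)) * Y.ncard + t * E.ncard) ≤
        1 * ((t * θ) * Y.ncard + t * E.ncard) := by
      apply mul_le_mul ha1 _ (by positivity) (by norm_num)
      gcongr
    push_cast
    rw [pow_succ]
    linarith

theorem local_final {G : Type} [Group G] (K N : Subgroup G) [K.Normal] (hNK : N ≤ K)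
    (hT : HasTiles (G ⧸ K)) (S : Finset G) (η : ℝ) (hη : 0 < η) :
    ∃ (B U : Finset G) (t : ℕ),
      ∀ (X : Type) [Finite X] (ρ : G →* Equiv.Perm X) (Y E : Set X),
        (∀ y ∈ Y, y ∉ E → ∀ u ∈ U, ρ u y ∈ Y) →
        (∀ y ∈ Y, y ∉ E → ∀ b ∈ B, (ρ b y = y ↔ b ∈ K)) →
        ∃ D, D ⊆ Y ∧ GoodSet ρ N S η D ∧
          ((Y \ D).ncard : ℝ) ≤ η * Y.ncard + t * E.ncard := by
  obtain ⟨C, hC, h⟩ := local_step K N hNK hT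
  have hC' : (1:ℝ) ≤ C := by exact_mod_cast hC
  have ha1 : 1 - 1 / (C : ℝ) < 1 := by
    have : 0 < 1 / (C : ℝ) := by positivity
    linarith
  have ha0 : 0 ≤ 1 - 1 / (C : ℝ) := by
    rw [sub_nonneg, div_le_one (by linarith)]
    exact hC'
  obtain ⟨t, ht⟩ := exists_pow_lt_of_lt_one (half_pos hη) ha1
  have hθ : 0 < η / (2 * (t + 1)) := by positivity
  obtain ⟨B, U, hBU⟩ := h t S _ hθ
  refine ⟨B, U, t, fun X _ ρ Y E h1 h2 => ?_⟩
  obtain ⟨D, hD, hG, hu⟩ := hBU X ρ Y E h1 h2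
  refine ⟨D, hD, hG.mono le_rfl ?_, hu.trans ?_⟩
  · apply div_le_self hη.le
    have : (0:ℝ) ≤ t := Nat.cast_nonneg _
    linarith
  · have h3 : t * (η / (2 * (t + 1))) ≤ η / 2 := by
      rw [← mul_div_assoc, div_le_div_iff₀ (by positivity) (by norm_num)]
      have : (0:ℝ) ≤ t := Nat.cast_nonneg _
      nlinarith
    have hy0 : (0:ℝ) ≤ Y.ncard := Nat.cast_nonneg _
    have : ((1 - 1 / (C : ℝ)) ^ t + t * (η / (2 * (t + 1)))) * Y.ncard ≤ η * Y.ncard :=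
      mul_le_mul_of_nonneg_right (by linarith) hy0
    linarith

theorem relator_bound {G : Type} [Group G] (R : Set G) (w : G)
    (hw : w ∈ Subgroup.normalClosure R) :
    ∃ c : ℕ, ∀ (X : Type) [Finite X] (ρ : G →* Equiv.Perm X) (r : ℝ),
      (∀ ξ ∈ R, ({x | ρ ξ x ≠ x}.ncard : ℝ) ≤ r) → ({x | ρ w x ≠ x}.ncard : ℝ) ≤ c * r := by
  unfold Subgroup.normalClosure at hw
  induction hw using Subgroup.closure_induction with
  | mem w hw =>
    refine ⟨1, fun X _ ρ r h => ?_⟩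
    rw [Group.mem_conjugatesOfSet_iff] at hw
    obtain ⟨a, ha, hc⟩ := hw
    obtain ⟨c, rfl⟩ := isConj_iff.1 hc
    rw [Nat.cast_one, one_mul]
    refine le_trans ?_ (h a ha)
    rw [Nat.cast_le, ← Set.ncard_image_of_injective {x | ρ a x ≠ x} (ρ c).injective]
    refine Set.ncard_le_ncard ?_ (Set.toFinite _)
    intro x hx
    refine ⟨(ρ c)⁻¹ x, ?_, by simp⟩
    intro heq
    apply hx
    simp only [map_mul, map_inv, Equiv.Perm.mul_apply]
    rw [heq]
    simp
  | one => exact ⟨0, fun X _ ρ r h => by simp⟩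
  | mul a b _ _ iha ihb =>
    obtain ⟨c, hc⟩ := iha
    obtain ⟨d, hd⟩ := ihb
    refine ⟨c + d, fun X _ ρ r h => ?_⟩
    have hsub : {x | ρ (a * b) x ≠ x} ⊆ {x | ρ a x ≠ x} ∪ {x | ρ b x ≠ x} := by
      intro x hx
      by_contra hcon
      simp only [Set.mem_union, Set.mem_ofPred_eq, not_or, not_not] at hcon
      apply hx
      rw [map_mul, Equiv.Perm.mul_apply, hcon.2, hcon.1]
    have e1 := (Set.ncard_le_ncard hsub (Set.toFinite _)).trans (Set.ncard_union_le _ _)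
    have e2 : ({x | ρ (a * b) x ≠ x}.ncard : ℝ) ≤
      {x | ρ a x ≠ x}.ncard + {x | ρ b x ≠ x}.ncard := by exact_mod_cast e1
    have := hc X ρ r h
    have := hd X ρ r h
    push_cast
    linarith
  | inv a _ iha =>
    obtain ⟨c, hc⟩ := iha
    refine ⟨c, fun X _ ρ r h => ?_⟩
    refine le_trans (le_of_eq ?_) (hc X ρ r h)
    congr 3
    ext x
    rw [map_inv, ne_eq, ne_eq, Equiv.Perm.inv_eq_iff_eq, eq_comm]

theorem good_biUnion {G X ι : Type} [Group G] [Finite X] {ρ : G →* Equiv.Perm X}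
    {N : Subgroup G} {S : Finset G} {θ : ℝ} (T : Finset ι) (Y D : ι → Set X)
    (hdis : ∀ i j, i ≠ j → Disjoint (Y i) (Y j)) (hDY : ∀ i ∈ T, D i ⊆ Y i)
    (hG : ∀ i ∈ T, GoodSet ρ N S θ (D i)) :
    GoodSet ρ N S θ (⋃ i ∈ T, D i) ∧ ∑ i ∈ T, (Y i).ncard = (⋃ i ∈ T, Y i).ncard := by
  classical
  induction T using Finset.induction_on with
  | empty => simpa using GoodSet.empty ρ N S θ
  | insert a T ha ih =>
    obtain ⟨h1, h2⟩ := ih (fun i hi => hDY i (Finset.mem_insert_of_mem hi))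
      (fun i hi => hG i (Finset.mem_insert_of_mem hi))
    have hY : Disjoint (Y a) (⋃ i ∈ T, Y i) := by
      simp only [Set.disjoint_iUnion_right]
      intro i hi
      exact hdis a i (fun h => ha (h ▸ hi))
    have hsub : (⋃ i ∈ T, D i) ⊆ ⋃ i ∈ T, Y i :=
      Set.iUnion₂_mono fun i hi => hDY i (Finset.mem_insert_of_mem hi)
    rw [Finset.set_biUnion_insert, Finset.set_biUnion_insert, Finset.sum_insert ha, h2,
      Set.ncard_union_eq hY (Set.toFinite _) (Set.toFinite _)]
    exact ⟨(hG a (Finset.mem_insert_self _ _)).union h1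
      (hY.mono (hDY a (Finset.mem_insert_self _ _)) hsub), rfl⟩

theorem global_good {G : Type} [Group G] [Group.FG G] (R : Set G)
    (habel : ∀ a b : G ⧸ Subgroup.normalClosure R, a * b = b * a) (S : Finset G)
    (η : ℝ) (hη : 0 < η) :
    ∃ c : ℕ, ∀ (X : Type) [Finite X] (ρ : G →* Equiv.Perm X) (r : ℝ),
      (∀ ξ ∈ R, ({x | ρ ξ x ≠ x}.ncard : ℝ) ≤ r) → ∃ D : Set X,
        GoodSet ρ (Subgroup.normalClosure R) S η D ∧
        ((Dᶜ).ncard : ℝ) ≤ η * Nat.card X + c * r := by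
  classical
  set N := Subgroup.normalClosure R with hN
  have hcomm : ∀ a b : G, (b * a)⁻¹ * (a * b) ∈ N := by
    intro a b
    rw [← QuotientGroup.eq, QuotientGroup.mk_mul, QuotientGroup.mk_mul, habel]
  have hloc : ∀ K : Subgroup G, ∃ (B U : Finset G) (t : ℕ), N ≤ K →
      ∀ (X : Type) [Finite X] (ρ : G →* Equiv.Perm X) (Y E : Set X),
        (∀ y ∈ Y, y ∉ E → ∀ u ∈ U, ρ u y ∈ Y) →
        (∀ y ∈ Y, y ∉ E → ∀ b ∈ B, (ρ b y = y ↔ b ∈ K)) →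
        ∃ D, D ⊆ Y ∧ GoodSet ρ N S η D ∧
          ((Y \ D).ncard : ℝ) ≤ η * Y.ncard + t * E.ncard := by
    intro K
    by_cases hNK : N ≤ K
    · have hnorm : K.Normal := by
        refine ⟨fun k hk g => ?_⟩
        have h2 : g * k * g⁻¹ = k * ((g⁻¹ * k)⁻¹ * (k * g⁻¹)) := by group
        rw [h2]
        exact K.mul_mem hk (hNK (hcomm k g⁻¹))
      have hq : ∀ a b : G ⧸ K, a * b = b * a := by
        intro a b
        induction a using QuotientGroup.induction_on
        induction b using QuotientGroup.induction_on
        rename_i a b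
        rw [← QuotientGroup.mk_mul, ← QuotientGroup.mk_mul, QuotientGroup.eq]
        exact hNK (hcomm b a)
      let _ : CommGroup (G ⧸ K) := { (inferInstance : Group (G ⧸ K)) with mul_comm := hq }
      have hfg : Group.FG (G ⧸ K) := QuotientGroup.fg K
      have hT : HasTiles (G ⧸ K) := HasTiles.of_comm (G ⧸ K)
      obtain ⟨B, U, t, h⟩ := local_final K N hNK hT S η hη
      exact ⟨B, U, t, fun _ => h⟩
    · exact ⟨∅, ∅, 0, fun h => absurd h hNK⟩
  choose B U t hloc using hloc
  obtain ⟨𝒦, W, hcpt⟩ := compact_subgroups N B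
  set Bm := 𝒦.biUnion B with hBm
  set Um := 𝒦.biUnion U with hUm
  set W' := W.filter (· ∈ N) ∪
    (Bm ×ˢ Um).image (fun bu : G × G => (bu.2 * bu.1)⁻¹ * (bu.1 * bu.2)) with hW'
  have hW'N : ∀ w ∈ W', w ∈ N := by
    intro w hw
    rw [hW', Finset.mem_union, Finset.mem_filter, Finset.mem_image] at hw
    rcases hw with h | ⟨bu, _, rfl⟩
    · exact h.2
    · exact hcomm _ _
  have hc : ∀ w : G, ∃ c : ℕ, w ∈ N → ∀ (X : Type) [Finite X] (ρ : G →* Equiv.Perm X) (r : ℝ),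
      (∀ ξ ∈ R, ({x | ρ ξ x ≠ x}.ncard : ℝ) ≤ r) →
        ({x | ρ w x ≠ x}.ncard : ℝ) ≤ c * r := by
    intro w
    by_cases hw : w ∈ N
    · obtain ⟨c, hc⟩ := relator_bound R w hw
      exact ⟨c, fun _ => hc⟩
    · exact ⟨0, fun h => absurd h hw⟩
  choose c hc using hc
  refine ⟨(1 + ∑ K ∈ 𝒦, t K) * ∑ w ∈ W', c w, fun X _ ρ r hr => ?_⟩
  let E : Set X := {x | ∃ w ∈ W', ρ w x ≠ x}
  have hE : (E.ncard : ℝ) ≤ (∑ w ∈ W', c w : ℕ) * r := by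
    have hsub : E ⊆ ⋃ w ∈ W', {x | ρ w x ≠ x} := by
      rintro x ⟨w, hw, hx⟩
      simp only [Set.mem_iUnion]
      exact ⟨w, hw, hx⟩
    have e1 := (Set.ncard_le_ncard hsub (Set.toFinite _)).trans (Finset.set_ncard_biUnion_le _ _)
    have e2 : (E.ncard : ℝ) ≤ ∑ w ∈ W', ({x | ρ w x ≠ x}.ncard : ℝ) := by exact_mod_cast e1
    refine e2.trans ?_
    push_cast
    rw [Finset.sum_mul]
    exact Finset.sum_le_sum fun w hw => hc w (hW'N w hw) X ρ r hr
  let pat : X → Set G := fun x => {b | b ∈ Bm ∧ ρ b x = x}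
  let Φ : Set G → Subgroup G → Prop := fun P K =>
    K ∈ 𝒦 ∧ N ≤ K ∧ ∀ b ∈ B K, (b ∈ P ↔ b ∈ K)
  have hcls : ∀ P : Set G, ∃ K, (∃ K', Φ P K') → Φ P K := by
    intro P
    by_cases h : ∃ K', Φ P K'
    · obtain ⟨K, hK⟩ := h
      exact ⟨K, fun _ => hK⟩
    · exact ⟨⊥, fun h' => absurd h' h⟩
  choose cls hcls using hcls
  let Y : Subgroup G → Set X := fun K => {x | Φ (pat x) K ∧ cls (pat x) = K}
  have hYd : ∀ K K', K ≠ K' → Disjoint (Y K) (Y K') := by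
    intro K K' hne
    rw [Set.disjoint_left]
    rintro x ⟨_, h1⟩ ⟨_, h2⟩
    exact hne (h1.symm.trans h2)
  have hcover : ∀ x, x ∉ E → ∃ K ∈ 𝒦, x ∈ Y K := by
    intro x hx
    have hfix : ∀ w ∈ W', ρ w x = x := by
      intro w hw
      by_contra hne
      exact hx ⟨w, hw, hne⟩
    obtain ⟨K, hK, hNK, hKB⟩ := hcpt ((MulAction.stabilizer (Equiv.Perm X) x).comap ρ) (by
      intro w hw hwN
      exact hfix w (Finset.mem_union_left _ (Finset.mem_filter.2 ⟨hw, hwN⟩)))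
    have hΦ : Φ (pat x) K := by
      refine ⟨hK, hNK, fun b hb => ?_⟩
      rw [← hKB b hb]
      constructor
      · rintro ⟨_, h⟩
        exact h
      · intro h
        exact ⟨Finset.mem_biUnion.2 ⟨K, hK, hb⟩, h⟩
    have := hcls (pat x) ⟨K, hΦ⟩
    exact ⟨cls (pat x), this.1, this, rfl⟩
  have hpat : ∀ x, x ∉ E → ∀ u ∈ Um, pat (ρ u x) = pat x := by
    intro x hx u hu
    have hfix : ∀ w ∈ W', ρ w x = x := by
      intro w hw
      by_contra hne
      exact hx ⟨w, hw, hne⟩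
    ext b
    refine and_congr_right fun hb => ?_
    have h1 := hfix ((u * b)⁻¹ * (b * u)) (Finset.mem_union_right _
      (Finset.mem_image.2 ⟨(b, u), Finset.mem_product.2 ⟨hb, hu⟩, rfl⟩))
    rw [map_mul, map_inv, Equiv.Perm.mul_apply, Equiv.Perm.inv_eq_iff_eq, map_mul, map_mul,
      Equiv.Perm.mul_apply, Equiv.Perm.mul_apply] at h1
    rw [h1]
    exact (ρ u).injective.eq_iff
  have hD : ∀ K, ∃ D : Set X, K ∈ 𝒦 → D ⊆ Y K ∧ GoodSet ρ N S η D ∧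
      ((Y K \ D).ncard : ℝ) ≤ η * (Y K).ncard + t K * E.ncard := by
    intro K
    by_cases hK : K ∈ 𝒦 ∧ N ≤ K
    · obtain ⟨D, hD⟩ := hloc K hK.2 X ρ (Y K) E
        (by
          intro y hy hyE u hu
          have := hpat y hyE u (Finset.mem_biUnion.2 ⟨K, hK.1, hu⟩)
          change Φ (pat (ρ u y)) K ∧ cls (pat (ρ u y)) = K
          rw [this]
          exact hy)
        (by
          intro y hy hyE b hb
          rw [← hy.1.2.2 b hb]
          constructor
          · intro h
            exact ⟨Finset.mem_biUnion.2 ⟨K, hK.1, hb⟩, h⟩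
          · rintro ⟨_, h⟩
            exact h)
      exact ⟨D, fun _ => hD⟩
    · refine ⟨∅, fun hK' => ⟨Set.empty_subset _, GoodSet.empty _ _ _ _, ?_⟩⟩
      have : Y K = ∅ := by
        rw [Set.eq_empty_iff_forall_notMem]
        intro x hx
        exact hK ⟨hx.1.1, hx.1.2.1⟩
      rw [this]
      simp
      positivity
  choose D hD using hD
  obtain ⟨hG, hsum⟩ := good_biUnion (ρ := ρ) (N := N) (S := S) (θ := η) 𝒦 Y D hYd
    (fun K hK => (hD K hK).1) (fun K hK => (hD K hK).2.1)
  refine ⟨_, hG, ?_⟩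
  have hsub : (⋃ K ∈ 𝒦, D K)ᶜ ⊆ E ∪ ⋃ K ∈ 𝒦, (Y K \ D K) := by
    intro x hx
    by_cases hxE : x ∈ E
    · exact Or.inl hxE
    right
    obtain ⟨K, hK, hxY⟩ := hcover x hxE
    simp only [Set.mem_compl_iff, Set.mem_iUnion, not_exists] at hx
    simp only [Set.mem_iUnion]
    exact ⟨K, hK, hxY, hx K hK⟩
  have e1 := (Set.ncard_le_ncard hsub (Set.toFinite _)).trans ((Set.ncard_union_le _ _).trans
    (Nat.add_le_add_left (Finset.set_ncard_biUnion_le _ _) _))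
  have e2 : (((⋃ K ∈ 𝒦, D K)ᶜ).ncard : ℝ) ≤ E.ncard + ∑ K ∈ 𝒦, ((Y K \ D K).ncard : ℝ) := by
    exact_mod_cast e1
  have e3 : ∑ K ∈ 𝒦, ((Y K \ D K).ncard : ℝ) ≤
      ∑ K ∈ 𝒦, (η * (Y K).ncard + t K * E.ncard) :=
    Finset.sum_le_sum fun K hK => (hD K hK).2.2
  rw [Finset.sum_add_distrib, ← Finset.mul_sum, ← Finset.sum_mul] at e3
  have e3a : ∑ K ∈ 𝒦, ((Y K).ncard : ℝ) = ((⋃ K ∈ 𝒦, Y K).ncard : ℝ) := by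
    exact_mod_cast hsum
  have e3b : ∑ K ∈ 𝒦, (t K : ℝ) = ((∑ K ∈ 𝒦, t K : ℕ) : ℝ) := by push_cast; rfl
  rw [e3a, e3b] at e3
  have e4 : ((⋃ K ∈ 𝒦, Y K).ncard : ℝ) ≤ Nat.card X := Nat.cast_le.2 (Set.ncard_le_card _)
  have e5 := mul_le_mul_of_nonneg_left e4 hη.le
  have e6 : (1 + ((∑ K ∈ 𝒦, t K : ℕ) : ℝ)) * E.ncard ≤
      (1 + ((∑ K ∈ 𝒦, t K : ℕ) : ℝ)) * ((∑ w ∈ W', c w : ℕ) * r) :=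
    mul_le_mul_of_nonneg_left hE (by positivity)
  rw [Nat.cast_mul, Nat.cast_add, Nat.cast_one, mul_assoc]
  linarith

/-- If the group presented by a finite set of relator words `R` is abelian,
then `R` is stable in permutations. -/
theorem abelian_presentation_stable (m : ℕ) (hm : 1 ≤ m)
    (R : Finset (FreeGroup (Fin m)))
    (habel : ∀ a b : FreeGroup (Fin m) ⧸
        Subgroup.normalClosure (R : Set (FreeGroup (Fin m))), a * b = b * a) :
    IsStable R := by
  classical
  intro ε hε
  obtain ⟨c, hc⟩ := global_good (R : Set (FreeGroup (Fin m))) habel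
    (Finset.univ.image FreeGroup.of) (ε / 4) (by positivity)
  refine ⟨ε / (4 * (c + 1)), by positivity, fun n p hp => ?_⟩
  have hdH : ∀ a b : Equiv.Perm (Fin n), dH a b = ({x | a x ≠ b x}.ncard : ℝ) / n := by
    intro a b
    rw [dH, Set.ncard_eq_toFinset_card']
    congr 3
    ext x
    simp
  have hn : (0:ℝ) ≤ n := Nat.cast_nonneg _
  obtain ⟨D, ⟨φ, h1, h2, h3⟩, hD⟩ := hc (Fin n) (FreeGroup.lift p) (ε / (4 * (c + 1)) * n) (by
    intro ξ hξ
    rcases Nat.eq_zero_or_pos n with rfl | hn0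
    · rw [Set.eq_empty_of_isEmpty {x | (FreeGroup.lift p) ξ x ≠ x}]
      simp
    have := hp ξ hξ
    rw [hdH, div_lt_iff₀ (by exact_mod_cast hn0)] at this
    exact this.le)
  refine ⟨fun i => φ (FreeGroup.of i), ?_, ?_⟩
  · intro ξ hξ
    have e : FreeGroup.lift (fun i => φ (FreeGroup.of i)) = φ := by
      ext i
      simp
    rw [evalWord, e]
    exact h1 ξ (Subgroup.subset_normalClosure hξ)
  · intro i
    rcases Nat.eq_zero_or_pos n with rfl | hn0
    · simpa [dH] using hε
    have hn0' : (0:ℝ) < n := by exact_mod_cast hn0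
    rw [hdH, div_lt_iff₀ hn0']
    have e1 := h3 (FreeGroup.of i) (by simp)
    rw [FreeGroup.lift_apply_of] at e1
    have hsub : {x | p i x ≠ φ (FreeGroup.of i) x} ⊆
        Dᶜ ∪ {d | d ∈ D ∧ φ (FreeGroup.of i) d ≠ p i d} := by
      intro x hx
      by_cases hxD : x ∈ D
      · exact Or.inr ⟨hxD, fun h => hx h.symm⟩
      · exact Or.inl hxD
    have e2 := (Set.ncard_le_ncard hsub (Set.toFinite _)).trans (Set.ncard_union_le _ _)
    have e3 : ({x | p i x ≠ φ (FreeGroup.of i) x}.ncard : ℝ) ≤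
      (Dᶜ).ncard + {d | d ∈ D ∧ φ (FreeGroup.of i) d ≠ p i d}.ncard := by exact_mod_cast e2
    have e4 : (D.ncard : ℝ) ≤ n := by
      have := Set.ncard_le_card D
      rw [Nat.card_eq_fintype_card, Fintype.card_fin] at this
      exact_mod_cast this
    have e5 := mul_le_mul_of_nonneg_left e4 (by positivity : 0 ≤ ε / 4)
    rw [Nat.card_eq_fintype_card, Fintype.card_fin] at hD
    have e6 : (c : ℝ) * (ε / (4 * (c + 1)) * n) ≤ ε / 4 * n := by
      rw [← mul_assoc]
      refine mul_le_mul_of_nonneg_right ?_ hn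
      rw [← mul_div_assoc, div_le_div_iff₀ (by positivity) (by norm_num)]
      nlinarith
    have e7 : 0 < ε * n := by positivity
    linarith
end

section
/- Let R ⊆ F_m be a finite set of words such that the group G = F_m/⟨⟨R⟩⟩ is amenable. Then R is weakly stable in permutations if and only if G is residually finite. -/
open Filter Topology

/-- `p` is a `δ`-strong solution of `R`. -/
def IsStrongSol {m : ℕ} (R : Finset (FreeGroup (Fin m))) (δ : ℝ) {n : ℕ}
    (p : Fin m → Equiv.Perm (Fin n)) : Prop :=
  ∀ ξ : FreeGroup (Fin m), (FreeGroup.norm ξ : ℝ) < 1 / δ →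
    (ξ ∈ Subgroup.normalClosure (R : Set (FreeGroup (Fin m))) →
      dH (evalWord ξ p) 1 < δ) ∧
    (ξ ∉ Subgroup.normalClosure (R : Set (FreeGroup (Fin m))) →
      1 - δ < dH (evalWord ξ p) 1)

/-- A finite set of words `R ⊆ F_m` is weakly stable in permutations. -/
def WeaklyStable {m : ℕ} (R : Finset (FreeGroup (Fin m))) : Prop :=
  ∀ ε : ℝ, 0 < ε → ∃ δ : ℝ, 0 < δ ∧
    ∀ (n : ℕ) (p : Fin m → Equiv.Perm (Fin n)),
      IsStrongSol R δ p →
      ∃ q : Fin m → Equiv.Perm (Fin n),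
        (∀ ξ ∈ R, evalWord ξ q = 1) ∧ ∀ i, dH (p i) (q i) < ε

/-- A group is amenable if it carries a left-invariant finitely additive
probability measure defined on all subsets. -/
def Amenable (G : Type*) [Group G] : Prop :=
  ∃ μ : Set G → ℝ,
    (∀ A, 0 ≤ μ A) ∧
    μ Set.univ = 1 ∧
    (∀ A B : Set G, Disjoint A B → μ (A ∪ B) = μ A + μ B) ∧
    (∀ (g : G) (A : Set G), μ ((fun x => g * x) '' A) = μ A)

/-- A group is residually finite if every nontrivial element survives in some
homomorphism to a finite group. -/
def ResiduallyFinite (G : Type*) [Group G] : Prop :=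
  ∀ g : G, g ≠ 1 → ∃ (F : Type) (_ : Group F) (_ : Finite F) (φ : G →* F), φ g ≠ 1


section FolnerPart
open Pointwise

lemma am_sum {G : Type*} [Group G] {μ : Set G → ℝ}
    (hadd : ∀ A B : Set G, Disjoint A B → μ (A ∪ B) = μ A + μ B)
    {ι : Type*} (s : Finset ι) (f : ι → Set G)
    (hf : ∀ i ∈ s, ∀ j ∈ s, i ≠ j → Disjoint (f i) (f j)) :
    μ (⋃ i ∈ s, f i) = ∑ i ∈ s, μ (f i) := by
  classical
  induction s using Finset.induction_on with
  | empty =>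
    have := hadd ∅ ∅ (by simp)
    simp at this ⊢
    exact this
  | insert a s ha ih =>
    rw [Finset.set_biUnion_insert, hadd, Finset.sum_insert ha, ih]
    · intro i hi j hj
      exact hf i (Finset.mem_insert_of_mem hi) j (Finset.mem_insert_of_mem hj)
    · rw [Set.disjoint_iUnion₂_right]
      intro i hi
      exact hf a (Finset.mem_insert_self _ _) i (Finset.mem_insert_of_mem hi)
        (fun h => ha (h ▸ hi))

lemma folner {G : Type*} [Group G] [DecidableEq G] (h : Amenable G) (K : Finset G)
    {ε : ℝ} (hε : 0 < ε) :
    ∃ A : Finset G, A.Nonempty ∧ ((K * A).card : ℝ) ≤ (1 + ε) * A.card := by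
  by_contra hcon
  push Not at hcon
  obtain ⟨μ, h0, h1, hadd, hinv⟩ := h
  have hiter : ∀ (j : ℕ) (A : Finset G), (1 + ε) ^ j * A.card ≤ ((K ^ j * A).card : ℝ) := by
    intro j
    induction j with
    | zero => intro A; simp
    | succ j ih =>
      intro A
      rcases A.eq_empty_or_nonempty with rfl | hA
      · simp
      · have h2 := ih (K * A)
        have h3 := hcon A hA
        rw [pow_succ K, mul_assoc]
        refine le_trans ?_ h2
        rw [pow_succ, mul_assoc]
        gcongr
  obtain ⟨j, hj⟩ := pow_unbounded_of_one_lt (2 : ℝ) (show 1 < 1 + ε by linarith)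
  set L := K ^ j with hL
  have h2 : ∀ A : Finset G, 2 * A.card ≤ (L * A).card := by
    intro A
    have := hiter j A
    have h3 : (2 : ℝ) * A.card ≤ (1 + ε) ^ j * A.card := by gcongr
    exact_mod_cast h3.trans this
  have hall := (Finset.all_card_le_biUnion_card_iff_exists_injective
    (fun x : G × Bool => L * {x.1})).1 (by
      intro s
      have e : s.biUnion (fun x : G × Bool => L * {x.1}) = L * s.image Prod.fst := by
        ext y
        simp only [Finset.mem_biUnion, Finset.mem_mul, Finset.mem_image, Finset.mem_singleton]
        constructor
        · rintro ⟨x, hx, l, hl, z, rfl, rfl⟩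
          exact ⟨l, hl, x.1, ⟨x, hx, rfl⟩, rfl⟩
        · rintro ⟨l, hl, z, ⟨x, hx, rfl⟩, rfl⟩
          exact ⟨x, hx, l, hl, x.1, rfl, rfl⟩
      rw [e]
      refine le_trans ?_ (h2 _)
      have : s ⊆ (s.image Prod.fst) ×ˢ (Finset.univ : Finset Bool) := by
        intro x hx
        simp only [Finset.mem_product, Finset.mem_univ, and_true]
        exact Finset.mem_image_of_mem _ hx
      have := Finset.card_le_card this
      rw [Finset.card_product] at this
      simpa [mul_comm] using this)
  obtain ⟨f, hf, hfm⟩ := hall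
  let S : Bool → G → Set G := fun b k => {x | f (x, b) = k * x}
  have hcov : ∀ b, ∑ k ∈ L, μ (S b k) = 1 := by
    intro b
    rw [← am_sum hadd, ← h1]
    · congr 1
      ext x
      simp only [Set.mem_iUnion, Set.mem_univ, iff_true]
      have := hfm (x, b)
      simp only [Finset.mem_mul, Finset.mem_singleton] at this
      obtain ⟨k, hk, z, rfl, hz⟩ := this
      exact ⟨k, hk, hz.symm⟩
    · intro i _ j _ hij
      rw [Set.disjoint_left]
      intro x hx hx'
      exact hij (mul_right_cancel ((show f (x, b) = i * x from hx).symm.trans hx'))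
  have hsum : ∑ q ∈ (Finset.univ : Finset Bool) ×ˢ L, μ ((fun x => q.2 * x) '' S q.1 q.2) = 2 := by
    simp_rw [hinv]
    rw [Finset.sum_product]
    simp only [hcov]
    norm_num
  rw [← am_sum hadd] at hsum
  · have hle : ∀ A : Set G, μ A ≤ 1 := by
      intro A
      have := hadd A Aᶜ disjoint_compl_right
      rw [Set.union_compl_self, h1] at this
      linarith [h0 Aᶜ]
    linarith [hle (⋃ q ∈ (Finset.univ : Finset Bool) ×ˢ L, (fun x => q.2 * x) '' S q.1 q.2)]
  · rintro ⟨b, k⟩ _ ⟨b', k'⟩ _ hne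
    rw [Set.disjoint_left]
    rintro _ ⟨x, hx, rfl⟩ ⟨x', hx', he⟩
    have e1 : f (x, b) = k * x := hx
    have e2 : f (x', b') = k' * x' := hx'
    have he' : k' * x' = k * x := he
    have := hf (e2.trans (he'.trans e1.symm))
    simp only [Prod.mk.injEq] at this
    obtain ⟨rfl, rfl⟩ := this
    exact hne (by rw [mul_right_cancel he'])
end FolnerPart

section ForwardPart
open Pointwise

lemma folner_interior {G : Type*} [Group G] [DecidableEq G] (h : Amenable G) (K : Finset G)
    {ε : ℝ} (hε : 0 < ε) :
    ∃ A : Finset G, A.Nonempty ∧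
      (((A.filter fun a => ∃ k ∈ K, k * a ∉ A).card : ℕ) : ℝ) ≤ ε * A.card := by
  obtain ⟨A, hA, hc⟩ := folner h (insert 1 K) (ε := ε / (K.card + 1)) (by positivity)
  refine ⟨A, hA, ?_⟩
  have hsub : A ⊆ insert 1 K * A := by
    intro a ha
    exact Finset.mem_mul.2 ⟨1, by simp, a, ha, by simp⟩
  have h1 : ∀ k ∈ K, (A.filter fun a => k * a ∉ A).card ≤ ((insert 1 K * A) \ A).card := by
    intro k hk
    refine Finset.card_le_card_of_injOn (fun a => k * a) ?_ ?_
    · intro a ha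
      simp only [Finset.coe_filter, Set.mem_ofPred_eq] at ha
      simp only [Finset.coe_sdiff, Set.mem_sdiff, Finset.mem_coe]
      exact ⟨Finset.mul_mem_mul (Finset.mem_insert_of_mem hk) ha.1, ha.2⟩
    · intro a _ b _ hab
      exact mul_left_cancel hab
  have h2 : (A.filter fun a => ∃ k ∈ K, k * a ∉ A) ⊆
      K.biUnion fun k => A.filter fun a => k * a ∉ A := by
    intro a ha
    simp only [Finset.mem_filter, Finset.mem_biUnion] at ha ⊢
    obtain ⟨ha, k, hk, hka⟩ := ha
    exact ⟨k, hk, ha, hka⟩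
  have h3 : (A.filter fun a => ∃ k ∈ K, k * a ∉ A).card ≤
      K.card * ((insert 1 K * A) \ A).card :=
    (Finset.card_le_card h2).trans (Finset.card_biUnion_le_card_mul _ _ _ h1)
  have h4 : (((insert 1 K * A) \ A).card : ℝ) ≤ ε / (K.card + 1) * A.card := by
    rw [Finset.cast_card_sdiff hsub]
    linarith
  calc (((A.filter fun a => ∃ k ∈ K, k * a ∉ A).card : ℕ) : ℝ)
      ≤ K.card * ((insert 1 K * A) \ A).card := by exact_mod_cast h3
    _ ≤ K.card * (ε / (K.card + 1) * A.card) := by gcongr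
    _ ≤ (K.card + 1) * (ε / (K.card + 1) * A.card) := by gcongr; linarith
    _ = ε * A.card := by field_simp

lemma exists_equiv_extend {X Y : Type*} [Fintype X] [Fintype Y]
    (hc : Fintype.card X = Fintype.card Y) (s : Finset X) (f : X → Y) (hf : Set.InjOn f s) :
    ∃ g : X ≃ Y, ∀ i ∈ s, g i = f i := by
  classical
  obtain ⟨g, hg⟩ := Finset.exists_equiv_extend_of_card_eq (t := (Finset.univ : Finset Y))
    (by simpa using hc) (s := s) (f := f) (by simp) hf
  exact ⟨g.trans (Equiv.subtypeUnivEquiv (by simp)), fun i hi => hg i hi⟩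

lemma exists_partial_mul {G : Type*} [Group G] {X : Type*} [Fintype X] (ι : X → G)
    (hι : Function.Injective ι) (g : G) :
    ∃ p : Equiv.Perm X, ∀ x y, ι y = g * ι x → p x = y := by
  classical
  let f : X → X := fun x => if h : ∃ y, ι y = g * ι x then h.choose else x
  have hf : ∀ x, (∃ y, ι y = g * ι x) → ι (f x) = g * ι x := by
    intro x hx
    simp only [f, dif_pos hx]
    exact hx.choose_spec
  obtain ⟨p, hp⟩ := exists_equiv_extend rfl
    (Finset.univ.filter fun x => ∃ y, ι y = g * ι x) f (by
      intro x hx y hy hxy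
      simp only [Finset.coe_filter, Finset.mem_univ, true_and, Set.mem_ofPred_eq] at hx hy
      have h1 := hf x hx
      rw [hxy, hf y hy] at h1
      exact (hι (mul_left_cancel h1)).symm)
  refine ⟨p, fun x y hxy => ?_⟩
  rw [hp x (by simp; exact ⟨y, hxy⟩)]
  apply hι
  rw [hf x ⟨y, hxy⟩, hxy]

lemma word_action {m : ℕ} {G : Type*} [Group G] (π : FreeGroup (Fin m) →* G) {X : Type*}
    (ι : X → G) (p : Fin m → Equiv.Perm X)
    (hp : ∀ s x y, ι y = π (FreeGroup.of s) * ι x → p s x = y) (x : X)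
    (L : List (Fin m × Bool))
    (hL : ∀ L', L' <:+ L → ∃ y, ι y = π (FreeGroup.mk L') * ι x) :
    ι (FreeGroup.lift p (FreeGroup.mk L) x) = π (FreeGroup.mk L) * ι x := by
  induction L with
  | nil =>
    rw [← FreeGroup.one_eq_mk]
    simp
  | cons a L ih =>
    have ih' := ih (fun L' h => hL L' (h.trans (List.suffix_cons a L)))
    obtain ⟨s, b⟩ := a
    obtain ⟨y, hy⟩ := hL _ List.suffix_rfl
    have e : (FreeGroup.mk ((s, b) :: L) : FreeGroup (Fin m)) =
        FreeGroup.mk [(s, b)] * FreeGroup.mk L := by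
      rw [FreeGroup.mul_mk]; rfl
    rw [← hy]
    congr 1
    rw [e, map_mul, Equiv.Perm.mul_apply]
    rw [e, map_mul, mul_assoc, ← ih'] at hy
    cases b with
    | true =>
      have e2 : (FreeGroup.mk [(s, true)] : FreeGroup (Fin m)) = FreeGroup.of s := rfl
      rw [e2] at hy ⊢
      rw [FreeGroup.lift_apply_of]
      exact hp s _ _ hy
    | false =>
      have e2 : (FreeGroup.mk [(s, false)] : FreeGroup (Fin m)) = (FreeGroup.of s)⁻¹ := by
        simp [FreeGroup.of, FreeGroup.inv_mk, FreeGroup.invRev]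
      rw [e2] at hy ⊢
      rw [map_inv, FreeGroup.lift_apply_of, Equiv.Perm.inv_eq_iff_eq]
      rw [map_inv] at hy
      refine (hp s _ _ ?_).symm
      rw [hy]; group

lemma exists_strong {m : ℕ} (R : Finset (FreeGroup (Fin m)))
    (hamen : Amenable
      (FreeGroup (Fin m) ⧸ Subgroup.normalClosure (R : Set (FreeGroup (Fin m)))))
    {δ : ℝ} (hδ : 0 < δ) :
    ∃ (n : ℕ) (p : Fin m → Equiv.Perm (Fin n)), IsStrongSol R δ p := by
  classical
  set N := Subgroup.normalClosure (R : Set (FreeGroup (Fin m))) with hN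
  let π : FreeGroup (Fin m) →* FreeGroup (Fin m) ⧸ N := QuotientGroup.mk' N
  have hπ : ∀ w, π w = 1 ↔ w ∈ N := fun w => QuotientGroup.eq_one_iff w
  let r : ℕ := ⌈1 / δ⌉₊
  let K : Finset (FreeGroup (Fin m) ⧸ N) :=
    (List.finite_length_le (Fin m × Bool) r).toFinset.image fun L => π (FreeGroup.mk L)
  obtain ⟨A, hA, hbad⟩ := folner_interior hamen K (half_pos hδ)
  let e : Fin A.card ≃ A := A.equivFin.symm
  let ι : Fin A.card → FreeGroup (Fin m) ⧸ N := fun i => (e i : FreeGroup (Fin m) ⧸ N)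
  have hι : Function.Injective ι := Subtype.val_injective.comp e.injective
  have hιA : ∀ a ∈ A, ∃ y, ι y = a := fun a ha => ⟨e.symm ⟨a, ha⟩, by simp [ι]⟩
  choose p hp using fun s : Fin m => exists_partial_mul ι hι (π (FreeGroup.of s))
  refine ⟨A.card, p, ?_⟩
  have hn : (0 : ℝ) < A.card := by exact_mod_cast hA.card_pos
  have hbad2 : ((Finset.univ.filter fun x => ∃ k ∈ K, k * ι x ∉ A).card : ℝ) < δ * A.card := by
    have : (Finset.univ.filter fun x => ∃ k ∈ K, k * ι x ∉ A).card ≤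
        (A.filter fun a => ∃ k ∈ K, k * a ∉ A).card := by
      refine Finset.card_le_card_of_injOn ι ?_ hι.injOn
      intro x hx
      simp only [Finset.coe_filter, Finset.mem_univ, true_and, Set.mem_ofPred_eq] at hx ⊢
      exact ⟨(e x).2, hx⟩
    have h2 : ((Finset.univ.filter fun x => ∃ k ∈ K, k * ι x ∉ A).card : ℝ) ≤ _ :=
      (Nat.cast_le.2 this).trans hbad
    nlinarith
  have key : ∀ ξ : FreeGroup (Fin m), (FreeGroup.norm ξ : ℝ) < 1 / δ → ∀ x,
      (¬ ∃ k ∈ K, k * ι x ∉ A) → ι (evalWord ξ p x) = π ξ * ι x := by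
    intro ξ hξ x hx
    push Not at hx
    have := word_action π ι p hp x ξ.toWord (by
      intro L' hL'
      apply hιA
      apply hx
      refine Finset.mem_image_of_mem _ ?_
      simp only [Set.Finite.mem_toFinset, Set.mem_ofPred_eq]
      have h1 : L'.length ≤ ξ.norm := hL'.length_le
      have h2 : ξ.norm ≤ r := by
        have := hξ.le.trans (Nat.le_ceil (1 / δ))
        exact_mod_cast this
      exact h1.trans h2)
    rwa [FreeGroup.mk_toWord] at this
  intro ξ hξ
  constructor
  · intro hm
    unfold dH
    rw [div_lt_iff₀ hn]
    refine lt_of_le_of_lt ?_ hbad2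
    refine Nat.cast_le.2 (Finset.card_le_card ?_)
    intro x hx
    simp only [Finset.mem_filter, Finset.mem_univ, true_and] at hx ⊢
    by_contra hcon
    apply hx
    apply hι
    rw [key ξ hξ x hcon, (hπ ξ).2 hm]
    simp
  · intro hm
    unfold dH
    rw [lt_div_iff₀ hn]
    have h1 : (A.card : ℝ) ≤ (Finset.univ.filter fun x => ∃ k ∈ K, k * ι x ∉ A).card +
        (Finset.univ.filter fun i => evalWord ξ p i ≠ (1 : Equiv.Perm (Fin A.card)) i).card := by
      have : (Finset.univ : Finset (Fin A.card)) ⊆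
          (Finset.univ.filter fun x => ∃ k ∈ K, k * ι x ∉ A) ∪
          (Finset.univ.filter fun i => evalWord ξ p i ≠ (1 : Equiv.Perm (Fin A.card)) i) := by
        intro x _
        simp only [Finset.mem_union, Finset.mem_filter, Finset.mem_univ, true_and]
        by_contra hcon
        push Not at hcon
        obtain ⟨h1, h2⟩ := hcon
        have h3 := key ξ hξ x (by push Not; exact h1)
        rw [h2] at h3
        apply hm
        rw [← hπ]
        exact (mul_eq_right.1 h3.symm)
      have h2 := (Finset.card_le_card this).trans (Finset.card_union_le _ _)
      simp only [Finset.card_univ, Fintype.card_fin] at h2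
      exact_mod_cast h2
    linarith

lemma dH_mul {n : ℕ} (a b c d : Equiv.Perm (Fin n)) : dH (a * b) (c * d) ≤ dH a c + dH b d := by
  classical
  unfold dH
  rw [← add_div]
  gcongr
  have h1 : (Finset.univ.filter fun i => (a * b) i ≠ (c * d) i) ⊆
      ((Finset.univ.filter fun i => a i ≠ c i).image (b⁻¹ : Equiv.Perm (Fin n))) ∪
      (Finset.univ.filter fun i => b i ≠ d i) := by
    intro x hx
    simp only [Finset.mem_union, Finset.mem_image, Finset.mem_filter, Finset.mem_univ,
      true_and] at hx ⊢
    rw [Equiv.Perm.mul_apply, Equiv.Perm.mul_apply] at hx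
    by_cases h : b x = d x
    · left
      exact ⟨b x, by rwa [← h] at hx, by simp⟩
    · right; exact h
  have h2 := (Finset.card_le_card h1).trans (Finset.card_union_le _ _)
  have h3 := Finset.card_image_le (s := Finset.univ.filter fun i => a i ≠ c i)
    (f := (b⁻¹ : Equiv.Perm (Fin n)))
  exact_mod_cast h2.trans (by gcongr)

lemma dH_inv {n : ℕ} (a c : Equiv.Perm (Fin n)) : dH a⁻¹ c⁻¹ ≤ dH a c := by
  classical
  unfold dH
  refine div_le_div_of_nonneg_right (Nat.cast_le.2 ?_) (Nat.cast_nonneg n)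
  refine Finset.card_le_card_of_injOn (a⁻¹ : Equiv.Perm (Fin n)) ?_ (Equiv.injective _).injOn
  intro x hx
  simp only [Finset.coe_filter, Finset.mem_univ, true_and, Set.mem_ofPred_eq] at hx ⊢
  intro h
  apply hx
  rw [Equiv.Perm.eq_inv_iff_eq, ← h]
  simp

lemma dH_self {n : ℕ} (a : Equiv.Perm (Fin n)) : dH a a = 0 := by
  simp [dH]

lemma dH_word {m n : ℕ} (p q : Fin m → Equiv.Perm (Fin n)) {ε : ℝ}
    (h : ∀ i, dH (p i) (q i) ≤ ε) (L : List (Fin m × Bool)) :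
    dH (FreeGroup.lift p (FreeGroup.mk L)) (FreeGroup.lift q (FreeGroup.mk L)) ≤
      L.length * ε := by
  induction L with
  | nil => rw [← FreeGroup.one_eq_mk]; simp [dH_self]
  | cons a L ih =>
    obtain ⟨s, b⟩ := a
    have e : (FreeGroup.mk ((s, b) :: L) : FreeGroup (Fin m)) =
        FreeGroup.mk [(s, b)] * FreeGroup.mk L := by
      rw [FreeGroup.mul_mk]; rfl
    rw [e, map_mul, map_mul]
    refine (dH_mul _ _ _ _).trans ?_
    have : dH (FreeGroup.lift p (FreeGroup.mk [(s, b)]))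
        (FreeGroup.lift q (FreeGroup.mk [(s, b)])) ≤ ε := by
      cases b with
      | true =>
        have e2 : (FreeGroup.mk [(s, true)] : FreeGroup (Fin m)) = FreeGroup.of s := rfl
        rw [e2, FreeGroup.lift_apply_of, FreeGroup.lift_apply_of]
        exact h s
      | false =>
        have e2 : (FreeGroup.mk [(s, false)] : FreeGroup (Fin m)) = (FreeGroup.of s)⁻¹ := by
          simp [FreeGroup.of, FreeGroup.inv_mk, FreeGroup.invRev]
        rw [e2, map_inv, map_inv, FreeGroup.lift_apply_of, FreeGroup.lift_apply_of]
        exact (dH_inv _ _).trans (h s)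
    simp only [List.length_cons]
    push_cast
    linarith

lemma IsStrongSol.mono {m : ℕ} {R : Finset (FreeGroup (Fin m))} {δ δ' : ℝ} {n : ℕ}
    {p : Fin m → Equiv.Perm (Fin n)} (h : IsStrongSol R δ' p) (h0 : 0 < δ') (hle : δ' ≤ δ) :
    IsStrongSol R δ p := by
  intro ξ hξ
  have h1 := h ξ (hξ.trans_le (one_div_le_one_div_of_le h0 hle))
  exact ⟨fun hm => (h1.1 hm).trans_le hle, fun hm => lt_of_le_of_lt (by linarith) (h1.2 hm)⟩

lemma forward_dir (m : ℕ) (R : Finset (FreeGroup (Fin m)))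
    (hamen : Amenable
      (FreeGroup (Fin m) ⧸ Subgroup.normalClosure (R : Set (FreeGroup (Fin m)))))
    (hw : WeaklyStable R) :
    ResiduallyFinite
        (FreeGroup (Fin m) ⧸ Subgroup.normalClosure (R : Set (FreeGroup (Fin m)))) := by
  intro g hg
  obtain ⟨ξ, rfl⟩ := QuotientGroup.mk_surjective g
  have hξ : ξ ∉ Subgroup.normalClosure (R : Set (FreeGroup (Fin m))) :=
    fun h => hg ((QuotientGroup.eq_one_iff ξ).2 h)
  set ε : ℝ := 1 / (2 * ((ξ.norm : ℝ) + 1)) with hε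
  have hε0 : 0 < ε := by positivity
  obtain ⟨δ, hδ, hst⟩ := hw ε hε0
  have hδ' : 0 < min δ ε := lt_min hδ hε0
  obtain ⟨n, p, hp⟩ := exists_strong R hamen hδ'
  obtain ⟨q, hq, hpq⟩ := hst n p (hp.mono hδ' (min_le_left _ _))
  have hle : Subgroup.normalClosure (R : Set (FreeGroup (Fin m))) ≤ (FreeGroup.lift q).ker :=
    Subgroup.normalClosure_le_normal (fun x hx => hq x hx)
  refine ⟨Equiv.Perm (Fin n), inferInstance, inferInstance,
    QuotientGroup.lift _ (FreeGroup.lift q) hle, ?_⟩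
  intro h1
  have h2 : FreeGroup.lift q ξ = 1 := h1
  have h3 := dH_word p q (fun i => (hpq i).le) ξ.toWord
  rw [FreeGroup.mk_toWord, h2] at h3
  have hp2 := hp.mono hδ' (min_le_right _ _)
  have h4 := (hp2 ξ (by rw [hε, one_div_one_div]; linarith [(Nat.cast_nonneg ξ.norm : (0:ℝ) ≤ _)])).2 hξ
  have h5 : dH (FreeGroup.lift p ξ) 1 ≤ ξ.norm * ε := h3
  have h6 : 1 - ε < dH (FreeGroup.lift p ξ) 1 := h4
  have h7 : (ξ.norm + 1 : ℝ) * ε = 1 / 2 := by rw [hε]; field_simp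
  linarith
end ForwardPart

section MatchingPart
open Pointwise

/-- Points of an approximate action at which everything indexed by `U` behaves as in `G`. -/
def GoodPt {m : ℕ} {G X : Type*} [Group G] (σ : G → Equiv.Perm X) (P : Fin m → Equiv.Perm X)
    (γ : Fin m → G) (U : Finset G) (c : X) : Prop :=
  (∀ t ∈ U, ∀ u ∈ U, σ t c = σ u c → t = u) ∧
  (∀ s, ∀ t ∈ U, P s (σ t c) = σ (γ s * t) c) ∧
  (∀ t ∈ U, ∀ u ∈ U, σ t (σ (t⁻¹ * u) c) = σ u c)

open Classical in
/-- Centres `c` whose tile `T c` meets `A`. -/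
noncomputable def Bd {G X : Type*} [Fintype X] (σ : G → Equiv.Perm X) (T : Finset G)
    (A : Finset X) : Finset X :=
  Finset.univ.filter fun c => ∃ t ∈ T, σ t c ∈ A

open Classical in
lemma select_centre {G X : Type*} [Fintype X] (σ : G → Equiv.Perm X) (T : Finset G)
    (A0 A1 X0 : Finset X) {ε : ℝ} (hT : T.Nonempty) (hε : 0 < ε)
    (h : (A1.card : ℝ) < ε * (X0.card - (Bd σ T A0).card)) :
    ∃ c ∈ X0, (∀ t ∈ T, σ t c ∉ A0) ∧
      ((T.filter fun t => σ t c ∈ A1).card : ℝ) < ε * T.card := by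
  by_contra hcon
  push Not at hcon
  have hF : ∀ c ∈ X0 \ Bd σ T A0, ε * T.card ≤ ((T.filter fun t => σ t c ∈ A1).card : ℝ) := by
    intro c hc
    simp only [Finset.mem_sdiff, Bd, Finset.mem_filter, Finset.mem_univ, true_and] at hc
    push Not at hc
    exact hcon c hc.1 hc.2
  have h1 := Finset.card_nsmul_le_sum _ _ _ hF
  have h2 : ∑ c ∈ X0 \ Bd σ T A0, (T.filter fun t => σ t c ∈ A1).card ≤ T.card * A1.card := by
    have : ∀ c, (T.filter fun t => σ t c ∈ A1).card = ∑ t ∈ T, if σ t c ∈ A1 then 1 else 0 := by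
      intro c; rw [Finset.card_filter]
    simp_rw [this]
    rw [Finset.sum_comm, ← smul_eq_mul]
    refine Finset.sum_le_card_nsmul _ _ _ ?_
    intro t _
    rw [← Finset.card_filter]
    refine Finset.card_le_card_of_injOn (σ t) ?_ (σ t).injective.injOn
    intro c hc
    simp only [Finset.coe_filter, Set.mem_ofPred_eq] at hc
    exact hc.2
  have h3 : (X0.card : ℝ) - (Bd σ T A0).card ≤ ((X0 \ Bd σ T A0).card : ℝ) := by
    have := Finset.le_card_sdiff (Bd σ T A0) X0
    have h4 : X0.card ≤ (X0 \ Bd σ T A0).card + (Bd σ T A0).card := by omega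
    have : (X0.card : ℝ) ≤ ((X0 \ Bd σ T A0).card + (Bd σ T A0).card : ℕ) := by exact_mod_cast h4
    push_cast at this
    linarith
  have h4 : (∑ c ∈ X0 \ Bd σ T A0, ((T.filter fun t => σ t c ∈ A1).card : ℝ)) ≤
      T.card * A1.card := by exact_mod_cast h2
  rw [nsmul_eq_mul] at h1
  have hT' : (0 : ℝ) < T.card := by exact_mod_cast hT.card_pos
  have h5 : ε * (X0 \ Bd σ T A0).card * T.card ≤ A1.card * T.card := by linarith
  have h6 := le_of_mul_le_mul_right h5 hT'
  nlinarith

open Classical in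
lemma bd_tile {m : ℕ} {G X : Type*} [Group G] [Fintype X] {σ : G → Equiv.Perm X}
    {P : Fin m → Equiv.Perm X} {γ : Fin m → G} {U : Finset G} {c : X}
    (hc : GoodPt σ P γ U c) {T T' T1 : Finset G} (hT : T ⊆ U) (hT' : T' ⊆ U) (hT1 : T1 ⊆ T)
    (A : Finset X) :
    (Bd σ T' (A ∪ T1.image fun t => σ t c)).card ≤ (Bd σ T' A).card + (T'⁻¹ * T).card := by
  have : Bd σ T' (A ∪ T1.image fun t => σ t c) ⊆
      Bd σ T' A ∪ (T'⁻¹ * T).image fun g => σ g c := by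
    intro x hx
    simp only [Bd, Finset.mem_filter, Finset.mem_univ, true_and, Finset.mem_union] at hx ⊢
    obtain ⟨t, ht, h | h⟩ := hx
    · exact Or.inl ⟨t, ht, h⟩
    · right
      obtain ⟨u, hu, he⟩ := Finset.mem_image.1 h
      refine Finset.mem_image.2 ⟨t⁻¹ * u, Finset.mul_mem_mul (Finset.inv_mem_inv ht) (hT1 hu), ?_⟩
      apply (σ t).injective
      rw [hc.2.2 t (hT' ht) u (hT (hT1 hu)), he]
  refine (Finset.card_le_card this).trans ((Finset.card_union_le _ _).trans ?_)
  gcongr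
  exact Finset.card_image_le

open Classical in
/-- Invariants of a partial matching `M` between `X` and `Y`. -/
structure MInv {m : ℕ} {G X Y : Type*} [Fintype X] [Fintype Y] (σ : G → Equiv.Perm X)
    (τ : G → Equiv.Perm Y) (P : Fin m → Equiv.Perm X) (Q : Fin m → Equiv.Perm Y) (ε : ℝ)
    (Ts : List (Finset G)) (M : Finset (X × Y)) : Prop where
  inj1 : Set.InjOn Prod.fst (M : Set (X × Y))
  inj2 : Set.InjOn Prod.snd (M : Set (X × Y))
  defect : ∀ s, ((M.filter fun z => (P s z.1, Q s z.2) ∉ M).card : ℝ) ≤ 6 * ε * M.card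
  bd1 : ∀ T ∈ Ts, ((Bd σ T (M.image Prod.fst)).card : ℝ) ≤ (1 + 4 * ε) * M.card
  bd2 : ∀ T ∈ Ts, ((Bd τ T (M.image Prod.snd)).card : ℝ) ≤ (1 + 4 * ε) * M.card

open Classical in
lemma add_tile {m : ℕ} {G X Y : Type*} [Group G] [Fintype X] [Fintype Y] {σ : G → Equiv.Perm X}
    {τ : G → Equiv.Perm Y} {P : Fin m → Equiv.Perm X} {Q : Fin m → Equiv.Perm Y}
    {γ : Fin m → G} {U : Finset G} {ε : ℝ} (hε : 0 < ε) (hε8 : ε ≤ 1 / 8)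
    {Ts : List (Finset G)} {M : Finset (X × Y)} (hM : MInv σ τ P Q ε Ts M)
    {T : Finset G} (hTU : T ⊆ U)
    (hTinv : ∀ s, ((T.filter fun t => γ s * t ∉ T).card : ℝ) ≤ ε * T.card)
    (hTs : ∀ T' ∈ Ts, T' ⊆ U ∧ ((T'⁻¹ * T).card : ℝ) ≤ (1 + ε) * T.card)
    {c : X} {d : Y} (hc : GoodPt σ P γ U c) (hd : GoodPt τ Q γ U d)
    {T1 : Finset G} (hT1 : T1 ⊆ T) (hcard : (1 - 2 * ε) * T.card ≤ (T1.card : ℝ))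
    (hcM : ∀ t ∈ T1, σ t c ∉ M.image Prod.fst) (hdM : ∀ t ∈ T1, τ t d ∉ M.image Prod.snd) :
    ∃ M', M ⊆ M' ∧ M'.card = M.card + T1.card ∧ MInv σ τ P Q ε Ts M' := by
  set F : G → X × Y := fun t => (σ t c, τ t d) with hF
  set D := T1.image F with hD
  have hdisj : Disjoint M D := by
    rw [Finset.disjoint_right]
    intro z hz hzM
    obtain ⟨t, ht, rfl⟩ := Finset.mem_image.1 hz
    exact hcM t ht (Finset.mem_image.2 ⟨_, hzM, rfl⟩)
  have hFinj : Set.InjOn F (T1 : Set G) := by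
    intro t ht u hu htu
    exact hc.1 t (hTU (hT1 ht)) u (hTU (hT1 hu)) (congrArg Prod.fst htu)
  have hDc : D.card = T1.card := Finset.card_image_of_injOn hFinj
  have hM'c : (M ∪ D).card = M.card + T1.card := by
    rw [Finset.card_union_of_disjoint hdisj, hDc]
  have hTn : (0 : ℝ) ≤ T.card := Nat.cast_nonneg _
  have hTT : (T.card : ℝ) ≤ T.card := le_rfl
  refine ⟨M ∪ D, Finset.subset_union_left, hM'c, ?_, ?_, ?_, ?_, ?_⟩
  · intro z hz w hw hzw
    rcases Finset.mem_union.1 (Finset.mem_coe.1 hz) with hz | hz <;>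
      rcases Finset.mem_union.1 (Finset.mem_coe.1 hw) with hw | hw
    · exact hM.inj1 hz hw hzw
    · obtain ⟨t, ht, rfl⟩ := Finset.mem_image.1 hw
      exact absurd (Finset.mem_image.2 ⟨z, hz, hzw⟩) (hcM t ht)
    · obtain ⟨t, ht, rfl⟩ := Finset.mem_image.1 hz
      exact absurd (Finset.mem_image.2 ⟨w, hw, hzw.symm⟩) (hcM t ht)
    · obtain ⟨t, ht, rfl⟩ := Finset.mem_image.1 hz
      obtain ⟨u, hu, rfl⟩ := Finset.mem_image.1 hw
      rw [hc.1 t (hTU (hT1 ht)) u (hTU (hT1 hu)) hzw]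
  · intro z hz w hw hzw
    rcases Finset.mem_union.1 (Finset.mem_coe.1 hz) with hz | hz <;>
      rcases Finset.mem_union.1 (Finset.mem_coe.1 hw) with hw | hw
    · exact hM.inj2 hz hw hzw
    · obtain ⟨t, ht, rfl⟩ := Finset.mem_image.1 hw
      exact absurd (Finset.mem_image.2 ⟨z, hz, hzw⟩) (hdM t ht)
    · obtain ⟨t, ht, rfl⟩ := Finset.mem_image.1 hz
      exact absurd (Finset.mem_image.2 ⟨w, hw, hzw.symm⟩) (hdM t ht)
    · obtain ⟨t, ht, rfl⟩ := Finset.mem_image.1 hz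
      obtain ⟨u, hu, rfl⟩ := Finset.mem_image.1 hw
      rw [hd.1 t (hTU (hT1 ht)) u (hTU (hT1 hu)) hzw]
  · intro s
    have hsub : ((M ∪ D).filter fun z => (P s z.1, Q s z.2) ∉ M ∪ D) ⊆
        (M.filter fun z => (P s z.1, Q s z.2) ∉ M) ∪
          ((T.filter fun t => γ s * t ∉ T).image F ∪
            (T \ T1).image fun u => F ((γ s)⁻¹ * u)) := by
      intro z hz
      obtain ⟨hz, hz'⟩ := Finset.mem_filter.1 hz
      rcases Finset.mem_union.1 hz with hz | hz
      · refine Finset.mem_union_left _ (Finset.mem_filter.2 ⟨hz, ?_⟩)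
        exact fun h => hz' (Finset.mem_union_left _ h)
      · refine Finset.mem_union_right _ ?_
        obtain ⟨t, ht, rfl⟩ := Finset.mem_image.1 hz
        have e : (P s (F t).1, Q s (F t).2) = F (γ s * t) := by
          simp only [hF]
          rw [hc.2.1 s t (hTU (hT1 ht)), hd.2.1 s t (hTU (hT1 ht))]
        rw [e] at hz'
        by_cases hst : γ s * t ∈ T
        · refine Finset.mem_union_right _ (Finset.mem_image.2 ⟨γ s * t, ?_, by simp⟩)
          refine Finset.mem_sdiff.2 ⟨hst, fun h => hz' ?_⟩
          exact Finset.mem_union_right _ (Finset.mem_image_of_mem _ h)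
        · exact Finset.mem_union_left _ (Finset.mem_image_of_mem _
            (Finset.mem_filter.2 ⟨hT1 ht, hst⟩))
    have h1 : ((M ∪ D).filter fun z => (P s z.1, Q s z.2) ∉ M ∪ D).card ≤
        (M.filter fun z => (P s z.1, Q s z.2) ∉ M).card +
          ((T.filter fun t => γ s * t ∉ T).card + (T \ T1).card) := by
      refine (Finset.card_le_card hsub).trans ((Finset.card_union_le _ _).trans ?_)
      gcongr
      refine (Finset.card_union_le _ _).trans ?_
      gcongr <;> exact Finset.card_image_le
    have h2 : (((M ∪ D).filter fun z => (P s z.1, Q s z.2) ∉ M ∪ D).card : ℝ) ≤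
        (M.filter fun z => (P s z.1, Q s z.2) ∉ M).card +
          ((T.filter fun t => γ s * t ∉ T).card + (T \ T1).card) := by exact_mod_cast h1
    rw [Finset.cast_card_sdiff hT1] at h2
    have h3 := hM.defect s
    have h4 := hTinv s
    rw [hM'c]
    push_cast
    have h5 : 3 * ε * T.card ≤ 6 * ε * T1.card := by
      have : T.card ≤ 2 * (T1.card : ℝ) := by nlinarith
      nlinarith
    nlinarith
  · intro T' hT'
    have h1 := bd_tile hc hTU (hTs T' hT').1 hT1 (M.image Prod.fst)
    have e : (M ∪ D).image Prod.fst = M.image Prod.fst ∪ T1.image fun t => σ t c := by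
      rw [Finset.image_union, hD, Finset.image_image]; rfl
    rw [e, hM'c]
    have h2 : ((Bd σ T' (M.image Prod.fst ∪ T1.image fun t => σ t c)).card : ℝ) ≤
      (Bd σ T' (M.image Prod.fst)).card + (T'⁻¹ * T).card := by exact_mod_cast h1
    have h3 := hM.bd1 T' hT'
    have h4 := (hTs T' hT').2
    push_cast
    have h5 : (1 + ε) * T.card ≤ (1 + 4 * ε) * T1.card := by
      have : (1 + ε) ≤ (1 + 4 * ε) * (1 - 2 * ε) := by nlinarith
      calc (1 + ε) * (T.card : ℝ) ≤ (1 + 4 * ε) * (1 - 2 * ε) * T.card := by gcongr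
        _ = (1 + 4 * ε) * ((1 - 2 * ε) * T.card) := by ring
        _ ≤ _ := by gcongr
    linarith
  · intro T' hT'
    have h1 := bd_tile hd hTU (hTs T' hT').1 hT1 (M.image Prod.snd)
    have e : (M ∪ D).image Prod.snd = M.image Prod.snd ∪ T1.image fun t => τ t d := by
      rw [Finset.image_union, hD, Finset.image_image]; rfl
    rw [e, hM'c]
    have h2 : ((Bd τ T' (M.image Prod.snd ∪ T1.image fun t => τ t d)).card : ℝ) ≤
      (Bd τ T' (M.image Prod.snd)).card + (T'⁻¹ * T).card := by exact_mod_cast h1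
    have h3 := hM.bd2 T' hT'
    have h4 := (hTs T' hT').2
    push_cast
    have h5 : (1 + ε) * T.card ≤ (1 + 4 * ε) * T1.card := by
      have : (1 + ε) ≤ (1 + 4 * ε) * (1 - 2 * ε) := by nlinarith
      calc (1 + ε) * (T.card : ℝ) ≤ (1 + 4 * ε) * (1 - 2 * ε) * T.card := by gcongr
        _ = (1 + 4 * ε) * ((1 - 2 * ε) * T.card) := by ring
        _ ≤ _ := by gcongr
    linarith

open Classical in
lemma phase {m : ℕ} {G X Y : Type*} [Group G] [Fintype X] [Fintype Y] {σ : G → Equiv.Perm X}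
    {τ : G → Equiv.Perm Y} {P : Fin m → Equiv.Perm X} {Q : Fin m → Equiv.Perm Y}
    {γ : Fin m → G} {U : Finset G} {ε : ℝ} (hε : 0 < ε) (hε8 : ε ≤ 1 / 8)
    {Ts : List (Finset G)} {T : Finset G} {M0 : Finset (X × Y)}
    (hM0 : MInv σ τ P Q ε (T :: Ts) M0)
    (hTne : T.Nonempty) (hTU : T ⊆ U)
    (hTinv : ∀ s, ((T.filter fun t => γ s * t ∉ T).card : ℝ) ≤ ε * T.card)
    (hTs : ∀ T' ∈ Ts, T' ⊆ U ∧ ((T'⁻¹ * T).card : ℝ) ≤ (1 + ε) * T.card)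
    {N : ℝ} (hX : N ≤ ((Finset.univ.filter fun c => GoodPt σ P γ U c).card : ℝ))
    (hY : N ≤ ((Finset.univ.filter fun c => GoodPt τ Q γ U c).card : ℝ)) :
    ∃ M, MInv σ τ P Q ε Ts M ∧
      ε * (N - (1 + 4 * ε) * M0.card) ≤ (M.card : ℝ) - M0.card := by
  have hM0' : MInv σ τ P Q ε Ts M0 := ⟨hM0.inj1, hM0.inj2, hM0.defect,
    fun T hT => hM0.bd1 T (List.mem_cons_of_mem _ hT),
    fun T hT => hM0.bd2 T (List.mem_cons_of_mem _ hT)⟩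
  obtain ⟨M, hM, hmax⟩ := Finset.exists_max_image
    (Finset.univ.filter fun M : Finset (X × Y) => M0 ⊆ M ∧ MInv σ τ P Q ε Ts M) Finset.card
    ⟨M0, by simp [hM0']⟩
  simp only [Finset.mem_filter, Finset.mem_univ, true_and] at hM hmax
  refine ⟨M, hM.2, ?_⟩
  by_contra hcon
  push Not at hcon
  have hsd : ((M \ M0).card : ℝ) = M.card - M0.card := Finset.cast_card_sdiff hM.1
  have hb1 := hM0.bd1 T List.mem_cons_self
  have hb2 := hM0.bd2 T List.mem_cons_self
  obtain ⟨c, hc, hc0, hc1⟩ := select_centre σ T (M0.image Prod.fst) ((M \ M0).image Prod.fst)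
    (Finset.univ.filter fun c => GoodPt σ P γ U c) hTne hε (by
      have h1 : (((M \ M0).image Prod.fst).card : ℝ) ≤ (M \ M0).card := by
        exact_mod_cast Finset.card_image_le
      refine lt_of_le_of_lt h1 ?_
      rw [hsd]
      refine lt_of_lt_of_le hcon ?_
      gcongr)
  obtain ⟨d, hd, hd0, hd1⟩ := select_centre τ T (M0.image Prod.snd) ((M \ M0).image Prod.snd)
    (Finset.univ.filter fun c => GoodPt τ Q γ U c) hTne hε (by
      have h1 : (((M \ M0).image Prod.snd).card : ℝ) ≤ (M \ M0).card := by
        exact_mod_cast Finset.card_image_le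
      refine lt_of_le_of_lt h1 ?_
      rw [hsd]
      refine lt_of_lt_of_le hcon ?_
      gcongr)
  simp only [Finset.mem_filter, Finset.mem_univ, true_and] at hc hd
  set B1 := T.filter fun t => σ t c ∈ (M \ M0).image Prod.fst with hB1
  set B2 := T.filter fun t => τ t d ∈ (M \ M0).image Prod.snd with hB2
  have hcard : (1 - 2 * ε) * T.card ≤ ((T \ (B1 ∪ B2)).card : ℝ) := by
    have hs : B1 ∪ B2 ⊆ T := Finset.union_subset (Finset.filter_subset _ _)
      (Finset.filter_subset _ _)
    rw [Finset.cast_card_sdiff hs]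
    have : ((B1 ∪ B2).card : ℝ) ≤ B1.card + B2.card := by
      exact_mod_cast Finset.card_union_le _ _
    linarith
  have hTpos : (0 : ℝ) < T.card := by exact_mod_cast hTne.card_pos
  obtain ⟨M', hMM', hM'c, hM'⟩ := add_tile hε hε8 hM.2 hTU hTinv hTs hc hd
    (T1 := T \ (B1 ∪ B2)) Finset.sdiff_subset hcard (by
      intro t ht hmem
      rw [Finset.mem_sdiff, Finset.mem_union, not_or] at ht
      obtain ⟨z, hz, hzt⟩ := Finset.mem_image.1 hmem
      by_cases hz0 : z ∈ M0
      · exact hc0 t ht.1 (Finset.mem_image.2 ⟨z, hz0, hzt⟩)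
      · exact ht.2.1 (Finset.mem_filter.2 ⟨ht.1,
          Finset.mem_image.2 ⟨z, Finset.mem_sdiff.2 ⟨hz, hz0⟩, hzt⟩⟩)) (by
      intro t ht hmem
      rw [Finset.mem_sdiff, Finset.mem_union, not_or] at ht
      obtain ⟨z, hz, hzt⟩ := Finset.mem_image.1 hmem
      by_cases hz0 : z ∈ M0
      · exact hd0 t ht.1 (Finset.mem_image.2 ⟨z, hz0, hzt⟩)
      · exact ht.2.2 (Finset.mem_filter.2 ⟨ht.1,
          Finset.mem_image.2 ⟨z, Finset.mem_sdiff.2 ⟨hz, hz0⟩, hzt⟩⟩))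
  have h1 := hmax M' ⟨hM.1.trans hMM', hM'⟩
  have h2 : (0 : ℝ) < (T \ (B1 ∪ B2)).card := lt_of_lt_of_le (by
    have : 0 < 1 - 2 * ε := by linarith
    positivity) hcard
  have h3 : 0 < (T \ (B1 ∪ B2)).card := by exact_mod_cast h2
  omega

open Classical in
lemma phases {m : ℕ} {G X Y : Type*} [Group G] [Fintype X] [Fintype Y] {σ : G → Equiv.Perm X}
    {τ : G → Equiv.Perm Y} {P : Fin m → Equiv.Perm X} {Q : Fin m → Equiv.Perm Y}
    {γ : Fin m → G} {U : Finset G} {ε : ℝ} (hε : 0 < ε) (hε8 : ε ≤ 1 / 8)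
    {N : ℝ} (hX : N ≤ ((Finset.univ.filter fun c => GoodPt σ P γ U c).card : ℝ))
    (hY : N ≤ ((Finset.univ.filter fun c => GoodPt τ Q γ U c).card : ℝ))
    (Ts : List (Finset G)) :
    ∀ (M0 : Finset (X × Y)) (B : ℝ), 0 ≤ B → N - (1 + 4 * ε) * M0.card ≤ B →
    MInv σ τ P Q ε Ts M0 →
    (∀ T ∈ Ts, T.Nonempty ∧ T ⊆ U ∧
      ∀ s, ((T.filter fun t => γ s * t ∉ T).card : ℝ) ≤ ε * T.card) →
    Ts.Pairwise (fun T T' => ((T'⁻¹ * T).card : ℝ) ≤ (1 + ε) * T.card) →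
    ∃ M, MInv σ τ P Q ε [] M ∧ N - (1 + 4 * ε) * M.card ≤ (1 - ε) ^ Ts.length * B := by
  induction Ts with
  | nil =>
    intro M0 B _ hB hM _ _
    exact ⟨M0, hM, by simpa using hB⟩
  | cons T Ts ih =>
    intro M0 B hB0 hB hM hTs hpw
    rw [List.pairwise_cons] at hpw
    obtain ⟨h1, h2, h3⟩ := hTs T List.mem_cons_self
    obtain ⟨M1, hM1, hM1c⟩ := phase hε hε8 hM h1 h2 h3
      (fun T' hT' => ⟨(hTs T' (List.mem_cons_of_mem _ hT')).2.1, hpw.1 T' hT'⟩) hX hY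
    obtain ⟨M, hM', hMc⟩ := ih M1 ((1 - ε) * B) (by
        have : 0 ≤ 1 - ε := by linarith
        positivity) (by
        set b := N - (1 + 4 * ε) * M0.card with hb
        have e1 : N - (1 + 4 * ε) * M1.card ≤ (1 - (1 + 4 * ε) * ε) * b := by
          have : (1 + 4 * ε) * (ε * b) ≤ (1 + 4 * ε) * ((M1.card : ℝ) - M0.card) := by gcongr
          rw [hb] at this ⊢
          linarith
        have e2 : 0 ≤ 1 - (1 + 4 * ε) * ε := by nlinarith
        have e3 : (1 - (1 + 4 * ε) * ε) * b ≤ (1 - (1 + 4 * ε) * ε) * B := by gcongr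
        have e4 : (1 - (1 + 4 * ε) * ε) * B ≤ (1 - ε) * B := by
          gcongr
          nlinarith
        linarith) hM1
      (fun T' hT' => hTs T' (List.mem_cons_of_mem _ hT')) hpw.2
    refine ⟨M, hM', hMc.trans (le_of_eq ?_)⟩
    rw [List.length_cons, pow_succ]; ring

open Classical in
lemma exists_tiles {m : ℕ} {G : Type*} [Group G] (h : Amenable G) (γ : Fin m → G)
    {ε : ℝ} (hε : 0 < ε) (k : ℕ) :
    ∃ Ts : List (Finset G), Ts.length = k ∧
      (∀ T ∈ Ts, T.Nonempty ∧
        ∀ s, ((T.filter fun t => γ s * t ∉ T).card : ℝ) ≤ ε * T.card) ∧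
      Ts.Pairwise (fun T T' => ((T'⁻¹ * T).card : ℝ) ≤ (1 + ε) * T.card) := by
  induction k with
  | zero => exact ⟨[], rfl, by simp, by simp⟩
  | succ k ih =>
    obtain ⟨Ts, hlen, hTs, hpw⟩ := ih
    let K : Finset G := insert 1 (Finset.univ.image γ ∪ Ts.toFinset.biUnion fun T => T⁻¹)
    obtain ⟨A, hA, hAc⟩ := folner h K hε
    refine ⟨A :: Ts, by simp [hlen], ?_, List.pairwise_cons.2 ⟨?_, hpw⟩⟩
    · intro T hT
      rcases List.mem_cons.1 hT with rfl | hT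
      · refine ⟨hA, fun s => ?_⟩
        have hsub : T ⊆ K * T := fun a ha =>
          Finset.mem_mul.2 ⟨1, by simp [K], a, ha, by simp⟩
        have h1 : (T.filter fun t => γ s * t ∉ T).card ≤ ((K * T) \ T).card := by
          refine Finset.card_le_card_of_injOn (fun t => γ s * t) ?_
            (fun a _ b _ hab => mul_left_cancel hab)
          intro t ht
          simp only [Finset.coe_filter, Set.mem_ofPred_eq] at ht
          simp only [Finset.coe_sdiff, Set.mem_sdiff, Finset.mem_coe]
          exact ⟨Finset.mul_mem_mul (by simp [K]) ht.1, ht.2⟩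
        have h2 : ((T.filter fun t => γ s * t ∉ T).card : ℝ) ≤ ((K * T) \ T).card := by
          exact_mod_cast h1
        rw [Finset.cast_card_sdiff hsub] at h2
        linarith
      · exact hTs T hT
    · intro T' hT'
      refine le_trans ?_ hAc
      refine Nat.cast_le.2 (Finset.card_le_card (Finset.mul_subset_mul_right ?_))
      intro x hx
      refine Finset.mem_insert_of_mem (Finset.mem_union_right _ ?_)
      exact Finset.mem_biUnion.2 ⟨T', by simpa using hT', hx⟩

open Classical in
lemma exists_matching {m : ℕ} {G : Type*} [Group G] (h : Amenable G) (γ : Fin m → G)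
    {ε : ℝ} (hε : 0 < ε) (hε8 : ε ≤ 1 / 8) :
    ∃ U : Finset G, ∀ (n : ℕ) (σ τ : G → Equiv.Perm (Fin n)) (P Q : Fin m → Equiv.Perm (Fin n)),
      (1 - ε) * n ≤ ((Finset.univ.filter fun c => GoodPt σ P γ U c).card : ℝ) →
      (1 - ε) * n ≤ ((Finset.univ.filter fun c => GoodPt τ Q γ U c).card : ℝ) →
      ∃ φ : Equiv.Perm (Fin n), ∀ s,
        ((Finset.univ.filter fun x => φ (P s x) ≠ Q s (φ x)).card : ℝ) ≤ 12 * ε * n := by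
  obtain ⟨k, hk⟩ := exists_pow_lt_of_lt_one hε (show 1 - ε < 1 by linarith)
  obtain ⟨Ts, hlen, hTs, hpw⟩ := exists_tiles h γ hε k
  refine ⟨Ts.toFinset.biUnion id, ?_⟩
  intro n σ τ P Q hX hY
  have hn : (0 : ℝ) ≤ n := Nat.cast_nonneg n
  obtain ⟨M, hM, hMc⟩ := phases hε hε8 hX hY Ts ∅ n hn (by simp; nlinarith)
    ⟨by simp, by simp, by simp, by simp [Bd], by simp [Bd]⟩
    (fun T hT => ⟨(hTs T hT).1, by
      intro t ht
      exact Finset.mem_biUnion.2 ⟨T, by simpa using hT, ht⟩, (hTs T hT).2⟩) hpw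
  rw [hlen] at hMc
  have hMn : (1 - 6 * ε) * n ≤ (M.card : ℝ) := by
    have h1 : (1 - ε) ^ k * n ≤ ε * n := by gcongr
    have h2 : (1 - 2 * ε) * n ≤ (1 + 4 * ε) * M.card := by linarith
    have h3 : (1 + 4 * ε) * ((1 - 6 * ε) * n) ≤ (1 + 4 * ε) * M.card := by
      refine le_trans ?_ h2
      rw [← mul_assoc]
      gcongr
      nlinarith
    exact le_of_mul_le_mul_left h3 (by linarith)
  let f : Fin n → Fin n := fun x => if h : ∃ y, (x, y) ∈ M then h.choose else x
  have hf : ∀ z ∈ M, f z.1 = z.2 := by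
    intro z hz
    have hex : ∃ y, (z.1, y) ∈ M := ⟨z.2, hz⟩
    have : f z.1 = hex.choose := dif_pos hex
    rw [this]
    exact congrArg Prod.snd (hM.inj1 (Finset.mem_coe.2 hex.choose_spec) (Finset.mem_coe.2 hz) rfl)
  obtain ⟨φ, hφ⟩ := exists_equiv_extend rfl (M.image Prod.fst) f (by
    intro x hx y hy hxy
    obtain ⟨z, hz, rfl⟩ := Finset.mem_image.1 (Finset.mem_coe.1 hx)
    obtain ⟨w, hw, rfl⟩ := Finset.mem_image.1 (Finset.mem_coe.1 hy)
    rw [hf z hz, hf w hw] at hxy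
    rw [hM.inj2 (Finset.mem_coe.2 hz) (Finset.mem_coe.2 hw) hxy])
  have hφM : ∀ z ∈ M, φ z.1 = z.2 := fun z hz => by
    rw [hφ _ (Finset.mem_image_of_mem _ hz), hf z hz]
  refine ⟨φ, fun s => ?_⟩
  have hsub : (Finset.univ.filter fun x => φ (P s x) ≠ Q s (φ x)) ⊆
      (M.image Prod.fst)ᶜ ∪ (M.filter fun z => (P s z.1, Q s z.2) ∉ M).image Prod.fst := by
    intro x hx
    simp only [Finset.mem_filter, Finset.mem_univ, true_and] at hx
    by_cases hxM : x ∈ M.image Prod.fst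
    · refine Finset.mem_union_right _ ?_
      obtain ⟨z, hz, rfl⟩ := Finset.mem_image.1 hxM
      refine Finset.mem_image.2 ⟨z, Finset.mem_filter.2 ⟨hz, fun hmem => hx ?_⟩, rfl⟩
      rw [hφM z hz]
      exact hφM _ hmem
    · exact Finset.mem_union_left _ (Finset.mem_compl.2 hxM)
  have h1 : (Finset.univ.filter fun x => φ (P s x) ≠ Q s (φ x)).card ≤
      (M.image Prod.fst)ᶜ.card + (M.filter fun z => (P s z.1, Q s z.2) ∉ M).card :=
    (Finset.card_le_card hsub).trans ((Finset.card_union_le _ _).trans (by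
      gcongr; exact Finset.card_image_le))
  have h2 : (M.image Prod.fst).card = M.card := Finset.card_image_of_injOn hM.inj1
  have h3 : (M.image Prod.fst)ᶜ.card + M.card = n := by
    rw [← h2, add_comm, Finset.card_add_card_compl]; simp
  have h4 : ((M.image Prod.fst)ᶜ.card : ℝ) + M.card = n := by exact_mod_cast h3
  have h5 : ((Finset.univ.filter fun x => φ (P s x) ≠ Q s (φ x)).card : ℝ) ≤
      (M.image Prod.fst)ᶜ.card + (M.filter fun z => (P s z.1, Q s z.2) ∉ M).card := by
    exact_mod_cast h1
  have h6 : ((M.filter fun z => (P s z.1, Q s z.2) ∉ M).card : ℝ) ≤ 6 * ε * M.card := by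
    convert hM.defect s
  have h7 : (M.card : ℝ) ≤ n := by
    have : (0:ℝ) ≤ (M.image Prod.fst)ᶜ.card := Nat.cast_nonneg _
    linarith
  have h8 : 6 * ε * M.card ≤ 6 * ε * (n : ℝ) := by gcongr
  refine h5.trans ?_
  linarith
end MatchingPart

section BackwardPart
open Pointwise

open Classical in
lemma exists_words {m : ℕ} (N : Subgroup (FreeGroup (Fin m))) [N.Normal]
    (U : Finset (FreeGroup (Fin m) ⧸ N)) :
    ∃ (W : Finset (FreeGroup (Fin m))) (r : FreeGroup (Fin m) ⧸ N → FreeGroup (Fin m)),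
      ∀ (n : ℕ) (p : Fin m → Equiv.Perm (Fin n)) (c : Fin n),
        (∀ w ∈ W, FreeGroup.lift p w c = c ↔ w ∈ N) →
        GoodPt (fun g => FreeGroup.lift p (r g)) p
          (fun s => (QuotientGroup.mk (FreeGroup.of s) : FreeGroup (Fin m) ⧸ N)) U c := by
  let r : FreeGroup (Fin m) ⧸ N → FreeGroup (Fin m) := Quotient.out
  have hr : ∀ g, (QuotientGroup.mk (r g) : FreeGroup (Fin m) ⧸ N) = g :=
    fun g => QuotientGroup.out_eq' g
  let W1 : Finset (FreeGroup (Fin m)) := (U ×ˢ U).image fun z => (r z.1)⁻¹ * r z.2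
  let W2 : Finset (FreeGroup (Fin m)) := ((Finset.univ : Finset (Fin m)) ×ˢ U).image fun z =>
    (r ((QuotientGroup.mk (FreeGroup.of z.1) : FreeGroup (Fin m) ⧸ N) * z.2))⁻¹ *
      (FreeGroup.of z.1 * r z.2)
  let W3 : Finset (FreeGroup (Fin m)) := (U ×ˢ U).image fun z =>
    (r z.2)⁻¹ * (r z.1 * r (z.1⁻¹ * z.2))
  refine ⟨W1 ∪ W2 ∪ W3, r, ?_⟩
  intro n p c hc
  have key : ∀ a b : FreeGroup (Fin m), a⁻¹ * b ∈ W1 ∪ W2 ∪ W3 →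
      (FreeGroup.lift p b c = FreeGroup.lift p a c ↔
        (QuotientGroup.mk a : FreeGroup (Fin m) ⧸ N) = QuotientGroup.mk b) := by
    intro a b hab
    rw [QuotientGroup.eq, ← hc _ hab, map_mul, map_inv, Equiv.Perm.mul_apply,
      Equiv.Perm.inv_eq_iff_eq]
  refine ⟨?_, ?_, ?_⟩
  · intro t ht u hu htu
    have := (key (r t) (r u) (Finset.mem_union_left _ (Finset.mem_union_left _
      (Finset.mem_image.2 ⟨(t, u), by simp [ht, hu], rfl⟩)))).1 htu.symm
    rwa [hr, hr] at this
  · intro s t ht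
    have := (key (r ((QuotientGroup.mk (FreeGroup.of s) : FreeGroup (Fin m) ⧸ N) * t))
      (FreeGroup.of s * r t) (Finset.mem_union_left _ (Finset.mem_union_right _
      (Finset.mem_image.2 ⟨(s, t), by simp [ht], rfl⟩)))).2 (by
        rw [hr, QuotientGroup.mk_mul, hr])
    rw [map_mul, Equiv.Perm.mul_apply, FreeGroup.lift_apply_of] at this
    exact this
  · intro t ht u hu
    have := (key (r u) (r t * r (t⁻¹ * u)) (Finset.mem_union_right _
      (Finset.mem_image.2 ⟨(t, u), by simp [ht, hu], rfl⟩))).2 (by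
        rw [QuotientGroup.mk_mul, hr, hr, hr]; group)
    rw [map_mul, Equiv.Perm.mul_apply] at this
    exact this

lemma exists_finite_quotient {m : ℕ} (N : Subgroup (FreeGroup (Fin m))) [N.Normal]
    (hrf : ResiduallyFinite (FreeGroup (Fin m) ⧸ N)) (W : Finset (FreeGroup (Fin m))) :
    ∃ (H : Type) (_ : Group H) (_ : Finite H) (ψ : FreeGroup (Fin m) →* H),
      N ≤ ψ.ker ∧ ∀ w ∈ W, ψ w = 1 → w ∈ N := by
  classical
  induction W using Finset.induction_on with
  | empty => exact ⟨Unit, inferInstance, inferInstance, 1, by simp [MonoidHom.ker_one], by simp⟩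
  | insert a W _ ih =>
    obtain ⟨H, hG, hF, ψ, h1, h2⟩ := ih
    by_cases ha : a ∈ N
    · refine ⟨H, hG, hF, ψ, h1, ?_⟩
      intro w hw hw1
      rcases Finset.mem_insert.1 hw with rfl | hw
      · exact ha
      · exact h2 w hw hw1
    · obtain ⟨F, hFg, hFf, φ, hφ⟩ := hrf (QuotientGroup.mk a)
        (fun h => ha ((QuotientGroup.eq_one_iff a).1 h))
      refine ⟨F × H, inferInstance, inferInstance,
        (φ.comp (QuotientGroup.mk' N)).prod ψ, ?_, ?_⟩
      · intro x hx
        have e1 : (QuotientGroup.mk' N) x = 1 := (QuotientGroup.eq_one_iff x).2 hx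
        have e2 : ψ x = 1 := h1 hx
        rw [MonoidHom.mem_ker, MonoidHom.prod_apply, MonoidHom.comp_apply, e1, e2, map_one]
        rfl
      · intro w hw hw1
        rw [MonoidHom.prod_apply, Prod.mk_eq_one] at hw1
        rcases Finset.mem_insert.1 hw with rfl | hw
        · exact absurd hw1.1 hφ
        · exact h2 w hw hw1.2

/-- Left translation on copies of `H`, trivial on the second summand. -/
def copiesHom (H A B : Type) [Group H] : H →* Equiv.Perm ((A × H) ⊕ B) :=
  MonoidHom.mk' (fun x => Equiv.sumCongr
    (Equiv.prodCongr (Equiv.refl A) (Equiv.mulLeft x)) (Equiv.refl B)) (by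
      intro x y
      ext z
      rcases z with ⟨a, z⟩ | b
      · simp [mul_assoc]
      · simp)

open Classical in
lemma exists_action {m : ℕ} (N : Subgroup (FreeGroup (Fin m))) [N.Normal]
    (hrf : ResiduallyFinite (FreeGroup (Fin m) ⧸ N)) (W : Finset (FreeGroup (Fin m))) :
    ∃ h : ℕ, ∀ n : ℕ, ∃ q : Fin m → Equiv.Perm (Fin n),
      (∀ ξ ∈ N, FreeGroup.lift q ξ = 1) ∧
      (Finset.univ.filter fun c => ¬ ∀ w ∈ W, FreeGroup.lift q w c = c ↔ w ∈ N).card ≤ h := by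
  obtain ⟨H, hG, hF, ψ, h1, h2⟩ := exists_finite_quotient N hrf W
  have : Fintype H := Fintype.ofFinite H
  have hpos : 0 < Fintype.card H := Fintype.card_pos
  refine ⟨Fintype.card H, fun n => ?_⟩
  let e : (Fin (n / Fintype.card H) × H) ⊕ Fin (n % Fintype.card H) ≃ Fin n :=
    Fintype.equivOfCardEq (by
      simp only [Fintype.card_sum, Fintype.card_prod, Fintype.card_fin]
      exact Nat.div_add_mod' n _)
  let Θ : FreeGroup (Fin m) →* Equiv.Perm (Fin n) :=
    (Equiv.permCongrHom e).toMonoidHom.comp ((copiesHom H _ _).comp ψ)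
  let q : Fin m → Equiv.Perm (Fin n) := fun s => Θ (FreeGroup.of s)
  have hq : FreeGroup.lift q = Θ := by
    ext s : 1
    simp [q]
  refine ⟨q, ?_, ?_⟩
  · intro ξ hξ
    have : ψ ξ = 1 := h1 hξ
    rw [hq]
    simp only [Θ, MonoidHom.comp_apply, this, map_one]
  · have hsub : (Finset.univ.filter fun c => ¬ ∀ w ∈ W, FreeGroup.lift q w c = c ↔ w ∈ N) ⊆
        (Finset.univ : Finset (Fin (n % Fintype.card H))).image fun b => e (Sum.inr b) := by
      intro c hc
      simp only [Finset.mem_filter, Finset.mem_univ, true_and] at hc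
      rcases he : e.symm c with ⟨a, z⟩ | b
      · exfalso
        apply hc
        intro w hw
        have hc' : c = e (Sum.inl (a, z)) := by rw [← he]; simp
        have : Θ w c = e (Sum.inl (a, ψ w * z)) := by
          rw [hc']
          simp [Θ, copiesHom, Equiv.permCongrHom]
        rw [hq, this, hc']
        simp only [EmbeddingLike.apply_eq_iff_eq, Sum.inl.injEq, Prod.mk.injEq, true_and,
          mul_eq_right]
        exact ⟨h2 w hw, fun h => h1 h⟩
      · exact Finset.mem_image.2 ⟨b, Finset.mem_univ _, by rw [← he]; simp⟩
    refine (Finset.card_le_card hsub).trans (Finset.card_image_le.trans ?_)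
    simp only [Finset.card_univ, Fintype.card_fin]
    exact (Nat.mod_lt _ hpos).le

open Classical in
lemma strong_good {m : ℕ} {R : Finset (FreeGroup (Fin m))} {δ : ℝ} {n : ℕ}
    {p : Fin m → Equiv.Perm (Fin n)} (hp : IsStrongSol R δ p) (W : Finset (FreeGroup (Fin m)))
    (hW : ∀ w ∈ W, (FreeGroup.norm w : ℝ) < 1 / δ) (hn : 0 < n) :
    ((Finset.univ.filter fun c => ¬ ∀ w ∈ W, FreeGroup.lift p w c = c ↔
      w ∈ Subgroup.normalClosure (R : Set (FreeGroup (Fin m)))).card : ℝ) ≤ W.card * (δ * n) := by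
  set N := Subgroup.normalClosure (R : Set (FreeGroup (Fin m))) with hN
  have hn' : (0 : ℝ) < n := by exact_mod_cast hn
  have h1 : ∀ w ∈ W, ((Finset.univ.filter fun c => ¬ (FreeGroup.lift p w c = c ↔
      w ∈ N)).card : ℝ) ≤ δ * n := by
    intro w hw
    obtain ⟨ha, hb⟩ := hp w (hW w hw)
    by_cases hwN : w ∈ N
    · have := ha hwN
      unfold dH at this
      rw [div_lt_iff₀ hn'] at this
      simp only [hwN, iff_true]
      refine le_trans (le_of_eq ?_) this.le
      congr 2
    · have := hb hwN
      unfold dH at this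
      rw [lt_div_iff₀ hn'] at this
      simp only [hwN, iff_false, not_not]
      have h2 := Finset.card_filter_add_card_filter_not (s := (Finset.univ : Finset (Fin n)))
        (fun c => FreeGroup.lift p w c = c)
      have h3 : ((Finset.univ.filter fun i => evalWord w p i ≠
          (1 : Equiv.Perm (Fin n)) i).card : ℝ) =
          (Finset.univ.filter fun c => ¬ FreeGroup.lift p w c = c).card := by
        congr 2
      rw [h3] at this
      simp only [Finset.card_univ, Fintype.card_fin] at h2
      have h4 : ((Finset.univ.filter fun c => FreeGroup.lift p w c = c).card : ℝ) +
        (Finset.univ.filter fun c => ¬ FreeGroup.lift p w c = c).card = n := by exact_mod_cast h2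
      linarith
  have hsub : (Finset.univ.filter fun c => ¬ ∀ w ∈ W, FreeGroup.lift p w c = c ↔ w ∈ N) ⊆
      W.biUnion fun w => Finset.univ.filter fun c => ¬ (FreeGroup.lift p w c = c ↔ w ∈ N) := by
    intro c hc
    simp only [Finset.mem_filter, Finset.mem_univ, true_and, Finset.mem_biUnion] at hc ⊢
    push Not at hc
    obtain ⟨w, hw, h⟩ := hc
    refine ⟨w, hw, ?_⟩
    tauto
  have h2 := (Finset.card_le_card hsub).trans Finset.card_biUnion_le
  calc ((Finset.univ.filter fun c => ¬ ∀ w ∈ W, FreeGroup.lift p w c = c ↔ w ∈ N).card : ℝ)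
      ≤ ∑ w ∈ W, ((Finset.univ.filter fun c => ¬ (FreeGroup.lift p w c = c ↔
        w ∈ N)).card : ℝ) := by exact_mod_cast h2
    _ ≤ ∑ w ∈ W, δ * n := Finset.sum_le_sum h1
    _ = W.card * (δ * n) := by rw [Finset.sum_const, nsmul_eq_mul]

open Classical in
lemma good_count {n : ℕ} {Pr Gd : Fin n → Prop} (h : ∀ c, Pr c → Gd c) {ε : ℝ}
    (hb : ((Finset.univ.filter fun c => ¬ Pr c).card : ℝ) ≤ ε * n) :
    (1 - ε) * n ≤ ((Finset.univ.filter fun c => Gd c).card : ℝ) := by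
  have h2 := Finset.card_filter_add_card_filter_not (s := (Finset.univ : Finset (Fin n))) Pr
  simp only [Finset.card_univ, Fintype.card_fin] at h2
  have h3 : (Finset.univ.filter Pr).card ≤ (Finset.univ.filter fun c => Gd c).card :=
    Finset.card_le_card (fun c hc => by
      simp only [Finset.mem_filter, Finset.mem_univ, true_and] at hc ⊢
      exact h c hc)
  have h4 : ((Finset.univ.filter Pr).card : ℝ) + (Finset.univ.filter fun c => ¬ Pr c).card = n := by
    exact_mod_cast h2
  have h5 : ((Finset.univ.filter Pr).card : ℝ) ≤ (Finset.univ.filter fun c => Gd c).card := by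
    exact_mod_cast h3
  linarith

lemma backward_dir (m : ℕ) (R : Finset (FreeGroup (Fin m)))
    (hamen : Amenable
      (FreeGroup (Fin m) ⧸ Subgroup.normalClosure (R : Set (FreeGroup (Fin m)))))
    (hrf : ResiduallyFinite
        (FreeGroup (Fin m) ⧸ Subgroup.normalClosure (R : Set (FreeGroup (Fin m))))) :
    WeaklyStable R := by
  classical
  intro ε0 hε0
  set N := Subgroup.normalClosure (R : Set (FreeGroup (Fin m))) with hN
  set ε : ℝ := min (1 / 8) (ε0 / 24) with hεd
  have hε : 0 < ε := lt_min (by norm_num) (by positivity)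
  have hε8 : ε ≤ 1 / 8 := min_le_left _ _
  have hε24 : ε ≤ ε0 / 24 := min_le_right _ _
  obtain ⟨U, hU⟩ := exists_matching hamen
    (fun s : Fin m => (QuotientGroup.mk (FreeGroup.of s) : FreeGroup (Fin m) ⧸ N)) hε hε8
  obtain ⟨W, r, hW⟩ := exists_words N U
  obtain ⟨h, hh⟩ := exists_action N hrf W
  set B : ℝ := ∑ w ∈ W ∪ R, (FreeGroup.norm w : ℝ) with hB
  have hB0 : 0 ≤ B := Finset.sum_nonneg (fun _ _ => Nat.cast_nonneg _)
  set D : ℝ := B + 1 + W.card / ε + h / ε with hD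
  have hW0 : (0 : ℝ) ≤ W.card / ε := by positivity
  have hh0 : (0 : ℝ) ≤ h / ε := by positivity
  have hD0 : 0 < D := by linarith
  have hnorm : ∀ w ∈ W ∪ R, (FreeGroup.norm w : ℝ) < 1 / (1 / D) := by
    intro w hw
    rw [one_div_one_div]
    have := Finset.single_le_sum (f := fun w => (FreeGroup.norm w : ℝ))
      (fun _ _ => Nat.cast_nonneg _) hw
    have h2 : (FreeGroup.norm w : ℝ) ≤ B := this
    linarith
  refine ⟨1 / D, by positivity, ?_⟩
  intro n p hp
  rcases Nat.eq_zero_or_pos n with rfl | hn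
  · exact ⟨p, fun ξ _ => Subsingleton.elim _ _, fun i => by rw [dH_self]; exact hε0⟩
  have hn' : (0 : ℝ) < n := by exact_mod_cast hn
  by_cases hlt : (n : ℝ) < h / ε
  · refine ⟨p, fun ξ hξ => ?_, fun i => by rw [dH_self]; exact hε0⟩
    have h1 := (hp ξ (hnorm ξ (Finset.mem_union_right _ hξ))).1
      (Subgroup.subset_normalClosure hξ)
    unfold dH at h1
    rw [div_lt_iff₀ hn', one_div, inv_mul_eq_div] at h1
    have h2 : (n : ℝ) / D < 1 := by rw [div_lt_one hD0]; linarith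
    have h3 : (Finset.univ.filter fun i => evalWord ξ p i ≠
        (1 : Equiv.Perm (Fin n)) i).card < 1 := by exact_mod_cast h1.trans h2
    rw [Nat.lt_one_iff, Finset.card_eq_zero, Finset.filter_eq_empty_iff] at h3
    ext1 i
    have := h3 (Finset.mem_univ i)
    push Not at this
    exact this
  push Not at hlt
  obtain ⟨q, hqN, hqb⟩ := hh n
  obtain ⟨φ, hφ⟩ := hU n (fun g => FreeGroup.lift p (r g)) (fun g => FreeGroup.lift q (r g)) p q
    (good_count (hW n p) (by
      have hs := strong_good hp W (fun w hw => hnorm w (Finset.mem_union_left _ hw)) hn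
      refine le_trans (le_of_eq ?_) (hs.trans ?_)
      · congr!
      rw [← mul_assoc]
      gcongr
      rw [mul_one_div, div_le_iff₀ hD0, mul_comm, ← div_le_iff₀ hε]
      linarith))
    (good_count (hW n q) (by
      rw [div_le_iff₀ hε, mul_comm] at hlt
      refine le_trans ?_ hlt
      refine Nat.cast_le.2 ?_
      convert hqb))
  refine ⟨fun s => MulAut.conj φ⁻¹ (q s), ?_, ?_⟩
  · intro ξ hξ
    have e : FreeGroup.lift (fun s => MulAut.conj φ⁻¹ (q s)) =
        (MulAut.conj φ⁻¹).toMonoidHom.comp (FreeGroup.lift q) := by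
      ext s : 1
      simp
    unfold evalWord
    rw [e, MonoidHom.comp_apply, hqN ξ (Subgroup.subset_normalClosure hξ), map_one]
  · intro s
    have h1 : dH (p s) (MulAut.conj φ⁻¹ (q s)) ≤ 12 * ε := by
      unfold dH
      rw [div_le_iff₀ hn']
      refine le_trans (le_of_eq ?_) (hφ s)
      congr 2
      ext x
      simp only [Finset.mem_filter, Finset.mem_univ, true_and, MulAut.conj_apply, inv_inv,
        Equiv.Perm.mul_apply, ne_eq, Equiv.Perm.eq_inv_iff_eq]
    exact lt_of_le_of_lt h1 (by linarith)
end BackwardPart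

/-- For an amenable presented group `G = F_m/⟨⟨R⟩⟩`, the set `R` is weakly
stable if and only if `G` is residually finite. -/
theorem amenable_weakly_stable_iff_residually_finite (m : ℕ)
    (R : Finset (FreeGroup (Fin m)))
    (hamen : Amenable
      (FreeGroup (Fin m) ⧸ Subgroup.normalClosure (R : Set (FreeGroup (Fin m))))) :
    WeaklyStable R ↔
      ResiduallyFinite
        (FreeGroup (Fin m) ⧸ Subgroup.normalClosure (R : Set (FreeGroup (Fin m)))) := by
  exact ⟨forward_dir m R hamen, backward_dir m R hamen⟩
end

section
/- For every nonzero integer n, the one-element set R = {t⁻¹ · a · t · a⁻ⁿ} in the free group F_2 on free generators a, t (the relator word of the Baumslag–Solitar group BS(1, n)) is weakly stable in permutations. -/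
open Filter Topology

/-- The free generator `a` of `F_2`. -/
def genA : FreeGroup (Fin 2) := FreeGroup.of 0

/-- The free generator `t` of `F_2`. -/
def genT : FreeGroup (Fin 2) := FreeGroup.of 1


/-! ### Words -/

/-- The relator set. -/
abbrev relBS (n : ℤ) : Finset (FreeGroup (Fin 2)) :=
  {genT⁻¹ * genA * genT * genA ^ (-n)}

/-- The normal closure of the relator. -/
abbrev ncBS (n : ℤ) : Subgroup (FreeGroup (Fin 2)) :=
  Subgroup.normalClosure ((relBS n : Finset (FreeGroup (Fin 2))) : Set (FreeGroup (Fin 2)))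

theorem conj_pow_eq {H : Type*} [Group H] (n : ℤ) (A T : H) (h : T * A ^ n * T⁻¹ = A) (k : ℕ) :
    T ^ k * A ^ (n ^ k) * (T ^ k)⁻¹ = A := by
  induction k with
  | zero => simp
  | succ k ih =>
    have h2 : T * A ^ (n ^ (k+1)) * T⁻¹ = A ^ (n ^ k) := by
      rw [pow_succ', zpow_mul, ← conj_zpow, h]
    calc T ^ (k+1) * A ^ (n ^ (k+1)) * (T ^ (k+1))⁻¹
        = T ^ k * (T * A ^ (n ^ (k+1)) * T⁻¹) * (T ^ k)⁻¹ := by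
          rw [pow_succ]; group
      _ = A := by rw [h2, ih]

theorem mem_nc_pow (n : ℤ) (k : ℕ) :
    genA⁻¹ * (genT ^ k * genA ^ (n ^ k) * (genT ^ k)⁻¹) ∈ ncBS n := by
  have h0 : genT⁻¹ * genA * genT * genA ^ (-n) ∈ ncBS n :=
    Subgroup.subset_normalClosure (by simp)
  rw [← QuotientGroup.eq_one_iff] at h0 ⊢
  simp only [QuotientGroup.mk_mul, QuotientGroup.mk_inv, QuotientGroup.mk_zpow,
    QuotientGroup.mk_pow] at h0 ⊢
  rw [conj_pow_eq, inv_mul_cancel]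
  have h1 := mul_eq_one_iff_eq_inv.mp h0
  rw [zpow_neg, inv_inv] at h1
  rw [← h1]; group

theorem lift_mem_nc {H : Type*} [Group H] (n : ℤ) (A T : H) (h : T⁻¹ * A * T = A ^ n)
    (w : FreeGroup (Fin 2)) (hw : w ∈ ncBS n) : FreeGroup.lift ![A, T] w = 1 := by
  have : ncBS n ≤ (FreeGroup.lift ![A, T]).ker := by
    apply Subgroup.normalClosure_le_normal
    intro x hx
    simp at hx
    subst hx
    simp [genA, genT, h, MonoidHom.mem_ker]
  exact this hw

theorem not_mem_nc_a (n : ℤ) (hn : n ≠ 0) (j : ℤ) (hj : j ≠ 0) : genA ^ j ∉ ncBS n := by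
  intro hw
  have hn' : (n : ℚ) ≠ 0 := by exact_mod_cast hn
  have hpow : ∀ (j : ℤ) (x : ℚ), ((Equiv.addRight (1:ℚ)) ^ j) x = x + j := by
    intro j x
    simp
  have := lift_mem_nc n (Equiv.addRight (1:ℚ)) (Equiv.mulRight₀ ((n:ℚ)⁻¹) (inv_ne_zero hn')) ?_ _ hw
  · have h2 := congrArg (fun e : Equiv.Perm ℚ => e 0) this
    simp only [genA, map_zpow, FreeGroup.lift_apply_of, Matrix.cons_val_zero, hpow] at h2
    simp at h2
    exact hj h2
  · rw [mul_assoc, inv_mul_eq_iff_eq_mul]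
    ext x
    simp only [Equiv.Perm.mul_apply, hpow]
    simp
    field_simp

theorem not_mem_nc_t (n : ℤ) (k j l : ℤ) (hk : k ≠ l) :
    genT ^ l * genA ^ j * genT ^ (-k) ∉ ncBS n := by
  intro hw
  have := lift_mem_nc n (1 : Multiplicative ℤ) (Multiplicative.ofAdd 1) (by simp) _ hw
  simp only [genA, genT, map_zpow, map_mul, FreeGroup.lift_apply_of, Matrix.cons_val_zero,
    Matrix.cons_val_one, one_zpow, mul_one] at this
  rw [← zpow_add, ← ofAdd_zsmul, ofAdd_eq_one] at this
  simp at this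
  omega

/-- The points at which some word of `F` misbehaves. -/
noncomputable def badPts (n : ℤ) (F : Finset (FreeGroup (Fin 2))) {N : ℕ}
    (p : Fin 2 → Equiv.Perm (Fin N)) : Finset (Fin N) := by
  classical
  exact Finset.univ.filter fun x => ∃ w ∈ F, ¬ ((evalWord w p) x = x ↔ w ∈ ncBS n)

theorem badPts_small (n : ℤ) (F : Finset (FreeGroup (Fin 2))) (η : ℝ) (hη : 0 < η) :
    ∃ δ : ℝ, 0 < δ ∧ ∀ (N : ℕ) (p : Fin 2 → Equiv.Perm (Fin N)), IsStrongSol (relBS n) δ p →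
      ((badPts n F p).card : ℝ) ≤ η * N := by
  classical
  set B : ℝ := ∑ w ∈ F, (FreeGroup.norm w : ℝ) with hB
  have hB0 : 0 ≤ B := Finset.sum_nonneg fun _ _ => by positivity
  refine ⟨min (η / (F.card + 1)) (1 / (B + 1)), by positivity, ?_⟩
  set δ := min (η / (F.card + 1)) (1 / (B + 1)) with hδ
  have hδ0 : 0 < δ := by positivity
  intro N p hp
  rcases Nat.eq_zero_or_pos N with h0 | hN
  · subst h0
    have : (badPts n F p) = ∅ := by ext x; exact x.elim0
    simp [this]
  have hN' : (0:ℝ) < N := by exact_mod_cast hN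
  have h1 : badPts n F p ⊆ F.biUnion fun w =>
      Finset.univ.filter fun x => ¬ ((evalWord w p) x = x ↔ w ∈ ncBS n) := by
    intro x hx
    simpa [badPts] using hx
  have h2 : ∀ w ∈ F, ((Finset.univ.filter fun x =>
      ¬ ((evalWord w p) x = x ↔ w ∈ ncBS n)).card : ℝ) ≤ δ * N := by
    intro w hw
    have hlen : (FreeGroup.norm w : ℝ) < 1 / δ := by
      have : (FreeGroup.norm w : ℝ) ≤ B :=
        Finset.single_le_sum (f := fun w => (FreeGroup.norm w : ℝ)) (fun _ _ => by positivity) hw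
      have h3 : δ ≤ 1 / (B + 1) := min_le_right _ _
      rw [lt_div_iff₀ hδ0]
      rw [le_div_iff₀ (by positivity)] at h3
      nlinarith
    obtain ⟨ha, hb⟩ := hp w hlen
    by_cases hm : w ∈ ncBS n
    · have := ha hm
      unfold dH at this
      rw [div_lt_iff₀ hN'] at this
      refine le_trans (le_of_eq ?_) this.le
      congr 2
      ext x
      rw [Finset.mem_filter, Finset.mem_filter]
      simp [hm]
    · have := hb hm
      unfold dH at this
      rw [lt_div_iff₀ hN'] at this
      have h4 := Finset.card_filter_add_card_filter_not (s := (Finset.univ : Finset (Fin N)))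
        (fun x => (evalWord w p) x = x)
      have h5 : ((Finset.univ.filter fun x => (evalWord w p) x = x).card : ℝ) +
        ((Finset.univ.filter fun x => ¬ (evalWord w p) x = x).card : ℝ) = N := by
        rw [← Nat.cast_add, h4]; simp
      have h6 : ((Finset.univ.filter fun x => ¬ ((evalWord w p) x = x ↔ w ∈ ncBS n)).card : ℝ) =
          ((Finset.univ.filter fun x => (evalWord w p) x = x).card : ℝ) := by
        congr 2
        ext x
        simp [hm]
      have h7 : ((Finset.univ.filter fun x => (evalWord w p) x ≠ (1 : Equiv.Perm (Fin N)) x).card : ℝ)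
          = ((Finset.univ.filter fun x => ¬ (evalWord w p) x = x).card : ℝ) := by
        congr 2
      rw [h6]
      have this' : (1 - δ) * N <
        ((Finset.univ.filter fun x => ¬ (evalWord w p) x = x).card : ℝ) := by
        rw [← h7]
        convert this
      linarith
  calc ((badPts n F p).card : ℝ) ≤ ((F.biUnion fun w =>
      Finset.univ.filter fun x => ¬ ((evalWord w p) x = x ↔ w ∈ ncBS n)).card : ℝ) := by
        exact_mod_cast Finset.card_le_card h1
    _ ≤ ∑ w ∈ F, ((Finset.univ.filter fun x =>
      ¬ ((evalWord w p) x = x ↔ w ∈ ncBS n)).card : ℝ) := by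
        exact_mod_cast Finset.card_biUnion_le
    _ ≤ ∑ w ∈ F, δ * N := Finset.sum_le_sum h2
    _ = F.card * δ * N := by simp; ring
    _ ≤ η * N := by
      have h3 : δ ≤ η / (F.card + 1) := min_le_left _ _
      rw [le_div_iff₀ (by positivity)] at h3
      gcongr
      nlinarith

/-! ### Markers, hitting times, colourings -/

theorem exists_markers {X : Type*} [Fintype X] (p : Equiv.Perm X) (W : ℕ) (hW : 0 < W) :
    ∃ S : Finset X, S.card * W ≤ Fintype.card X ∧
      ∀ x, (∀ k : ℕ, 0 < k → k < W → (p ^ (k:ℤ)) x ≠ x) →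
        ∃ k : ℕ, k < 2 * W ∧ (p ^ (-(k:ℤ))) x ∈ S := by
  classical
  let Q : Finset X → Prop := fun S => ∀ x ∈ S, ∀ k : ℕ, 0 < k → k < W → (p ^ (k:ℤ)) x ∉ S
  obtain ⟨S, hS, hmax⟩ := Finset.exists_max_image (Finset.univ.filter Q) Finset.card
    ⟨∅, by simp [Q]⟩
  have hSQ : Q S := by simpa using hS
  refine ⟨S, ?_, ?_⟩
  · rw [← Finset.card_range W, ← Finset.card_product, ← Finset.card_univ]
    apply Finset.card_le_card_of_injOn (fun y : X × ℕ => (p ^ (y.2:ℤ)) y.1) (by simp)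
    have key : ∀ x ∈ S, ∀ y ∈ S, ∀ k l : ℕ, k < W → l < W → k < l →
        (p ^ (k:ℤ)) x = (p ^ (l:ℤ)) y → False := by
      intro x hx y hy k l hk hl hkl h
      apply hSQ y hy (l - k) (by omega) (by omega)
      have : (p ^ ((l - k : ℕ) : ℤ)) y = x := by
        apply (p ^ (k:ℤ)).injective
        rw [h, ← Equiv.Perm.mul_apply, ← zpow_add]
        congr 2; omega
      rwa [this]
    rintro ⟨x, k⟩ hx ⟨y, l⟩ hy h
    simp at hx hy h
    rcases lt_trichotomy k l with h1 | h1 | h1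
    · exact (key x hx.1 y hy.1 k l hx.2 hy.2 h1 (by simpa using h)).elim
    · subst h1
      simpa using h
    · exact (key y hy.1 x hx.1 l k hy.2 hx.2 h1 (by simpa using h.symm)).elim
  · have claim : ∀ x, (∀ k : ℕ, 0 < k → k < W → (p ^ (k:ℤ)) x ≠ x) →
        (∃ k : ℕ, k < W ∧ (p ^ (k:ℤ)) x ∈ S) ∨ (∃ k : ℕ, k < W ∧ (p ^ (-(k:ℤ))) x ∈ S) := by
      intro x hx
      by_cases hxS : x ∈ S
      · left; exact ⟨0, hW, by simpa using hxS⟩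
      by_contra hcon
      push Not at hcon
      have : Q (insert x S) := by
        intro y hy k hk0 hk
        rw [Finset.mem_insert] at hy ⊢
        rcases hy with rfl | hy
        · rintro (h | h)
          · exact hx k hk0 hk h
          · exact hcon.1 k hk h
        · rintro (h | h)
          · apply hcon.2 k hk
            rw [← h, ← Equiv.Perm.mul_apply, ← zpow_add]
            simpa using hy
          · exact hSQ y hy k hk0 hk h
      have h2 := hmax (insert x S) (by simpa using this)
      rw [Finset.card_insert_of_notMem hxS] at h2
      omega
    intro x hx
    set x' := (p ^ (-((W - 1 : ℕ):ℤ))) x with hx'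
    have hA : ∀ k : ℕ, 0 < k → k < W → (p ^ (k:ℤ)) x' ≠ x' := by
      intro k hk0 hk h
      apply hx k hk0 hk
      apply (p ^ (-((W - 1 : ℕ):ℤ))).injective
      rw [← hx', ← h, hx', ← Equiv.Perm.mul_apply, ← Equiv.Perm.mul_apply, ← zpow_add, ← zpow_add,
        add_comm]
    rcases claim x' hA with ⟨k, hk, h⟩ | ⟨k, hk, h⟩
    · refine ⟨W - 1 - k, by omega, ?_⟩
      rw [hx', ← Equiv.Perm.mul_apply, ← zpow_add] at h
      convert h using 3
      omega
    · refine ⟨W - 1 + k, by omega, ?_⟩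
      rw [hx', ← Equiv.Perm.mul_apply, ← zpow_add] at h
      convert h using 3
      push_cast
      ring

/-- Backward hitting time of a set. -/
noncomputable def ht {X : Type*} (p : Equiv.Perm X) (S : Set X) (x : X) : ℕ :=
  sInf {k : ℕ | (p ^ (-(k:ℤ))) x ∈ S}

theorem ht_mem {X : Type*} (p : Equiv.Perm X) (S : Set X) (x : X)
    (h : ∃ k : ℕ, (p ^ (-(k:ℤ))) x ∈ S) : (p ^ (-(ht p S x:ℤ))) x ∈ S :=
  Nat.sInf_mem (s := {k : ℕ | (p ^ (-(k:ℤ))) x ∈ S}) h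

theorem ht_le {X : Type*} (p : Equiv.Perm X) (S : Set X) (x : X) (k : ℕ)
    (h : (p ^ (-(k:ℤ))) x ∈ S) : ht p S x ≤ k :=
  Nat.sInf_le (s := {k : ℕ | (p ^ (-(k:ℤ))) x ∈ S}) h

theorem ht_lt_of {X : Type*} (p : Equiv.Perm X) (S : Set X) (x : X) (K : ℕ) (hK : 0 < K)
    (h : (∃ k : ℕ, (p ^ (-(k:ℤ))) x ∈ S) → ∃ k : ℕ, k < K ∧ (p ^ (-(k:ℤ))) x ∈ S) :
    ht p S x < K := by
  by_cases h0 : ∃ k : ℕ, (p ^ (-(k:ℤ))) x ∈ S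
  · obtain ⟨k, hk, h1⟩ := h h0
    exact (ht_le p S x k h1).trans_lt hk
  · have : {k : ℕ | (p ^ (-(k:ℤ))) x ∈ S} = ∅ := by
      ext k; simpa using fun hh => h0 ⟨k, by simpa using hh⟩
    unfold ht
    rw [this]; simpa using hK

theorem zpow_neg_succ_apply {X : Type*} (p : Equiv.Perm X) (k : ℕ) (x : X) :
    (p ^ (-((k+1 : ℕ):ℤ))) (p x) = (p ^ (-(k:ℤ))) x := by
  have : (p ^ (-(k:ℤ))) = p ^ (-((k+1 : ℕ):ℤ)) * p := by
    rw [← zpow_add_one]; congr 1; push_cast; ring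
  rw [this]; rfl

theorem ht_step {X : Type*} (p : Equiv.Perm X) (S : Set X) (x : X) (hx : p x ∉ S)
    (h : ∃ k : ℕ, (p ^ (-(k:ℤ))) (p x) ∈ S) : ht p S (p x) = ht p S x + 1 := by
  have h1 : ∃ k : ℕ, (p ^ (-(k:ℤ))) x ∈ S := by
    obtain ⟨k, hk⟩ := h
    cases k with
    | zero => exact (hx (by simpa using hk)).elim
    | succ k => exact ⟨k, by rwa [zpow_neg_succ_apply] at hk⟩
  apply le_antisymm
  · apply ht_le
    rw [zpow_neg_succ_apply]
    exact ht_mem p S x h1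
  · have h2 := ht_mem p S _ h
    cases hk : ht p S (p x) with
    | zero => rw [hk] at h2; exact (hx (by simpa using h2)).elim
    | succ k =>
      rw [hk, zpow_neg_succ_apply] at h2
      have := ht_le p S x k h2
      omega

theorem ht_congr {X : Type*} (p : Equiv.Perm X) (S : Set X) (x y : X) (K : ℕ)
    (h : ∃ k : ℕ, k < K ∧ (p ^ (-(k:ℤ))) x ∈ S)
    (hxy : ∀ k : ℕ, k < K → ((p ^ (-(k:ℤ))) y ∈ S ↔ (p ^ (-(k:ℤ))) x ∈ S)) :
    ht p S y = ht p S x := by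
  obtain ⟨k, hk, hx⟩ := h
  have hy := (hxy k hk).2 hx
  have hkx := ht_le p S x k hx
  have hky := ht_le p S y k hy
  apply le_antisymm
  · exact ht_le _ _ _ _ ((hxy _ (by omega)).2 (ht_mem p S x ⟨k, hx⟩))
  · exact ht_le _ _ _ _ ((hxy _ (by omega)).1 (ht_mem p S y ⟨k, hy⟩))

theorem count_avoid {X : Type*} [Fintype X] [DecidableEq X] (d : ℕ) (T : Finset X) :
    ((Finset.univ.filter fun c : X → Fin (d+1) => ∀ i ∈ T, c i ≠ 0).card : ℝ) =
      ((d:ℝ) / (d+1)) ^ T.card * (d+1) ^ Fintype.card X := by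
  have h1 : (Finset.univ.filter fun c : X → Fin (d+1) => ∀ i ∈ T, c i ≠ 0) =
      Fintype.piFinset (fun i => if i ∈ T then Finset.univ.erase (0 : Fin (d+1)) else Finset.univ) := by
    ext c
    simp only [Finset.mem_filter, Finset.mem_univ, true_and, Fintype.mem_piFinset]
    refine forall_congr' fun i => ?_
    by_cases hi : i ∈ T <;> simp [hi]
  rw [h1, Fintype.card_piFinset]
  push_cast
  have h2 : ∀ i : X, (((if i ∈ T then Finset.univ.erase (0 : Fin (d+1)) else Finset.univ).card : ℕ) : ℝ)
      = (if i ∈ T then (d:ℝ) / (d+1) else 1) * (d+1) := by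
    intro i
    have : (d:ℝ) + 1 ≠ 0 := by positivity
    by_cases hi : i ∈ T
    · simp [hi]; field_simp
    · simp [hi]
  rw [Finset.prod_congr rfl fun i _ => h2 i, Finset.prod_mul_distrib, Finset.prod_const,
    Finset.card_univ]
  congr 1
  rw [Finset.prod_ite_mem, Finset.univ_inter, Finset.prod_const]

theorem exists_colouring {X : Type*} [Fintype X] [DecidableEq X] (d K : ℕ) (q : X → X)
    (f : ℕ → X → X) (G : Finset X)
    (hG : ∀ x ∈ G, Set.InjOn (fun k => f k x) (Finset.range K : Finset ℕ)) :
    ∃ c : X → Fin (d+1),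
      ((Finset.univ.filter fun x => c (q x) = 0).card : ℝ) +
      ((G.filter fun x => ∀ k < K, c (f k x) ≠ 0).card : ℝ) ≤
        (1 / (d+1) + ((d:ℝ) / (d+1)) ^ K) * Fintype.card X := by
  have hd : (d:ℝ) + 1 ≠ 0 := by positivity
  have main : ∑ c : X → Fin (d+1), (((Finset.univ.filter fun x => c (q x) = 0).card : ℝ) +
      ((G.filter fun x => ∀ k < K, c (f k x) ≠ 0).card : ℝ)) ≤
      ∑ c : X → Fin (d+1), (1 / (d+1) + ((d:ℝ) / (d+1)) ^ K) * (Fintype.card X : ℝ) := by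
    rw [Finset.sum_add_distrib]
    have e1 : ∑ c : X → Fin (d+1), ((Finset.univ.filter fun x => c (q x) = 0).card : ℝ) =
        ∑ x : X, ((Finset.univ.filter fun c : X → Fin (d+1) => c (q x) = 0).card : ℝ) := by
      simp only [Finset.card_filter, Nat.cast_sum]
      exact Finset.sum_comm
    have e2 : ∑ c : X → Fin (d+1), ((G.filter fun x => ∀ k < K, c (f k x) ≠ 0).card : ℝ) =
        ∑ x ∈ G, ((Finset.univ.filter fun c : X → Fin (d+1) => ∀ k < K, c (f k x) ≠ 0).card : ℝ) := by
      simp only [Finset.card_filter, Nat.cast_sum]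
      exact Finset.sum_comm
    have c1 : ∀ x : X, ((Finset.univ.filter fun c : X → Fin (d+1) => c (q x) = 0).card : ℝ) =
        1 / (d+1) * (d+1) ^ Fintype.card X := by
      intro x
      have h1 := count_avoid d ({q x} : Finset X)
      have h2 := Finset.card_filter_add_card_filter_not
        (s := (Finset.univ : Finset (X → Fin (d+1)))) (fun c => c (q x) = 0)
      have h3 : ((Finset.univ.filter fun c : X → Fin (d+1) => c (q x) = 0).card : ℝ) +
        ((Finset.univ.filter fun c : X → Fin (d+1) => ¬ c (q x) = 0).card : ℝ)
          = (d+1) ^ Fintype.card X := by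
        rw [← Nat.cast_add, h2]; simp
      simp only [Finset.mem_singleton, forall_eq, Finset.card_singleton, pow_one, ne_eq] at h1
      rw [h1] at h3
      rw [eq_sub_of_add_eq h3]
      field_simp
      ring
    have c2 : ∀ x ∈ G, ((Finset.univ.filter fun c : X → Fin (d+1) =>
        ∀ k < K, c (f k x) ≠ 0).card : ℝ) = ((d:ℝ) / (d+1)) ^ K * (d+1) ^ Fintype.card X := by
      intro x hx
      have h1 := count_avoid d ((Finset.range K).image fun k => f k x)
      rw [Finset.card_image_of_injOn (hG x hx), Finset.card_range] at h1
      rw [← h1]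
      congr 2
      ext c
      simp
    rw [e1, e2, Finset.sum_congr rfl fun x _ => c1 x, Finset.sum_congr rfl c2]
    simp only [Finset.sum_const, nsmul_eq_mul, Finset.card_univ, Fintype.card_fun, Fintype.card_fin]
    push_cast
    have : (G.card : ℝ) ≤ Fintype.card X := by exact_mod_cast Finset.card_le_univ G
    have h0 : (0:ℝ) ≤ ((d:ℝ) / (d+1)) ^ K * (d+1) ^ Fintype.card X := by positivity
    nlinarith [mul_le_mul_of_nonneg_right this h0]
  obtain ⟨c, -, hc⟩ := Finset.exists_le_of_sum_le Finset.univ_nonempty main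
  exact ⟨c, hc⟩

theorem label_change {X Z : Type*} [Fintype X] [DecidableEq X] [DecidableEq Z] (a : Equiv.Perm X)
    (q : X → Z) (m : ℤ) :
    (Finset.univ.filter fun x => q ((a ^ m) x) ≠ q x).card ≤
      m.natAbs * (Finset.univ.filter fun x => q (a x) ≠ q x).card := by
  have nat : ∀ k : ℕ, (Finset.univ.filter fun x => q ((a ^ (k:ℤ)) x) ≠ q x).card ≤
      k * (Finset.univ.filter fun x => q (a x) ≠ q x).card := by
    intro k
    induction k with
    | zero => simp
    | succ k ih =>
      have h1 : (Finset.univ.filter fun x => q ((a ^ ((k+1 : ℕ):ℤ)) x) ≠ q x) ⊆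
          (Finset.univ.filter fun x => q ((a ^ (k:ℤ)) x) ≠ q x) ∪
          (Finset.univ.filter fun x => q (a x) ≠ q x).image (a ^ (-(k:ℤ))) := by
        intro x hx
        simp only [Finset.mem_filter, Finset.mem_univ, true_and, Finset.mem_union,
          Finset.mem_image] at hx ⊢
        by_cases h : q ((a ^ (k:ℤ)) x) = q x
        · right
          refine ⟨(a ^ (k:ℤ)) x, ?_, by simp⟩
          rw [h]
          have : a ((a ^ (k:ℤ)) x) = (a ^ ((k+1 : ℕ):ℤ)) x := by
            push_cast
            rw [add_comm, zpow_add, zpow_one]; rfl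
          rwa [this]
        · left; exact h
      calc _ ≤ _ := Finset.card_le_card h1
        _ ≤ _ := Finset.card_union_le _ _
        _ ≤ k * _ + _ := add_le_add ih Finset.card_image_le
        _ = _ := by ring
  rcases Int.natAbs_eq m with h | h
  · conv_lhs => rw [h]
    exact nat _
  · refine le_trans ?_ (nat m.natAbs)
    apply Finset.card_le_card_of_injOn (a ^ m) ?_ (a ^ m).injective.injOn
    intro x hx
    simp only [Finset.coe_filter, Finset.mem_univ, true_and, Set.mem_ofPred_eq] at hx ⊢
    have : (a ^ (m.natAbs : ℤ)) ((a ^ m) x) = x := by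
      rw [← Equiv.Perm.mul_apply, ← zpow_add]
      rw [show (m.natAbs : ℤ) + m = 0 by omega]; simp
    rw [this]
    exact hx.symm

/-! ### Approximate heights -/

theorem heights_core {X : Type*} [Fintype X] [DecidableEq X] (n : ℤ) (d K W : ℕ) (hW : 0 < W)
    (a t : Equiv.Perm X) (V : Finset X)
    (hrel : ∀ x, x ∉ V → ∀ k : ℕ, k < K →
      a x = (t ^ (k:ℤ)) ((a ^ (n ^ k)) ((t ^ (-(k:ℤ))) x)))
    (hap : ∀ x, x ∉ V → ∀ k : ℕ, 0 < k → k < W → (a ^ (k:ℤ)) x ≠ x)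
    (hfree : ∀ x, x ∉ V → ∀ k l r s : ℕ, k < K → l < K → r < 2 * W → s < 2 * W → k ≠ l →
      (a ^ (-(r:ℤ))) ((t ^ (-(k:ℤ))) x) ≠ (a ^ (-(s:ℤ))) ((t ^ (-(l:ℤ))) x)) :
    ∃ (j h : X → ℕ) (Bad : Finset X),
      (Bad.card : ℝ) ≤ 2 * ((1 / (d+1) + ((d:ℝ) / (d+1)) ^ K) * Fintype.card X) +
        ((∑ k ∈ Finset.range K, (n ^ k).natAbs : ℕ) + 1) * (Fintype.card X / W) +
        ((∑ k ∈ Finset.range K, (n ^ k).natAbs : ℕ) + 4) * V.card ∧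
      V ⊆ Bad ∧
      (∀ x, a x ∉ Bad → j (a x) = j x + 1 ∧ h (a x) = h x) ∧
      (∀ x, t x ∉ Bad → h (t x) = h x + 1) := by
  classical
  obtain ⟨S, hScard, hS⟩ := exists_markers a W hW
  set P := ∑ k ∈ Finset.range K, (n ^ k).natAbs with hP
  have hs : (S.card : ℝ) ≤ Fintype.card X / W := by
    rw [le_div_iff₀ (by exact_mod_cast hW)]
    exact_mod_cast hScard
  let j : X → ℕ := ht a (S : Set X)
  have hit : ∀ x, x ∉ V → ∃ k : ℕ, k < 2 * W ∧ (a ^ (-(k:ℤ))) x ∈ (S : Set X) := by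
    intro x hx
    simpa using hS x (hap x hx)
  have hj : ∀ x, a x ∉ S → a x ∉ V → j (a x) = j x + 1 := by
    intro x h1 h2
    obtain ⟨k, -, hk⟩ := hit _ h2
    exact ht_step a _ x (by simpa using h1) ⟨k, hk⟩
  let r : X → ℕ := fun x => if j x < 2 * W then j x else 0
  have hr : ∀ x, r x < 2 * W := by
    intro x
    simp only [r]
    split_ifs <;> omega
  let q : X → X := fun x => (a ^ (-(r x:ℤ))) x
  have hq : ∀ x, a x ∉ S → a x ∉ V → q (a x) = q x := by
    intro x h1 h2
    have h3 := hj x h1 h2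
    obtain ⟨k, hk, hk2⟩ := hit _ h2
    have h4 : j (a x) < 2 * W := (ht_le a _ _ k hk2).trans_lt hk
    have h5 : r (a x) = r x + 1 := by
      simp only [r]
      rw [if_pos h4, if_pos (by omega), h3]
    simp only [q]
    rw [h5, zpow_neg_succ_apply]
  -- label changes
  have hqc : (Finset.univ.filter fun x => q (a x) ≠ q x).card ≤ S.card + V.card := by
    have h1 : (Finset.univ.filter fun x => q (a x) ≠ q x) ⊆ (S ∪ V).image (a.symm) := by
      intro x hx
      simp only [Finset.mem_filter, Finset.mem_univ, true_and] at hx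
      rw [Finset.mem_image]
      refine ⟨a x, ?_, by simp⟩
      by_contra hcon
      rw [Finset.mem_union, not_or] at hcon
      exact hx (hq x hcon.1 hcon.2)
    exact (Finset.card_le_card h1).trans (Finset.card_image_le.trans (Finset.card_union_le _ _))
  -- colouring
  obtain ⟨c, hc⟩ := exists_colouring d K q (fun k x => q ((t ^ (-(k:ℤ))) x)) Vᶜ (by
    intro x hx k hk l hl hkl
    by_contra hne
    simp only [Finset.coe_range, Set.mem_Iio] at hk hl
    exact hfree x (by simpa using hx) k l _ _ hk hl (hr _) (hr _) hne hkl)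
  set C := Finset.univ.filter fun x => c (q x) = 0 with hC
  set G := Vᶜ.filter fun x => ∀ k < K, c (q ((t ^ (-(k:ℤ))) x)) ≠ 0 with hG
  let h : X → ℕ := ht t (C : Set X)
  set U := Finset.univ.filter fun x => ∀ k : ℕ, k < K → (t ^ (-(k:ℤ))) x ∉ C with hU
  have hUc : U.card ≤ G.card + V.card := by
    have h1 : U ⊆ G ∪ V := by
      intro x hx
      simp only [hU, hC, hG, Finset.mem_filter, Finset.mem_univ, true_and, Finset.mem_union,
        Finset.mem_compl] at hx ⊢
      by_cases hv : x ∈ V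
      · exact Or.inr hv
      · exact Or.inl ⟨hv, hx⟩
    exact (Finset.card_le_card h1).trans (Finset.card_union_le _ _)
  let E : ℕ → Finset X := fun k => Finset.univ.filter fun x =>
    q ((a ^ (n ^ k)) ((t ^ (-(k:ℤ))) x)) ≠ q ((t ^ (-(k:ℤ))) x)
  have hE : ∀ k, (E k).card ≤ (n ^ k).natAbs * (S.card + V.card) := by
    intro k
    refine le_trans ?_ ((label_change a q (n ^ k)).trans (Nat.mul_le_mul_left _ hqc))
    apply Finset.card_le_card_of_injOn (t ^ (-(k:ℤ))) ?_ (t ^ (-(k:ℤ))).injective.injOn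
    intro x hx
    simpa [E] using hx
  set H := Finset.univ.filter fun x => h (a x) ≠ h x with hH
  have hHc : H.card ≤ V.card + U.card + P * (S.card + V.card) := by
    have h1 : H ⊆ (V ∪ U) ∪ (Finset.range K).biUnion E := by
      intro x hx
      by_contra hcon
      simp only [Finset.mem_union, not_or, Finset.mem_biUnion, not_exists, not_and] at hcon
      obtain ⟨⟨hv, hu⟩, he⟩ := hcon
      simp only [hH, Finset.mem_filter, Finset.mem_univ, true_and] at hx
      apply hx
      apply ht_congr t _ _ _ K
      · simp only [hU, Finset.mem_filter, Finset.mem_univ, true_and] at hu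
        push Not at hu
        simpa using hu
      · intro k hk
        have h2 := he k (by simpa using hk)
        simp only [E, Finset.mem_filter, Finset.mem_univ, true_and, not_not] at h2
        have h3 : (t ^ (-(k:ℤ))) (a x) = (a ^ (n ^ k)) ((t ^ (-(k:ℤ))) x) := by
          rw [hrel x hv k hk]
          simp
        simp only [hC, Finset.coe_filter, Finset.mem_univ, true_and, Set.mem_ofPred_eq]
        rw [h3, h2]
    calc H.card ≤ _ := Finset.card_le_card h1
      _ ≤ (V ∪ U).card + ((Finset.range K).biUnion E).card := Finset.card_union_le _ _
      _ ≤ (V.card + U.card) + ∑ k ∈ Finset.range K, (E k).card :=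
        add_le_add (Finset.card_union_le _ _) Finset.card_biUnion_le
      _ ≤ (V.card + U.card) + ∑ k ∈ Finset.range K, (n ^ k).natAbs * (S.card + V.card) := by
        gcongr with k _
        exact hE k
      _ = _ := by rw [← Finset.sum_mul]
  refine ⟨j, h, (S ∪ V) ∪ (C ∪ (U ∪ H.image a)), ?_, ?_, ?_, ?_⟩
  · have h1 : ((S ∪ V) ∪ (C ∪ (U ∪ H.image a))).card ≤
        (S.card + V.card) + (C.card + (U.card + H.card)) := by
      refine (Finset.card_union_le _ _).trans (add_le_add (Finset.card_union_le _ _) ?_)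
      refine (Finset.card_union_le _ _).trans (add_le_add le_rfl ?_)
      exact (Finset.card_union_le _ _).trans (add_le_add le_rfl Finset.card_image_le)
    have h2 : ((S ∪ V) ∪ (C ∪ (U ∪ H.image a))).card ≤
        2 * (C.card + G.card) + (P + 1) * S.card + (P + 4) * V.card := by
      nlinarith
    have h3 : (((S ∪ V) ∪ (C ∪ (U ∪ H.image a))).card : ℝ) ≤
        2 * (C.card + G.card) + (P + 1) * S.card + (P + 4) * V.card := by exact_mod_cast h2
    refine h3.trans ?_
    gcongr
  · intro x hx
    simp [hx]
  · intro x hx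
    simp only [Finset.mem_union, not_or] at hx
    refine ⟨hj x hx.1.1 hx.1.2, ?_⟩
    by_contra hne
    exact hx.2.2.2 (Finset.mem_image_of_mem a (by simpa [hH] using hne))
  · intro x hx
    simp only [Finset.mem_union, not_or] at hx
    obtain ⟨-, hxC, hxU, -⟩ := hx
    simp only [hU, Finset.mem_filter, Finset.mem_univ, true_and] at hxU
    push Not at hxU
    obtain ⟨k, -, hk⟩ := hxU
    exact ht_step t _ x (by simpa using hxC) ⟨k, by simpa using hk⟩

theorem evalWord_genA {H : Type*} [Group H] (p : Fin 2 → H) : evalWord genA p = p 0 := by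
  simp [evalWord, genA]

theorem evalWord_genT {H : Type*} [Group H] (p : Fin 2 → H) : evalWord genT p = p 1 := by
  simp [evalWord, genT]

theorem evalWord_mul {H : Type*} [Group H] (p : Fin 2 → H) (v w : FreeGroup (Fin 2)) :
    evalWord (v * w) p = evalWord v p * evalWord w p := by
  simp [evalWord]

theorem evalWord_inv {H : Type*} [Group H] (p : Fin 2 → H) (v : FreeGroup (Fin 2)) :
    evalWord (v⁻¹) p = (evalWord v p)⁻¹ := by
  simp [evalWord]

theorem evalWord_zpow {H : Type*} [Group H] (p : Fin 2 → H) (v : FreeGroup (Fin 2)) (k : ℤ) :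
    evalWord (v ^ k) p = (evalWord v p) ^ k := by
  simp [evalWord]

theorem heights (n : ℤ) (hn : n ≠ 0) (β : ℝ) (hβ : 0 < β) (L : ℕ) :
    ∃ δ : ℝ, 0 < δ ∧ ∀ (N : ℕ) (p : Fin 2 → Equiv.Perm (Fin N)), IsStrongSol (relBS n) δ p →
      ∃ (j h : Fin N → ℕ) (Bad : Finset (Fin N)),
        (Bad.card : ℝ) ≤ β * N ∧
        (∀ x, p 0 x ∉ Bad → j (p 0 x) = j x + 1 ∧ h (p 0 x) = h x) ∧
        (∀ x, p 1 x ∉ Bad → h (p 1 x) = h x + 1) ∧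
        (∀ x, x ∉ Bad → ∀ k : ℕ, k < L →
          p 0 x = (p 1 ^ (k:ℤ)) ((p 0 ^ (n ^ k)) ((p 1 ^ (-(k:ℤ))) x))) := by
  classical
  obtain ⟨d, hd⟩ := exists_nat_gt (8 / β)
  have hd1 : 1 / ((d:ℝ) + 1) ≤ β / 8 := by
    rw [div_lt_iff₀ hβ] at hd
    rw [div_le_iff₀ (by positivity)]
    nlinarith
  have hlt : (d:ℝ) / (d + 1) < 1 := by rw [div_lt_one (by positivity)]; linarith
  have hnn : 0 ≤ (d:ℝ) / (d + 1) := by positivity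
  obtain ⟨K0, hK0⟩ := exists_pow_lt_of_lt_one (show 0 < β / 8 by positivity) hlt
  set K := max K0 L with hK
  have hK1 : ((d:ℝ) / (d + 1)) ^ K ≤ β / 8 :=
    (pow_le_pow_of_le_one hnn hlt.le (le_max_left _ _)).trans hK0.le
  set P := ∑ k ∈ Finset.range K, (n ^ k).natAbs with hP
  obtain ⟨W0, hW0⟩ := exists_nat_gt (((P:ℝ) + 1) / (β / 4))
  set W := W0 + 1 with hW
  have hW1 : ((P:ℝ) + 1) / W ≤ β / 4 := by
    rw [div_lt_iff₀ (by positivity)] at hW0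
    rw [div_le_iff₀ (by positivity), hW]
    push_cast
    nlinarith
  let F : Finset (FreeGroup (Fin 2)) :=
    ((Finset.range K).image fun k => genA⁻¹ * (genT ^ k * genA ^ (n ^ k) * (genT ^ k)⁻¹)) ∪
    (((Finset.range W).image fun k : ℕ => genA ^ (k:ℤ)) ∪
    ((Finset.range K ×ˢ Finset.range K ×ˢ Finset.range (2 * W) ×ˢ Finset.range (2 * W)).image
      fun z => genT ^ (z.2.1:ℤ) * genA ^ ((z.2.2.2:ℤ) - z.2.2.1) * genT ^ (-(z.1:ℤ))))
  obtain ⟨δ, hδ, hmain⟩ := badPts_small n F (β / 4 / (P + 4)) (by positivity)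
  refine ⟨δ, hδ, fun N p hp => ?_⟩
  have hV := hmain N p hp
  set V := badPts n F p with hVdef
  have hgood : ∀ x, x ∉ V → ∀ w ∈ F, ((evalWord w p) x = x ↔ w ∈ ncBS n) := by
    intro x hx w hw
    by_contra hcon
    apply hx
    simp only [hVdef, badPts, Finset.mem_filter, Finset.mem_univ, true_and]
    exact ⟨w, hw, hcon⟩
  have hrel : ∀ x, x ∉ V → ∀ k : ℕ, k < K →
      p 0 x = (p 1 ^ (k:ℤ)) ((p 0 ^ (n ^ k)) ((p 1 ^ (-(k:ℤ))) x)) := by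
    intro x hx k hk
    have h1 := (hgood x hx (genA⁻¹ * (genT ^ k * genA ^ (n ^ k) * (genT ^ k)⁻¹)) (by
      apply Finset.mem_union_left
      exact Finset.mem_image_of_mem (fun k => genA⁻¹ * (genT ^ k * genA ^ (n ^ k) * (genT ^ k)⁻¹))
        (by simpa using hk))).2 (mem_nc_pow n k)
    rw [← zpow_natCast] at h1
    simp only [evalWord_mul, evalWord_inv, evalWord_zpow, evalWord_genA, evalWord_genT,
      Equiv.Perm.mul_apply] at h1
    rw [Equiv.Perm.inv_eq_iff_eq] at h1
    rw [← h1, zpow_neg]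
  obtain ⟨j, h, Bad, hcard, hVB, h1, h2⟩ := heights_core n d K W (by omega) (p 0) (p 1) V hrel
    (by
      intro x hx k hk0 hk hcon
      refine not_mem_nc_a n hn k (by omega) ((hgood x hx _ ?_).1 ?_)
      · apply Finset.mem_union_right
        apply Finset.mem_union_left
        exact Finset.mem_image_of_mem (fun k : ℕ => genA ^ (k:ℤ)) (Finset.mem_range.2 hk)
      · simpa only [evalWord_zpow, evalWord_genA] using hcon)
    (by
      intro x hx k l r s hk hl hr hs hkl hcon
      refine not_mem_nc_t n k (s - r) l (by omega) ((hgood x hx _ ?_).1 ?_)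
      · apply Finset.mem_union_right
        apply Finset.mem_union_right
        exact Finset.mem_image_of_mem (a := (k, l, r, s)) (fun z : ℕ × ℕ × ℕ × ℕ =>
          genT ^ (z.2.1:ℤ) * genA ^ ((z.2.2.2:ℤ) - z.2.2.1) * genT ^ (-(z.1:ℤ)))
          (by simp [hk, hl, hr, hs, -Finset.mem_range, Finset.mem_range.2])
      · simp only [evalWord_zpow, evalWord_genA, evalWord_genT, evalWord_mul, Equiv.Perm.mul_apply]
        rw [sub_eq_add_neg, zpow_add, Equiv.Perm.mul_apply, hcon]
        simp)
  refine ⟨j, h, Bad, ?_, h1, h2, fun x hx k hk => hrel x (fun hh => hx (hVB hh)) k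
    (hk.trans_le (le_max_right _ _))⟩
  refine hcard.trans ?_
  rw [Fintype.card_fin]
  have hN : (0:ℝ) ≤ N := by positivity
  have e1 : 2 * ((1 / ((d:ℝ)+1) + ((d:ℝ) / (d+1)) ^ K) * N) ≤ β / 2 * N := by
    nlinarith [mul_le_mul_of_nonneg_right (add_le_add hd1 hK1) hN]
  have e2 : ((P:ℝ) + 1) * (N / W) ≤ β / 4 * N := by
    calc ((P:ℝ) + 1) * (N / W) = ((P:ℝ) + 1) / W * N := by ring
      _ ≤ _ := by gcongr
  have e3 : ((P:ℝ) + 4) * V.card ≤ β / 4 * N := by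
    calc ((P:ℝ) + 4) * V.card ≤ (P + 4) * (β / 4 / (P + 4) * N) := by gcongr
      _ = _ := by field_simp
  linarith

/-! ### The model action on a rectangle -/

section Model

variable (Z : Type*) (n : ℤ) (l M : ℕ)

/-- The translation action of the generator `a` on the model. -/
def modelA : Multiplicative (ZMod M) →* Equiv.Perm (Z × Fin (l+1) × ZMod M) where
  toFun c :=
    { toFun := fun y => (y.1, y.2.1, y.2.2 + c.toAdd * (n : ZMod M) ^ (y.2.1 : ℕ))
      invFun := fun y => (y.1, y.2.1, y.2.2 - c.toAdd * (n : ZMod M) ^ (y.2.1 : ℕ))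
      left_inv := fun y => by simp
      right_inv := fun y => by simp }
  map_one' := by ext y <;> simp
  map_mul' c c' := by
    ext y
    · simp
    · simp
    · simp; ring

/-- The underlying function of the action of the generator `t` on the model. -/
def modelTFun (u : ZMod M) (y : Z × Fin (l+1) × ZMod M) : Z × Fin (l+1) × ZMod M :=
  (y.1, y.2.1 + 1, if y.2.1 = Fin.last l then u * y.2.2 else y.2.2)

theorem modelT_bij (u : ZMod M) (hu : u * (n : ZMod M) ^ (l+1) = 1) :
    Function.Bijective (modelTFun Z l M u) := by
  refine ⟨?_, ?_⟩
  · rintro ⟨x, i, k⟩ ⟨x', i', k'⟩ h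
    simp only [modelTFun, Prod.mk.injEq, add_left_inj] at h
    obtain ⟨rfl, rfl, h⟩ := h
    split_ifs at h with h1
    · have : k = k' := by
        have := congrArg (fun z => (n : ZMod M) ^ (l+1) * z) h
        simp only [← mul_assoc] at this
        rw [mul_comm _ u, hu] at this
        simpa using this
      simp [this]
    · simp [h]
  · rintro ⟨x, i, k⟩
    refine ⟨(x, i - 1, if i - 1 = Fin.last l then (n : ZMod M) ^ (l+1) * k else k), ?_⟩
    simp only [modelTFun, sub_add_cancel, Prod.mk.injEq, true_and]
    split_ifs with h1
    · rw [← mul_assoc, hu, one_mul]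
    · rfl

/-- The action of the generator `t` on the model. -/
noncomputable def modelT (u : ZMod M) (hu : u * (n : ZMod M) ^ (l+1) = 1) :
    Equiv.Perm (Z × Fin (l+1) × ZMod M) :=
  Equiv.ofBijective _ (modelT_bij Z n l M u hu)

theorem model_rel (u : ZMod M) (hu : u * (n : ZMod M) ^ (l+1) = 1) :
    (modelT Z n l M u hu)⁻¹ * modelA Z n l M (Multiplicative.ofAdd 1) * modelT Z n l M u hu =
      (modelA Z n l M (Multiplicative.ofAdd 1)) ^ n := by
  rw [mul_assoc, inv_mul_eq_iff_eq_mul, ← map_zpow, ← ofAdd_zsmul]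
  apply Equiv.ext
  rintro ⟨x, i, k⟩
  simp only [Equiv.Perm.mul_apply, modelT, Equiv.ofBijective_apply, modelTFun, modelA,
    MonoidHom.coe_mk, OneHom.coe_mk, Equiv.coe_fn_mk, toAdd_ofAdd, Prod.mk.injEq, true_and]
  by_cases h : i = Fin.last l
  · subst h
    simp only [if_true, Fin.last_add_one, Fin.val_zero, pow_zero, Fin.val_last]
    rw [mul_add, ← hu]
    simp
    ring
  · have hv : ((i + 1 : Fin (l+1)) : ℕ) = i + 1 := by
      rw [Fin.val_add_one, if_neg h]
    simp only [if_neg h, hv]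
    simp
    ring

end Model

/-! ### The tiling argument -/

theorem tiling {X : Type*} [Fintype X] [DecidableEq X] (n : ℤ) (l M Q K : ℕ)
    [NeZero M] (hQ : ∀ i : ℕ, i < l + 1 → (n ^ i).natAbs ≤ Q) (hM : Q * K ≤ M)
    (u : ZMod M) (hu : u * (n : ZMod M) ^ (l+1) = 1)
    (a t : Equiv.Perm X) (j h : X → ℕ) (Bad : Finset X)
    (ha : ∀ x, a x ∉ Bad → j (a x) = j x + 1 ∧ h (a x) = h x)
    (ht : ∀ x, t x ∉ Bad → h (t x) = h x + 1)
    (hrel : ∀ x, x ∉ Bad → ∀ k : ℕ, k < l + 1 →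
      a x = (t ^ (k:ℤ)) ((a ^ (n ^ k)) ((t ^ (-(k:ℤ))) x))) :
    ∃ qa qt : Equiv.Perm X, qt⁻¹ * qa * qt = qa ^ n ∧
      ∃ U : Finset X, U.card ≤ ((l+1) * M * (M * (l+1))) * Bad.card ∧
      (∃ B : Finset X, (Finset.univ.filter fun x => a x ≠ qa x) ⊆ U ∪ B ∧
        B.card * K ≤ Fintype.card X) ∧
      (∃ B : Finset X, (Finset.univ.filter fun x => t x ≠ qt x) ⊆ U ∪ B ∧
        B.card * (l+1) ≤ Fintype.card X) := by
  classical
  let T : Type _ := {x : X // h x % (l+1) = 0 ∧ j x % M = 0 ∧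
    ∀ i : ℕ, i < l + 1 → ∀ k : ℕ, k < M → (t ^ (i:ℤ)) ((a ^ (k:ℤ)) x) ∉ Bad}
  have hM0 : 0 < M := Nat.pos_of_ne_zero (NeZero.ne M)
  have succ_app : ∀ (p : Equiv.Perm X) (k : ℕ) (x : X),
      (p ^ ((k+1 : ℕ):ℤ)) x = p ((p ^ (k:ℤ)) x) := by
    intro p k x
    push_cast
    rw [add_comm, zpow_add, zpow_one]; rfl
  have pred_app : ∀ (p : Equiv.Perm X) (k : ℕ) (x : X),
      p ((p ^ (-((k+1 : ℕ):ℤ))) x) = (p ^ (-(k:ℤ))) x := by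
    intro p k x
    have : p ^ (-(k:ℤ)) = p * p ^ (-((k+1 : ℕ):ℤ)) := by
      rw [← zpow_one_add]; congr 1; push_cast; ring
    rw [this]; rfl
  have hTa : ∀ (x : T) (k : ℕ), k < M → j ((a ^ (k:ℤ)) x.1) = j x.1 + k ∧
      h ((a ^ (k:ℤ)) x.1) = h x.1 := by
    intro x k
    induction k with
    | zero => simp
    | succ k ih =>
      intro hk
      obtain ⟨h1, h2⟩ := ih (by omega)
      have h3 := x.2.2.2 0 (by omega) (k+1) hk
      rw [succ_app] at h3 ⊢
      simp only [Nat.cast_zero, zpow_zero, Equiv.Perm.one_apply] at h3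
      obtain ⟨h4, h5⟩ := ha _ h3
      rw [h4, h5, h1, h2]
      exact ⟨by ring, rfl⟩
  have hTt : ∀ (x : T) (k : ℕ), k < M → ∀ i : ℕ, i < l + 1 →
      h ((t ^ (i:ℤ)) ((a ^ (k:ℤ)) x.1)) = h x.1 + i := by
    intro x k hk i
    induction i with
    | zero => simpa using (hTa x k hk).2
    | succ i ih =>
      intro hi
      have h1 := ih (by omega)
      have h3 := x.2.2.2 (i+1) hi k hk
      rw [succ_app] at h3 ⊢
      rw [ht _ h3, h1]
      ring
  let Y : Type _ := T × Fin (l+1) × ZMod M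
  let Φ : Y → X := fun y => (t ^ (((y.2.1 : ℕ)):ℤ)) ((a ^ ((y.2.2.val : ℕ):ℤ)) y.1.1)
  have hΦ : Function.Injective Φ := by
    rintro ⟨x, i, k⟩ ⟨x', i', k'⟩ he
    have hk : k.val < M := ZMod.val_lt k
    have hk' : k'.val < M := ZMod.val_lt k'
    simp only [Φ] at he
    have e1 := hTt x k.val hk i i.2
    have e2 := hTt x' k'.val hk' i' i'.2
    rw [he, e2] at e1
    have hii : i = i' := by
      have h1 : (h x'.1 + i') % (l+1) = (h x.1 + i) % (l+1) := by rw [e1]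
      rw [Nat.add_mod, x'.2.1, Nat.add_mod (h x.1), x.2.1] at h1
      simp only [zero_add, Nat.mod_eq_of_lt i.2, Nat.mod_eq_of_lt i'.2] at h1
      exact Fin.ext h1.symm
    subst hii
    have he2 := (t ^ (((i : ℕ)):ℤ)).injective he
    have f1 := (hTa x k.val hk).1
    have f2 := (hTa x' k'.val hk').1
    rw [he2, f2] at f1
    have hkk : k.val = k'.val := by
      have h1 : (j x'.1 + k'.val) % M = (j x.1 + k.val) % M := by rw [f1]
      rw [Nat.add_mod, x'.2.2.1, Nat.add_mod (j x.1), x.2.2.1] at h1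
      simp only [zero_add, Nat.mod_eq_of_lt hk, Nat.mod_eq_of_lt hk'] at h1
      exact h1.symm
    have hkk' : k = k' := ZMod.val_injective M hkk
    subst hkk'
    have hxx : x = x' := Subtype.ext ((a ^ ((k.val : ℕ):ℤ)).injective he2)
    rw [hxx]
  let ι : Y ↪ X := ⟨Φ, hΦ⟩
  have hYcard : Fintype.card T * ((l+1) * M) ≤ Fintype.card X := by
    have := Fintype.card_le_of_embedding ι
    simpa [Y, ZMod.card] using this
  -- covering
  let Λ : Finset (ℕ × ℕ × ℕ × ℕ) :=
    Finset.range (l+1) ×ˢ Finset.range M ×ˢ Finset.range M ×ˢ Finset.range (l+1)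
  let g : ℕ × ℕ × ℕ × ℕ → Equiv.Perm X := fun z =>
    t ^ (z.1:ℤ) * a ^ (z.2.1:ℤ) * a ^ (-(z.2.2.1:ℤ)) * t ^ (-(z.2.2.2:ℤ))
  let U : Finset X := Λ.biUnion fun z => Bad.image (g z).symm
  have hUcard : U.card ≤ ((l+1) * M * (M * (l+1))) * Bad.card := by
    calc U.card ≤ ∑ z ∈ Λ, (Bad.image (g z).symm).card := Finset.card_biUnion_le
      _ ≤ ∑ z ∈ Λ, Bad.card := Finset.sum_le_sum fun z _ => Finset.card_image_le
      _ = _ := by simp [Λ, mul_assoc]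
  have hcover : ∀ z, z ∉ U → ∃ y, Φ y = z := by
    intro z hz
    have hgood : ∀ i k k' i' : ℕ, i < l+1 → k < M → k' < M → i' < l+1 →
        (t ^ (i:ℤ)) ((a ^ (k:ℤ)) ((a ^ (-(k':ℤ))) ((t ^ (-(i':ℤ))) z))) ∉ Bad := by
      intro i k k' i' hi hk hk' hi' hb
      apply hz
      simp only [U, Finset.mem_biUnion]
      refine ⟨(i, k, k', i'), ?_, ?_⟩
      · simp only [Λ, Finset.mem_product, Finset.mem_range]
        exact ⟨hi, hk, hk', hi'⟩
      · refine Finset.mem_image.2 ⟨_, hb, ?_⟩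
        rw [Equiv.symm_apply_eq]
        rfl
    have s1 : ∀ s : ℕ, s ≤ l → h ((t ^ (-(s:ℤ))) z) + s = h z := by
      intro s
      induction s with
      | zero => simp
      | succ s ih =>
        intro hs
        have h1 := hgood 0 0 0 s (by omega) hM0 hM0 (by omega)
        simp only [Nat.cast_zero, zpow_zero, Equiv.Perm.one_apply, neg_zero] at h1
        rw [← pred_app] at h1
        have h2 := ht _ h1
        rw [pred_app] at h2
        have h3 := ih (by omega)
        omega
    set i := h z % (l+1) with hi
    have hil : i < l + 1 := Nat.mod_lt _ (by omega)
    set w := (t ^ (-(i:ℤ))) z with hw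
    have hwh : h w % (l+1) = 0 := by
      have h1 : h w + i = h z := s1 i (by omega)
      have h2 : h w = h z - i := by omega
      rw [h2, hi]
      exact Nat.sub_mod_eq_zero_of_mod_eq (by simp)
    have s2 : ∀ s : ℕ, s < M → j ((a ^ (-(s:ℤ))) w) + s = j w ∧ h ((a ^ (-(s:ℤ))) w) = h w := by
      intro s
      induction s with
      | zero => simp
      | succ s ih =>
        intro hs
        have h1 := hgood 0 0 s i (by omega) hM0 (by omega) hil
        simp only [Nat.cast_zero, zpow_zero, Equiv.Perm.one_apply] at h1
        rw [← hw, ← pred_app] at h1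
        obtain ⟨h2, h2'⟩ := ha _ h1
        rw [pred_app] at h2 h2'
        obtain ⟨h3, h3'⟩ := ih (by omega)
        constructor
        · omega
        · omega
    set k := j w % M with hk
    have hkM : k < M := Nat.mod_lt _ hM0
    obtain ⟨hj, hh⟩ := s2 k hkM
    set x := (a ^ (-(k:ℤ))) w with hx
    have hxj : j x % M = 0 := by
      have h2 : j x = j w - k := by omega
      rw [h2, hk]
      exact Nat.sub_mod_eq_zero_of_mod_eq (by simp)
    refine ⟨(⟨x, by rw [hh]; exact hwh, hxj, ?_⟩, ⟨i, hil⟩, (k : ZMod M)), ?_⟩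
    · intro i' hi' k' hk'
      exact hgood i' k' k i hi' hk' hkM hil
    · simp only [Φ]
      rw [ZMod.val_cast_of_lt hkM, hx, hw]
      simp
  -- the new permutations
  let Pa : Equiv.Perm Y := modelA T n l M (Multiplicative.ofAdd 1)
  let Pt : Equiv.Perm Y := modelT T n l M u hu
  have hP : Pt⁻¹ * Pa * Pt = Pa ^ n := model_rel T n l M u hu
  let qa : Equiv.Perm X := Equiv.Perm.viaEmbeddingHom ι Pa
  let qt : Equiv.Perm X := Equiv.Perm.viaEmbeddingHom ι Pt
  have hqa : ∀ y, qa (Φ y) = Φ (Pa y) := fun y => Equiv.Perm.viaEmbedding_apply Pa ι y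
  have hqt : ∀ y, qt (Φ y) = Φ (Pt y) := fun y => Equiv.Perm.viaEmbedding_apply Pt ι y
  refine ⟨qa, qt, ?_, U, hUcard, ?_, ?_⟩
  · have := congrArg (Equiv.Perm.viaEmbeddingHom ι) hP
    simpa only [map_mul, map_inv, map_zpow] using this
  · let BY : Finset Y := Finset.univ.filter fun y =>
      ¬ (0 ≤ (y.2.2.val : ℤ) + n ^ (y.2.1 : ℕ) ∧ (y.2.2.val : ℤ) + n ^ (y.2.1 : ℕ) < M)
    have hBY : BY.card ≤ Fintype.card T * ((l+1) * Q) := by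
      have hc : ((Finset.univ : Finset T) ×ˢ (Finset.univ : Finset (Fin (l+1))) ×ˢ
          Finset.range Q).card = Fintype.card T * ((l+1) * Q) := by
        simp
      rw [← hc]
      apply Finset.card_le_card_of_injOn (fun y : Y => (y.1, y.2.1,
        if 0 ≤ n ^ (y.2.1 : ℕ) then M - 1 - y.2.2.val else y.2.2.val))
      · rintro ⟨x, i, k⟩ hy
        have hkM : k.val < M := ZMod.val_lt k
        have hq := hQ i i.2
        simp only [BY, Finset.coe_filter, Finset.mem_univ, true_and, Set.mem_ofPred_eq] at hy
        simp only [Finset.coe_product, Finset.coe_univ, Finset.coe_range, Set.mem_prod,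
          Set.mem_univ, true_and, Set.mem_Iio]
        generalize n ^ (i:ℕ) = m at *
        split_ifs <;> omega
      · rintro ⟨x, i, k⟩ hy ⟨x', i', k'⟩ hy' he
        have hkM : k.val < M := ZMod.val_lt k
        have hkM' : k'.val < M := ZMod.val_lt k'
        simp only [Prod.mk.injEq] at he
        obtain ⟨rfl, rfl, he⟩ := he
        have : k.val = k'.val := by
          split_ifs at he <;> omega
        rw [ZMod.val_injective M this]
    refine ⟨BY.image Φ, ?_, ?_⟩
    · intro z hz
      simp only [Finset.mem_filter, Finset.mem_univ, true_and] at hz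
      by_contra hcon
      rw [Finset.mem_union, not_or] at hcon
      obtain ⟨y, rfl⟩ := hcover z hcon.1
      have hy : y ∉ BY := fun hh => hcon.2 (Finset.mem_image_of_mem Φ hh)
      apply hz
      rw [hqa]
      obtain ⟨x, i, k⟩ := y
      simp only [BY, Finset.mem_filter, Finset.mem_univ, true_and, not_not] at hy
      obtain ⟨hy0, hy1⟩ := hy
      have hkM : k.val < M := ZMod.val_lt k
      have hval : (((k + (n : ZMod M) ^ (i:ℕ)).val : ℕ) : ℤ) = (k.val : ℤ) + n ^ (i:ℕ) := by
        obtain ⟨v, hv⟩ := Int.eq_ofNat_of_zero_le hy0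
        have h1 : k + (n : ZMod M) ^ (i:ℕ) = (v : ZMod M) := by
          have := congrArg (Int.cast : ℤ → ZMod M) hv
          simpa using this
        rw [h1, ZMod.val_cast_of_lt (by omega), hv]
      have h2 := hrel _ (x.2.2.2 i i.2 k.val hkM) i i.2
      have h3 : Φ (Pa (x, i, k)) = (t ^ ((i : ℕ):ℤ))
          ((a ^ (((k + (n : ZMod M) ^ (i:ℕ)).val : ℕ) : ℤ)) x.1) := by
        simp [Φ, Pa, modelA]
      rw [h3, hval]
      simp only [Φ]
      rw [h2, add_comm (k.val : ℤ), zpow_add]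
      simp
    · calc (BY.image Φ).card * K ≤ (Fintype.card T * ((l+1) * Q)) * K :=
          Nat.mul_le_mul_right _ (Finset.card_image_le.trans hBY)
        _ = Fintype.card T * ((l+1) * (Q * K)) := by ring
        _ ≤ Fintype.card T * ((l+1) * M) := by gcongr
        _ ≤ _ := hYcard
  · let BY : Finset Y := Finset.univ.filter fun y => y.2.1 = Fin.last l
    have hBY : BY.card ≤ Fintype.card T * M := by
      have hc : ((Finset.univ : Finset T) ×ˢ (Finset.univ : Finset (ZMod M))).card =
          Fintype.card T * M := by
        simp [ZMod.card]
      rw [← hc]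
      apply Finset.card_le_card_of_injOn (fun y : Y => (y.1, y.2.2)) (by intro y _; simp)
      rintro ⟨x, i, k⟩ hy ⟨x', i', k'⟩ hy' he
      simp only [BY, Finset.coe_filter, Finset.mem_univ, true_and, Set.mem_ofPred_eq] at hy hy'
      simp only [Prod.mk.injEq] at he
      rw [hy, hy', he.1, he.2]
    refine ⟨BY.image Φ, ?_, ?_⟩
    · intro z hz
      simp only [Finset.mem_filter, Finset.mem_univ, true_and] at hz
      by_contra hcon
      rw [Finset.mem_union, not_or] at hcon
      obtain ⟨y, rfl⟩ := hcover z hcon.1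
      have hy : y ∉ BY := fun hh => hcon.2 (Finset.mem_image_of_mem Φ hh)
      apply hz
      rw [hqt]
      obtain ⟨x, i, k⟩ := y
      simp only [BY, Finset.mem_filter, Finset.mem_univ, true_and] at hy
      have hv : ((i + 1 : Fin (l+1)) : ℕ) = i + 1 := by
        rw [Fin.val_add_one, if_neg hy]
      have h3 : Φ (Pt (x, i, k)) = (t ^ (((i + 1 : Fin (l+1)) : ℕ):ℤ))
          ((a ^ ((k.val : ℕ) : ℤ)) x.1) := by
        simp only [Φ, Pt, modelT, Equiv.ofBijective_apply, modelTFun, if_neg hy]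
      rw [h3, hv, succ_app]
    · calc (BY.image Φ).card * (l+1) ≤ (Fintype.card T * M) * (l+1) :=
          Nat.mul_le_mul_right _ (Finset.card_image_le.trans hBY)
        _ = Fintype.card T * ((l+1) * M) := by ring
        _ ≤ _ := hYcard

/-- The relator word of the Baumslag–Solitar group `BS(1, n)` is weakly stable
in permutations, for every nonzero integer `n`. -/
theorem BS_one_n_weakly_stable (n : ℤ) (hn : n ≠ 0) :
    WeaklyStable ({genT⁻¹ * genA * genT * genA ^ (-n)} : Finset (FreeGroup (Fin 2))) := by
  classical
  intro ε hε
  obtain ⟨l, hl⟩ := exists_nat_gt (4 / ε)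
  obtain ⟨K, hK⟩ := exists_nat_gt (4 / ε)
  have hK0 : (0:ℝ) < K := lt_trans (by positivity) hK
  have hn1 : 1 ≤ n.natAbs := Int.natAbs_pos.2 hn
  set Q : ℕ := n.natAbs ^ (l+1) with hQ
  have hQ1 : 1 ≤ Q := Nat.one_le_pow _ _ hn1
  set M : ℕ := Q * Q * K + 1 with hM
  have hM0 : (0:ℝ) < M := by positivity
  have : NeZero M := ⟨by omega⟩
  have hu : (-((n : ZMod M) ^ (l+1) * K)) * (n : ZMod M) ^ (l+1) = 1 := by
    have h1 : ((M : ℕ) : ZMod M) = 0 := ZMod.natCast_self M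
    have h2 : ((Q * Q : ℕ) : ZMod M) = (n : ZMod M) ^ (l+1) * (n : ZMod M) ^ (l+1) := by
      have h3 : ((Q * Q : ℕ) : ℤ) = n ^ (l+1) * n ^ (l+1) := by
        rw [hQ, ← mul_pow, ← mul_pow]
        push_cast
        rw [abs_mul_abs_self]
      have := congrArg (Int.cast : ℤ → ZMod M) h3
      rw [Int.cast_natCast] at this
      rw [this]
      push_cast
      ring
    rw [hM] at h1
    rw [Nat.cast_add, Nat.cast_mul, h2, Nat.cast_one] at h1
    linear_combination -h1
  obtain ⟨δ, hδ, hmain⟩ := heights n hn (ε / 4 / (((l+1) * M * (M * (l+1)) : ℕ) : ℝ))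
    (by positivity) (l+1)
  refine ⟨δ, hδ, fun N p hp => ?_⟩
  obtain ⟨j, h, Bad, hBad, h1, h2, h3⟩ := hmain N p hp
  obtain ⟨qa, qt, hrel, U, hU, ⟨B, hB, hBc⟩, ⟨B', hB', hBc'⟩⟩ := tiling n l M Q K
    (by
      intro i hi
      rw [Int.natAbs_pow]
      exact Nat.pow_le_pow_right hn1 hi.le)
    (by
      rw [hM]
      nlinarith [Nat.mul_le_mul_right (Q * K) hQ1])
    _ hu (p 0) (p 1) j h Bad h1 h2 h3
  refine ⟨![qa, qt], ?_, ?_⟩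
  · intro ξ hξ
    rw [Finset.mem_singleton] at hξ
    subst hξ
    simp only [evalWord_mul, evalWord_inv, evalWord_zpow, evalWord_genA, evalWord_genT]
    simp [hrel]
  · rcases Nat.eq_zero_or_pos N with h0 | hN
    · subst h0
      intro i
      simpa [dH] using hε
    have hN' : (0:ℝ) < N := by exact_mod_cast hN
    have hUr : (U.card : ℝ) ≤ ε / 4 * N := by
      have hc : (0:ℝ) < (((l+1) * M * (M * (l+1)) : ℕ) : ℝ) := by positivity
      calc (U.card : ℝ) ≤ (((l+1) * M * (M * (l+1)) : ℕ) : ℝ) * Bad.card := by exact_mod_cast hU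
        _ ≤ (((l+1) * M * (M * (l+1)) : ℕ) : ℝ) *
            (ε / 4 / (((l+1) * M * (M * (l+1)) : ℕ) : ℝ) * N) := by gcongr
        _ = _ := by field_simp
    have key : ∀ (s : Finset (Fin N)) (B : Finset (Fin N)) (m : ℕ), 4 / ε < m → s ⊆ U ∪ B →
        B.card * m ≤ Fintype.card (Fin N) → (s.card : ℝ) / N < ε := by
      intro s B m hm hs hb
      have hm0 : (0:ℝ) < m := lt_trans (by positivity) hm
      have e1 : (s.card : ℝ) ≤ U.card + B.card := by
        exact_mod_cast (Finset.card_le_card hs).trans (Finset.card_union_le _ _)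
      rw [Fintype.card_fin] at hb
      have e2 : (B.card : ℝ) * m ≤ N := by exact_mod_cast hb
      rw [div_lt_iff₀ hε] at hm
      have e3 : (B.card : ℝ) * 4 ≤ ε * N := by
        have h4 : (B.card : ℝ) * 4 ≤ B.card * (m * ε) := by gcongr
        nlinarith
      rw [div_lt_iff₀ hN']
      have : 0 < ε * N := by positivity
      linarith
    intro i
    fin_cases i
    · exact key _ B K hK hB hBc
    · exact key _ B' (l+1) (by push_cast; linarith) hB' hBc'
end
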